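/- arXiv:0904.1301 — 2 statements merged into one kernel-verified Lean document; each statement's English description precedes it below -/
import Mathlib

section
/- Let g^Δ be a semicosimplicial DGLA over K. The projection π : Z¹_sc(exp g^Δ) → H¹_sc(exp g^Δ) is a smooth morphism of functors of Artin rings: for every surjection B → A in Art_K, the induced map Z¹_sc(exp g^Δ)(B) → H¹_sc(exp g^Δ)(B) ×_{H¹_sc(exp g^Δ)(A)} Z¹_sc(exp g^Δ)(A) is surjective. -/
open scoped TensorProduct Classical

noncomputable section

/-- The data of a (pre-)differential graded Lie algebra over `K`: a `K`-vector
space together with degree projections `proj i` (giving the grading), a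
differential `d` and a bilinear bracket `br`.  The axioms are collected in
`PreDGLA.IsDGLA` below. -/
structure PreDGLA (K : Type) [Field K] where
  carrier : Type
  [acg : AddCommGroup carrier]
  [mod : Module K carrier]
  proj : ℤ → (carrier →ₗ[K] carrier)
  d : carrier →ₗ[K] carrier
  br : carrier →ₗ[K] carrier →ₗ[K] carrier

attribute [instance] PreDGLA.acg PreDGLA.mod

namespace PreDGLA

variable {K : Type} [Field K]

/-- The degree `i` homogeneous component `L^i`. -/
def comp (L : PreDGLA K) (i : ℤ) : Submodule K L.carrier :=
  LinearMap.ker (L.proj i - LinearMap.id)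

/-- The sign `(-1)^i` as an integer. -/
def sgn (i : ℤ) : ℤ := ((Int.negOnePow i : ℤˣ) : ℤ)

/-- The axioms making a `PreDGLA` an honest differential graded Lie algebra:
the projections form a grading, `d` is a degree `1` differential, and the
bracket is graded (graded antisymmetry, graded Jacobi, graded Leibniz). -/
structure IsDGLA (L : PreDGLA K) : Prop where
  proj_idem : ∀ i x, L.proj i (L.proj i x) = L.proj i x
  proj_orth : ∀ i j x, i ≠ j → L.proj i (L.proj j x) = 0
  proj_finite : ∀ x, (Function.support fun i => L.proj i x).Finite
  proj_total : ∀ x, (∑ᶠ i, L.proj i x) = x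
  d_sq : ∀ x, L.d (L.d x) = 0
  d_deg : ∀ i, ∀ x ∈ L.comp i, L.d x ∈ L.comp (i + 1)
  br_deg : ∀ i j, ∀ x ∈ L.comp i, ∀ y ∈ L.comp j, L.br x y ∈ L.comp (i + j)
  antisymm : ∀ i j, ∀ x ∈ L.comp i, ∀ y ∈ L.comp j,
      L.br x y = -(sgn (i * j) • L.br y x)
  jacobi : ∀ i j, ∀ x ∈ L.comp i, ∀ y ∈ L.comp j, ∀ z,
      L.br x (L.br y z) = L.br (L.br x y) z + sgn (i * j) • L.br y (L.br x z)
  leibniz : ∀ i, ∀ x ∈ L.comp i, ∀ y,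
      L.d (L.br x y) = L.br (L.d x) y + sgn i • L.br x (L.d y)

/-- Morphisms of (pre-)DGLAs: linear maps commuting with differentials,
brackets and the grading. -/
structure Hom (L M : PreDGLA K) where
  lin : L.carrier →ₗ[K] M.carrier
  map_d : ∀ x, lin (L.d x) = M.d (lin x)
  map_br : ∀ x y, lin (L.br x y) = M.br (lin x) (lin y)
  map_proj : ∀ i x, lin (L.proj i x) = M.proj i (lin x)

/-- The Maurer-Cartan set: degree one elements satisfying
`d x + ½ [x,x] = 0`. -/
def MCset (L : PreDGLA K) : Set L.carrier :=
  {x | x ∈ L.comp 1 ∧ L.d x + (2 : K)⁻¹ • L.br x x = 0}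

/-- The gauge action `e^a * x = x + Σ_{n≥0} (ad_a)^n([a,x] - d a)/(n+1)!`. -/
def gauge (L : PreDGLA K) (a x : L.carrier) : L.carrier :=
  x + ∑ᶠ n : ℕ, ((((n + 1).factorial : K))⁻¹ •
    ((L.br a ^ n) (L.br a x - L.d a)))

/-- Right-nested Lie monomial on a list of elements. -/
def nb (L : PreDGLA K) : List L.carrier → L.carrier
  | [] => 0
  | [x] => x
  | x :: y :: xs => L.br x (nb L (y :: xs))

/-- The word `a^{r_1} b^{s_1} ⋯ a^{r_{n+1}} b^{s_{n+1}}` appearing in Dynkin's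
formula. -/
def dynkinWord (L : PreDGLA K) (a b : L.carrier) (n : ℕ)
    (rs : Fin (n + 1) → ℕ × ℕ) : List L.carrier :=
  (List.finRange (n + 1)).flatMap fun i =>
    List.replicate (rs i).1 a ++ List.replicate (rs i).2 b

/-- The coefficient in Dynkin's explicit formula for the
Baker-Campbell-Hausdorff series. -/
def dynkinCoeff (K : Type) [Field K] (n : ℕ) (rs : Fin (n + 1) → ℕ × ℕ) : K :=
  if ∀ i, 1 ≤ (rs i).1 + (rs i).2 then
    ((-1 : K) ^ n / ((n : K) + 1)) *
      ((∑ i, ((rs i).1 + (rs i).2) : ℕ) : K)⁻¹ *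
      ((∏ i, ((rs i).1.factorial * (rs i).2.factorial) : ℕ) : K)⁻¹
  else 0

/-- The Baker-Campbell-Hausdorff product `a • b = log(e^a e^b)`, via Dynkin's
explicit formula.  (In the nilpotent situations where it is used only finitely
many terms are non-zero.) -/
def bch (L : PreDGLA K) (a b : L.carrier) : L.carrier :=
  ∑ᶠ p : (Σ n : ℕ, Fin (n + 1) → ℕ × ℕ),
    dynkinCoeff K p.1 p.2 • L.nb (L.dynkinWord a b p.1 p.2)

/-- The irrelevant stabilizer `Stab(x) = {d h + [x,h] : h ∈ L^{-1}}`. -/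
def Stab (L : PreDGLA K) (x : L.carrier) : Set L.carrier :=
  {y | ∃ h ∈ L.comp (-1), y = L.d h + L.br x h}

/-- Gauge equivalence of two elements: `y = e^a * x` for some degree zero `a`. -/
def gaugeEquiv (L : PreDGLA K) (x y : L.carrier) : Prop :=
  ∃ a ∈ L.comp 0, L.gauge a x = y

/-- The deformation set: Maurer-Cartan elements modulo gauge equivalence. -/
def DefSpace (L : PreDGLA K) : Type :=
  Quot (fun x y : L.MCset => L.gaugeEquiv x.1 y.1)

end PreDGLA

/-- A local Artinian `K`-algebra with residue field `K`. -/
structure ArtinData (K : Type) [Field K] where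
  A : Type
  [cring : CommRing A]
  [alg : Algebra K A]
  [isLocal : IsLocalRing A]
  isArtinian : IsArtinianRing A
  residue_field : ∀ a : A, ∃ c : K, a - algebraMap K A c ∈ IsLocalRing.maximalIdeal A

attribute [instance] ArtinData.cring ArtinData.alg ArtinData.isLocal

namespace ArtinData

variable {K : Type} [Field K]

/-- The maximal ideal, as a `K`-submodule. -/
def mId (R : ArtinData K) : Submodule K R.A :=
  Submodule.restrictScalars K (IsLocalRing.maximalIdeal R.A)

/-- Multiplication on the maximal ideal, as a `K`-bilinear map. -/
def mmul (R : ArtinData K) : R.mId →ₗ[K] R.mId →ₗ[K] R.mId where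
  toFun a :=
    { toFun := fun b => ⟨a.1 * b.1, Ideal.mul_mem_left _ _ b.2⟩
      map_add' := by intro b c; ext; simp [mul_add]
      map_smul' := by intro k b; ext; simp [Algebra.mul_smul_comm] }
  map_add' := by intro a b; ext; simp [add_mul]
  map_smul' := by intro k a; ext; simp [Algebra.smul_mul_assoc]

end ArtinData

/-- Tensoring a DGLA with the maximal ideal of a local Artinian algebra:
`L ⊗ m_A`, with the induced grading, differential and bracket. -/
def PreDGLA.tmA {K : Type} [Field K] (L : PreDGLA K) (R : ArtinData K) :
    PreDGLA K where
  carrier := L.carrier ⊗[K] R.mId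
  proj := fun i => LinearMap.rTensor _ (L.proj i)
  d := LinearMap.rTensor _ L.d
  br := TensorProduct.curry
    ((TensorProduct.map (TensorProduct.lift L.br) (TensorProduct.lift R.mmul)).comp
      (TensorProduct.tensorTensorTensorComm K L.carrier R.mId L.carrier R.mId).toLinearMap)

/-- A morphism of Artinian base algebras. -/
structure ArtinHom {K : Type} [Field K] (R S : ArtinData K) where
  toAlg : R.A →ₐ[K] S.A
  maps_m : ∀ x : R.A, x ∈ R.mId → toAlg x ∈ S.mId

namespace ArtinHom

variable {K : Type} [Field K] {R S : ArtinData K}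

/-- The induced linear map on maximal ideals. -/
def mLin (f : ArtinHom R S) : R.mId →ₗ[K] S.mId where
  toFun x := ⟨f.toAlg x.1, f.maps_m x.1 x.2⟩
  map_add' := by intro a b; ext; simp
  map_smul' := by intro k a; ext; simp [Algebra.smul_def]

/-- The induced map `L ⊗ m_R → L ⊗ m_S`. -/
def tmap (f : ArtinHom R S) (L : PreDGLA K) :
    (L.tmA R).carrier →ₗ[K] (L.tmA S).carrier :=
  LinearMap.lTensor L.carrier f.mLin

end ArtinHom

/-- A semicosimplicial DGLA: a diagram `g_0 ⇉ g_1 ⇶ g_2 ⋯` of DGLAs, where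
`face n k : g_n → g_{n+1}` is the coface map `∂_{k,n+1}` (`k = 0, …, n+1`),
subject to the semicosimplicial identities. -/
structure ScDGLA (K : Type) [Field K] where
  g : ℕ → PreDGLA K
  isDGLA : ∀ n, (g n).IsDGLA
  face : ∀ n : ℕ, Fin (n + 2) → PreDGLA.Hom (g n) (g (n + 1))
  face_comm : ∀ (n : ℕ) (k l : Fin (n + 2)), (l : ℕ) ≤ (k : ℕ) → ∀ x,
    (face (n + 1) k.succ).lin ((face n l).lin x) =
      (face (n + 1) l.castSucc).lin ((face n k).lin x)

namespace ScDGLA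

variable {K : Type} [Field K]

/-- The tensored coface maps `∂_{k,n+1} ⊗ id : g_n ⊗ m_A → g_{n+1} ⊗ m_A`. -/
def faceT (G : ScDGLA K) (R : ArtinData K) (n : ℕ) (k : Fin (n + 2)) :
    ((G.g n).tmA R).carrier →ₗ[K] ((G.g (n + 1)).tmA R).carrier :=
  LinearMap.rTensor _ (G.face n k).lin

/-- The set `Z¹_sc(exp g^Δ)(A)` of semicosimplicial Maurer-Cartan data
`(l, m)`: `l` is Maurer-Cartan in `g_0 ⊗ m_A`, `m ∈ g_1^0 ⊗ m_A` conjugates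
the two pullbacks of `l`, and satisfies the cocycle condition up to homotopy
on `g_2`. -/
def Zsc (G : ScDGLA K) (R : ArtinData K) :
    Set (((G.g 0).tmA R).carrier × ((G.g 1).tmA R).carrier) :=
  {p | p.1 ∈ ((G.g 0).tmA R).MCset ∧ p.2 ∈ ((G.g 1).tmA R).comp 0 ∧
    G.faceT R 0 1 p.1 = ((G.g 1).tmA R).gauge p.2 (G.faceT R 0 0 p.1) ∧
    ∃ nn ∈ ((G.g 2).tmA R).comp (-1),
      ((G.g 2).tmA R).bch (G.faceT R 1 0 p.2)
          (((G.g 2).tmA R).bch (-(G.faceT R 1 1 p.2)) (G.faceT R 1 2 p.2)) =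
        ((G.g 2).tmA R).d nn +
          ((G.g 2).tmA R).br (G.faceT R 1 2 (G.faceT R 0 0 p.1)) nn}

/-- The equivalence relation `∼` on `Z¹_sc(exp g^Δ)(A)`. -/
def srel (G : ScDGLA K) (R : ArtinData K) :
    (((G.g 0).tmA R).carrier × ((G.g 1).tmA R).carrier) →
      (((G.g 0).tmA R).carrier × ((G.g 1).tmA R).carrier) → Prop :=
  fun p q =>
    ∃ a ∈ ((G.g 0).tmA R).comp 0, ∃ b ∈ ((G.g 1).tmA R).comp (-1),
      ((G.g 0).tmA R).gauge a p.1 = q.1 ∧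
      ((G.g 1).tmA R).bch (-p.2)
          (((G.g 1).tmA R).bch (-(G.faceT R 0 1 a))
            (((G.g 1).tmA R).bch q.2 (G.faceT R 0 0 a))) =
        ((G.g 1).tmA R).d b + ((G.g 1).tmA R).br (G.faceT R 0 0 p.1) b

/-- `H¹_sc(exp g^Δ)(A) = Z¹_sc(exp g^Δ)(A)/∼`. -/
def Hsc (G : ScDGLA K) (R : ArtinData K) : Type :=
  Quot (fun x y : (G.Zsc R) => G.srel R x.1 y.1)

end ScDGLA

/-- The map `Z¹_sc(exp g^Δ)(B) → Z¹_sc(exp g^Δ)(A)` induced by a morphism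
`B → A` of Artinian bases. -/
def ScDGLA.zmap {K : Type} [Field K] (G : ScDGLA K) {B A : ArtinData K}
    (f : ArtinHom B A) :
    (((G.g 0).tmA B).carrier × ((G.g 1).tmA B).carrier) →
      (((G.g 0).tmA A).carrier × ((G.g 1).tmA A).carrier) :=
  fun p => (f.tmap (G.g 0) p.1, f.tmap (G.g 1) p.2)

set_option linter.unusedSectionVars false

namespace BCHAux

open PowerSeries

section nev

variable {K : Type*} [Field K] {R : Type*} [Ring R] [Algebra K R]

/-- Evaluation of a formal power series at a nilpotent element. -/
def nev (f : K⟦X⟧) (x : R) : R := ∑ᶠ n : ℕ, coeff n f • x ^ n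

theorem nev_eq_sum {x : R} {N : ℕ} (h : x ^ N = 0) (f : K⟦X⟧) :
    nev f x = ∑ n ∈ Finset.range N, coeff n f • x ^ n := by
  unfold nev
  apply finsum_eq_sum_of_support_subset
  intro n hn
  simp only [Finset.coe_range, Set.mem_Iio]
  by_contra hc
  apply hn
  simp [pow_eq_zero_of_le (not_lt.1 hc) h]

theorem nev_eq_aeval {x : R} {N : ℕ} (h : x ^ N = 0) (f : K⟦X⟧) :
    nev f x = Polynomial.aeval x (trunc N f) := by
  rw [nev_eq_sum h, Polynomial.aeval_def, eval₂_trunc_eq_sum_range]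
  simp [Algebra.smul_def]

theorem nev_coe {x : R} (h : IsNilpotent x) (p : Polynomial K) :
    nev (p : K⟦X⟧) x = Polynomial.aeval x p := by
  obtain ⟨N, hN⟩ := h
  rw [nev_eq_aeval (N := max N (p.natDegree + 1)) (pow_eq_zero_of_le (le_max_left _ _) hN),
    trunc_coe_eq_self]
  exact lt_of_lt_of_le (Nat.lt_succ_self _) (le_max_right _ _)

theorem nev_mul {x : R} (h : IsNilpotent x) (f g : K⟦X⟧) :
    nev (f * g) x = nev f x * nev g x := by
  have hx := h
  obtain ⟨N, hN⟩ := h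
  rw [nev_eq_aeval hN f, nev_eq_aeval hN g, ← map_mul, nev_eq_aeval hN, ← trunc_trunc_mul_trunc,
    ← Polynomial.coe_mul, ← nev_eq_aeval hN, nev_coe hx]

theorem nev_add {x : R} (h : IsNilpotent x) (f g : K⟦X⟧) :
    nev (f + g) x = nev f x + nev g x := by
  obtain ⟨N, hN⟩ := h
  simp only [nev_eq_aeval hN, map_add]

theorem nev_sub {x : R} (h : IsNilpotent x) (f g : K⟦X⟧) :
    nev (f - g) x = nev f x - nev g x := by
  obtain ⟨N, hN⟩ := h
  simp only [nev_eq_aeval hN, map_sub]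

theorem nev_one {x : R} (h : IsNilpotent x) : nev (1 : K⟦X⟧) x = 1 := by
  have := nev_coe h (1 : Polynomial K)
  simpa using this

theorem nev_X {x : R} (h : IsNilpotent x) : nev (X : K⟦X⟧) x = x := by
  have := nev_coe h (Polynomial.X : Polynomial K)
  simpa using this

theorem nev_pow {x : R} (h : IsNilpotent x) (f : K⟦X⟧) (n : ℕ) :
    nev (f ^ n) x = nev f x ^ n := by
  induction n with
  | zero => simpa using nev_one h
  | succ n ih => rw [pow_succ, nev_mul h, ih, pow_succ]

theorem nev_mem {x : R} (f : K⟦X⟧) (S : Submodule K R) (hS : ∀ n, x ^ n ∈ S) : nev f x ∈ S := by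
  unfold nev
  exact finsum_mem_induction' S f x hS
where finsum_mem_induction' (S : Submodule K R) (f : K⟦X⟧) (x : R) (hS : ∀ n, x ^ n ∈ S) :
    (∑ᶠ n : ℕ, coeff n f • x ^ n) ∈ S :=
  finsum_induction (· ∈ S) S.zero_mem (fun _ _ => S.add_mem) (fun n => S.smul_mem _ (hS n))

/-- Every power series without constant term is divisible by `X`. -/
theorem exists_X_mul {f : K⟦X⟧} (hf : constantCoeff f = 0) : ∃ h, f = X * h :=
  X_dvd_iff.2 hf

theorem nev_commute {x : R} (h : IsNilpotent x) (f g : K⟦X⟧) :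
    Commute (nev f x) (nev g x) := by
  show _ * _ = _ * _
  rw [← nev_mul h, ← nev_mul h, mul_comm]

theorem nev_nilp {x : R} (h : IsNilpotent x) {f : K⟦X⟧} (hf : constantCoeff f = 0) :
    IsNilpotent (nev f x) := by
  obtain ⟨g, rfl⟩ := exists_X_mul hf
  rw [nev_mul h, nev_X h]
  have := nev_commute h X g
  rw [nev_X h] at this
  exact this.isNilpotent_mul_right h

theorem nev_comp {x : R} (h : IsNilpotent x) {g : K⟦X⟧} (hg : constantCoeff g = 0)
    (f : K⟦X⟧) : nev f (nev g x) = nev (f.subst g) x := by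
  obtain ⟨N, hN⟩ := h
  have h : IsNilpotent x := ⟨N, hN⟩
  have hz : ∀ d n, n < d → coeff n (g ^ d) = 0 := by
    intro d n hnd
    have : X ^ d ∣ g ^ d := pow_dvd_pow_of_dvd (X_dvd_iff.2 hg) d
    exact X_pow_dvd_iff.1 this n hnd
  have hgN : nev g x ^ N = 0 := by
    rw [← nev_pow h, nev_eq_sum hN]
    apply Finset.sum_eq_zero
    intro n hn
    rw [hz N n (Finset.mem_range.1 hn), zero_smul]
  rw [nev_eq_sum hgN, nev_eq_sum hN (f.subst g)]
  have hpow : ∀ d, nev g x ^ d = ∑ n ∈ Finset.range N, coeff n (g ^ d) • x ^ n := by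
    intro d
    rw [← nev_pow h, nev_eq_sum hN]
  simp only [hpow, Finset.smul_sum]
  rw [Finset.sum_comm]
  apply Finset.sum_congr rfl
  intro n hn
  rw [coeff_subst' (HasSubst.of_constantCoeff_zero' hg),
    finsum_eq_sum_of_support_subset (s := Finset.range N), Finset.sum_smul]
  · simp [mul_smul]
  · intro d hd
    simp only [Finset.coe_range, Set.mem_Iio]
    by_contra hc
    apply hd
    simp [hz d n (lt_of_lt_of_le (Finset.mem_range.1 hn) (not_lt.1 hc))]

/-- Intertwining. -/
theorem nev_intertwine {V W : Type*} [AddCommGroup V] [Module K V] [AddCommGroup W] [Module K W]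
    {x : Module.End K V} {y : Module.End K W} (hx : IsNilpotent x) (hy : IsNilpotent y)
    (T : V →ₗ[K] W) (hT : ∀ v, T (x v) = y (T v)) (f : K⟦X⟧) (v : V) :
    T (nev f x v) = nev f y (T v) := by
  obtain ⟨N, hN⟩ := hx
  obtain ⟨M, hM⟩ := hy
  rw [nev_eq_sum (pow_eq_zero_of_le (le_max_left N M) hN),
    nev_eq_sum (pow_eq_zero_of_le (le_max_right N M) hM)]
  have hp : ∀ n v, T ((x ^ n) v) = (y ^ n) (T v) := by
    intro n
    induction n with
    | zero => simp
    | succ n ih => intro v; rw [pow_succ, pow_succ, Module.End.mul_apply, ih, hT]; rfl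
  simp [LinearMap.sum_apply, hp]

theorem nev_map {S : Type*} [Ring S] [Algebra K S] {x : R} (hx : IsNilpotent x)
    (T : R →ₐ[K] S) (f : K⟦X⟧) : T (nev f x) = nev f (T x) := by
  obtain ⟨N, hN⟩ := hx
  have : (T x) ^ N = 0 := by rw [← map_pow, hN, map_zero]
  rw [nev_eq_sum hN, nev_eq_sum this]
  simp

/-- Powers of an operator acting on a vector, as a finsum. -/
theorem nev_apply {V : Type*} [AddCommGroup V] [Module K V]
    {x : Module.End K V} (hx : IsNilpotent x) (f : K⟦X⟧) (v : V) :
    nev f x v = ∑ᶠ n : ℕ, coeff n f • (x ^ n) v := by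
  obtain ⟨N, hN⟩ := hx
  rw [nev_eq_sum hN, finsum_eq_sum_of_support_subset (s := Finset.range N)]
  · simp
  · intro d hd
    simp only [Finset.coe_range, Set.mem_Iio]
    by_contra hc
    apply hd
    simp [pow_eq_zero_of_le (not_lt.1 hc) hN]

end nev

section explog

variable {K : Type*} [Field K] [CharZero K]

/-- `(e^X - 1)/X`. -/
def phi (K : Type*) [Field K] : K⟦X⟧ := PowerSeries.mk fun n => (((n + 1).factorial : K))⁻¹

theorem coeff_exp' (n : ℕ) : coeff n (exp K) = ((n.factorial : K))⁻¹ := by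
  simp [coeff_exp]

theorem exp_eq_phi : exp K = 1 + X * phi K := by
  ext n
  rw [coeff_exp']
  cases n with
  | zero => simp
  | succ n => simp [phi, coeff_succ_X_mul, coeff_one]

theorem one_add_X_mul_dlog : (1 + X) * (d⁄dX K (log K)) = 1 := by
  rw [deriv_log]
  ext n
  cases n with
  | zero => simp
  | succ n => simp [add_mul, coeff_succ_X_mul, coeff_one, pow_succ]

theorem exp_subst_log : (exp K).subst (log K) = 1 + X := by
  set E := (exp K).subst (log K) with hE
  have h1 : (1 + X) * d⁄dX K E = E := by
    rw [hE, derivative_subst HasSubst.log, derivative_exp, mul_left_comm, one_add_X_mul_dlog,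
      mul_one]
  have h0 : constantCoeff E = 1 := by
    rw [hE, exp_eq_phi, subst_add HasSubst.log, subst_mul HasSubst.log, subst_X HasSubst.log]
    rw [map_add, map_mul, constantCoeff_log, zero_mul, add_zero,
      ← coe_substAlgHom HasSubst.log, map_one, map_one]
  have hrec : ∀ n : ℕ, coeff (n + 1) E * ((n : K) + 1) = coeff n E * (1 - n) := by
    intro n
    have := congrArg (coeff n) h1
    rw [add_mul, one_mul, map_add, coeff_derivative] at this
    cases n with
    | zero => simp at this ⊢; exact this
    | succ n =>
      rw [coeff_succ_X_mul, coeff_derivative] at this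
      push_cast at this ⊢
      linear_combination this
  have key : ∀ n : ℕ, coeff (n + 2) E = 0 := by
    intro n
    induction n with
    | zero =>
      have := hrec 1
      norm_num at this
      exact this
    | succ n ih =>
      have := hrec (n + 2)
      rw [ih, zero_mul] at this
      have h2 : (((n + 2 : ℕ) : K) + 1) ≠ 0 := by exact_mod_cast Nat.succ_ne_zero (n + 2)
      exact (mul_eq_zero.1 this).resolve_right h2
  ext n
  match n with
  | 0 => simp [h0]
  | 1 =>
    have := hrec 0
    simp [h0] at this
    simp [this, coeff_one]
  | n + 2 => rw [key]; simp [coeff_one, coeff_X]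

theorem log_subst_exp : (log K).subst (exp K - 1) = X := by
  set E := (log K).subst (exp K - 1) with hE
  have hs : HasSubst (exp K - 1) := HasSubst.exp_sub_one
  have h1 : d⁄dX K E = 1 := by
    rw [hE, derivative_subst hs, map_sub, derivative_exp]
    have h := congrArg (subst (exp K - 1)) (one_add_X_mul_dlog (K := K))
    rw [subst_mul hs, subst_add hs, subst_X hs, ← coe_substAlgHom hs, map_one] at h
    rw [coe_substAlgHom hs] at h
    have h1 : d⁄dX K (1 : K⟦X⟧) = 0 := by simp
    rw [h1, sub_zero, mul_comm]
    simpa using h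
  have h0 : constantCoeff E = 0 := by
    have := constantCoeff_logOf (f := exp K) (by simp [constantCoeff_exp])
    exact this
  ext n
  cases n with
  | zero => simp [h0]
  | succ n =>
    have := congrArg (coeff n) h1
    rw [coeff_derivative] at this
    have h2 : ((n : K) + 1) ≠ 0 := by exact_mod_cast Nat.succ_ne_zero n
    cases n with
    | zero => simpa [coeff_X] using this
    | succ n =>
      rw [coeff_one, if_neg (Nat.succ_ne_zero n)] at this
      rw [(mul_eq_zero.1 this).resolve_right h2]
      simp [coeff_X]

end explog

section nexp

variable {K : Type*} [Field K] [CharZero K] {R : Type*} [Ring R] [Algebra K R]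

/-- exponential of a nilpotent element -/
def nexp (K : Type*) [Field K] [CharZero K] {R : Type*} [Ring R] [Algebra K R] (x : R) : R :=
  nev (exp K) x

/-- logarithm of a unipotent element -/
def nlog (K : Type*) [Field K] [CharZero K] {R : Type*} [Ring R] [Algebra K R] (g : R) : R :=
  nev (log K) (g - 1)

theorem nexp_nlog {g : R} (h : IsNilpotent (g - 1)) : nexp K (nlog K g) = g := by
  unfold nexp nlog
  rw [nev_comp h constantCoeff_log, exp_subst_log, nev_add h, nev_one h, nev_X h]
  abel

theorem nexp_eq_phi {x : R} (h : IsNilpotent x) : nexp K x = 1 + x * nev (phi K) x := by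
  unfold nexp
  rw [exp_eq_phi, nev_add h, nev_mul h, nev_one h, nev_X h]

theorem nexp_eq_phi' {x : R} (h : IsNilpotent x) : nexp K x = 1 + nev (phi K) x * x := by
  unfold nexp
  rw [exp_eq_phi, mul_comm X, nev_add h, nev_mul h, nev_one h, nev_X h]

theorem phi_unit {x : R} (h : IsNilpotent x) : ∃ u : R, u * nev (phi K) x = 1 := by
  refine ⟨nev (phi K)⁻¹ x, ?_⟩
  rw [← nev_mul h, PowerSeries.inv_mul_cancel, nev_one h]
  simp [phi]

theorem nexp_sub_one_nilp {x : R} (h : IsNilpotent x) : IsNilpotent (nexp K x - 1) := by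
  unfold nexp
  rw [← nev_one (K := K) h, ← nev_sub h]
  exact nev_nilp h (by simp)

theorem nlog_nexp {x : R} (h : IsNilpotent x) : nlog K (nexp K x) = x := by
  unfold nlog nexp
  rw [← nev_one (K := K) h, ← nev_sub h, nev_comp h (by simp), log_subst_exp, nev_X h]

theorem nlog_nilp {g : R} (h : IsNilpotent (g - 1)) : IsNilpotent (nlog K g) :=
  nev_nilp h constantCoeff_log

theorem nexp_add {x y : R} (h : Commute x y) (hx : IsNilpotent x) (hy : IsNilpotent y) :
    nexp K (x + y) = nexp K x * nexp K y := by
  let _ : Module ℚ R := Module.compHom R (algebraMap ℚ K)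
  have key : ∀ z : R, IsNilpotent z → nexp K z = IsNilpotent.exp z := by
    rintro z ⟨N, hN⟩
    unfold nexp
    rw [IsNilpotent.exp_eq_sum hN, nev_eq_sum hN]
    apply Finset.sum_congr rfl
    intro n _
    rw [coeff_exp']
    show _ = (algebraMap ℚ K ((n.factorial : ℚ)⁻¹)) • z ^ n
    simp
  rw [key _ hx, key _ hy, key _ (h.isNilpotent_add hx hy), IsNilpotent.exp_add_of_commute h hx hy]

theorem nexp_zero : nexp K (0 : R) = 1 := by
  rw [nexp_eq_phi IsNilpotent.zero, zero_mul, add_zero]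

theorem nexp_mul_neg {x : R} (h : IsNilpotent x) : nexp K x * nexp K (-x) = 1 := by
  rw [← nexp_add (Commute.refl x).neg_right h h.neg, add_neg_cancel, nexp_zero]

theorem nexp_neg_mul {x : R} (h : IsNilpotent x) : nexp K (-x) * nexp K x = 1 := by
  rw [← nexp_add (Commute.refl x).neg_left h.neg h, neg_add_cancel, nexp_zero]

/-- The commutator operator. -/
def cad (K : Type*) [Field K] {R : Type*} [Ring R] [Algebra K R] (x : R) : Module.End K R :=
  LinearMap.mulLeft K x - LinearMap.mulRight K x

theorem cad_apply (x y : R) : cad K x y = x * y - y * x := rfl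

theorem cad_nilp {x : R} (h : IsNilpotent x) : IsNilpotent (cad K x) := by
  unfold cad
  apply Commute.isNilpotent_sub (LinearMap.commute_mulLeft_right x x)
  · obtain ⟨N, hN⟩ := h
    exact ⟨N, by rw [LinearMap.pow_mulLeft, hN, LinearMap.mulLeft_zero_eq_zero]⟩
  · obtain ⟨N, hN⟩ := h
    exact ⟨N, by rw [LinearMap.pow_mulRight, hN, LinearMap.mulRight_zero_eq_zero]⟩

theorem nexp_cad {x : R} (h : IsNilpotent x) (y : R) :
    nexp K (cad K x) y = nexp K x * y * nexp K (-x) := by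
  have hl : IsNilpotent (LinearMap.mulLeft K x) := by
    obtain ⟨N, hN⟩ := h
    exact ⟨N, by rw [LinearMap.pow_mulLeft, hN, LinearMap.mulLeft_zero_eq_zero]⟩
  have hr : IsNilpotent (LinearMap.mulRight K (-x)) := by
    obtain ⟨N, hN⟩ := h.neg
    exact ⟨N, by rw [LinearMap.pow_mulRight, hN, LinearMap.mulRight_zero_eq_zero]⟩
  have e : cad K x = LinearMap.mulLeft K x + LinearMap.mulRight K (-x) := by
    ext z; simp [cad_apply, sub_eq_add_neg]
  rw [e, nexp_add (LinearMap.commute_mulLeft_right x (-x)) hl hr]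
  have e1 : nexp K (LinearMap.mulLeft K x) = LinearMap.mulLeft K (nexp K x) := by
    have := nev_map h (Algebra.lmul K R) (exp K)
    exact this.symm
  have e2 : nexp K (LinearMap.mulRight K (-x)) = LinearMap.mulRight K (nexp K (-x)) := by
    obtain ⟨N, hN⟩ := h.neg
    have hN' : (LinearMap.mulRight K (-x)) ^ N = 0 := by
      rw [LinearMap.pow_mulRight, hN, LinearMap.mulRight_zero_eq_zero]
    unfold nexp
    rw [nev_eq_sum hN, nev_eq_sum hN']
    ext z
    simp [LinearMap.pow_mulRight, Finset.mul_sum, LinearMap.sum_apply]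
  rw [e1, e2]
  simp [mul_assoc]

end nexp

end BCHAux

set_option linter.unusedSectionVars false
set_option linter.unusedVariables false

namespace BCHAux

open PowerSeries

section filt

variable {K : Type*} [Field K] {V : Type*} [AddCommGroup V] [Module K V]

/-- A finite decreasing filtration. -/
structure IsFilt (F : ℕ → Submodule K V) (N : ℕ) : Prop where
  top : F 0 = ⊤
  bot : F N = ⊥
  anti : ∀ k, F (k + 1) ≤ F k

/-- Operators that strictly lower the filtration. -/
def low (F : ℕ → Submodule K V) : Submodule K (Module.End K V) where
  carrier := {T | ∀ k, ∀ v ∈ F k, T v ∈ F (k + 1)}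
  add_mem' := fun {S T} hS hT k v hv => (F (k + 1)).add_mem (hS k v hv) (hT k v hv)
  zero_mem' := fun k v _ => (F (k + 1)).zero_mem
  smul_mem' := fun c T hT k v hv => (F (k + 1)).smul_mem c (hT k v hv)

variable {F : ℕ → Submodule K V} {N : ℕ}

theorem IsFilt.anti_le (hF : IsFilt F N) {i j : ℕ} (h : i ≤ j) : F j ≤ F i :=
  antitone_nat_of_succ_le hF.anti h

theorem low_mul (hF : IsFilt F N) {S T : Module.End K V} (hS : S ∈ low F) (hT : T ∈ low F) :
    S * T ∈ low F := fun k v hv => hF.anti _ (hS _ _ (hT k v hv))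

theorem low_list {l : List (Module.End K V)} (h : ∀ T ∈ l, T ∈ low F) (k : ℕ) (v : V)
    (hv : v ∈ F k) : l.prod v ∈ F (k + l.length) := by
  induction l with
  | nil => simpa using hv
  | cons T l ih =>
    rw [List.prod_cons, List.length_cons, ← add_assoc]
    exact h T (by simp) _ _ (ih fun S hS => h S (by simp [hS]))

theorem low_list_zero (hF : IsFilt F N) {l : List (Module.End K V)} (h : ∀ T ∈ l, T ∈ low F)
    (hl : N ≤ l.length) : l.prod = 0 := by
  ext v
  have := low_list h 0 v (by rw [hF.top]; trivial)
  have := hF.anti_le (by omega : N ≤ 0 + l.length) this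
  rw [hF.bot] at this
  simpa using this

theorem low_pow_zero (hF : IsFilt F N) {T : Module.End K V} (hT : T ∈ low F) : T ^ N = 0 := by
  rw [← List.prod_replicate]
  apply low_list_zero hF
  · intro S hS; rw [List.eq_of_mem_replicate hS]; exact hT
  · simp

theorem low_nilp (hF : IsFilt F N) {T : Module.End K V} (hT : T ∈ low F) : IsNilpotent T :=
  ⟨N, low_pow_zero hF hT⟩

theorem low_pow (hF : IsFilt F N) {T : Module.End K V} (hT : T ∈ low F) (n : ℕ) :
    T ^ (n + 1) ∈ low F := by
  induction n with
  | zero => simpa using hT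
  | succ n ih => rw [pow_succ]; exact low_mul hF ih hT

theorem low_nev (hF : IsFilt F N) {T : Module.End K V} (hT : T ∈ low F) {f : K⟦X⟧}
    (hf : constantCoeff f = 0) : nev f T ∈ low F := by
  unfold nev
  refine finsum_induction (· ∈ low F) (low F).zero_mem (fun _ _ => (low F).add_mem) ?_
  intro n
  cases n with
  | zero => simp [hf]
  | succ n => exact (low F).smul_mem _ (low_pow hF hT n)

theorem low_unip (hF : IsFilt F N) [CharZero K] {S T : Module.End K V} (hS : S ∈ low F)
    (hT : T ∈ low F) : nexp K S * nexp K T - 1 ∈ low F := by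
  have h1 : ∀ S ∈ low F, nexp K S - 1 ∈ low F := by
    intro S hS
    unfold nexp
    rw [← nev_one (K := K) (low_nilp hF hS), ← nev_sub (low_nilp hF hS)]
    exact low_nev hF hS (by simp)
  have e : nexp K S * nexp K T - 1 =
      (nexp K S - 1) * (nexp K T - 1) + ((nexp K S - 1) + (nexp K T - 1)) := by noncomm_ring
  rw [e]
  exact (low F).add_mem (low_mul hF (h1 S hS) (h1 T hT)) ((low F).add_mem (h1 S hS) (h1 T hT))

end filt

section words

theorem sum_pow_expand {R ι : Type*} [Semiring R] (S : Finset ι) (h : ι → R) (n : ℕ) :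
    (∑ q ∈ S, h q) ^ n =
      ∑ rs ∈ Fintype.piFinset (fun _ : Fin n => S), (List.ofFn fun i => h (rs i)).prod := by
  induction n with
  | zero => simp
  | succ n ih =>
    rw [pow_succ', ih, Finset.sum_mul_sum, ← Finset.sum_product']
    refine Finset.sum_nbij' (fun p => Fin.cons p.1 p.2) (fun rs => (rs 0, Fin.tail rs)) ?_ ?_ ?_ ?_ ?_
    · rintro ⟨q, rs⟩ h
      simp only [Finset.mem_product, Fintype.mem_piFinset] at h ⊢
      intro i
      refine Fin.cases ?_ (fun j => ?_) i
      · simpa using h.1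
      · simpa using h.2 j
    · intro rs h
      simp only [Finset.mem_product, Fintype.mem_piFinset] at h ⊢
      exact ⟨h 0, fun i => h i.succ⟩
    · rintro ⟨q, rs⟩ _
      simp
    · intro rs _
      simp
    · rintro ⟨q, rs⟩ _
      simp [List.ofFn_succ]

/-- Dynkin word in any type. -/
def dw {α : Type*} (a b : α) (n : ℕ) (rs : Fin (n + 1) → ℕ × ℕ) : List α :=
  (List.finRange (n + 1)).flatMap fun i =>
    List.replicate (rs i).1 a ++ List.replicate (rs i).2 b

theorem dw_length {α : Type*} (a b : α) (n : ℕ) (rs : Fin (n + 1) → ℕ × ℕ) :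
    (dw a b n rs).length = ∑ i, ((rs i).1 + (rs i).2) := by
  unfold dw
  rw [List.length_flatMap]
  simp only [List.length_append, List.length_replicate]
  rw [← List.ofFn_eq_map, List.sum_ofFn]

theorem dw_map {α β : Type*} (f : α → β) (a b : α) (n : ℕ) (rs : Fin (n + 1) → ℕ × ℕ) :
    (dw a b n rs).map f = dw (f a) (f b) n rs := by
  unfold dw
  simp [List.map_flatMap]

theorem dw_mem {α : Type*} {a b : α} {n : ℕ} {rs : Fin (n + 1) → ℕ × ℕ} {c : α}
    (h : c ∈ dw a b n rs) : c = a ∨ c = b := by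
  unfold dw at h
  simp only [List.mem_flatMap, List.mem_append] at h
  obtain ⟨i, _, h | h⟩ := h
  · exact Or.inl (List.eq_of_mem_replicate h)
  · exact Or.inr (List.eq_of_mem_replicate h)

theorem dw_prod {R : Type*} [Monoid R] (a b : R) (n : ℕ) (rs : Fin (n + 1) → ℕ × ℕ) :
    (dw a b n rs).prod = (List.ofFn fun i => a ^ (rs i).1 * b ^ (rs i).2).prod := by
  unfold dw
  rw [List.flatMap_def, List.prod_flatten, List.map_map, List.ofFn_eq_map]
  congr 2
  funext i
  simp

/-- Coefficients of `log (e^a e^b)` in terms of words. -/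
def wcoef (K : Type*) [Field K] (n : ℕ) (rs : Fin (n + 1) → ℕ × ℕ) : K :=
  if ∀ i, 1 ≤ (rs i).1 + (rs i).2 then
    ((-1 : K) ^ n / ((n : K) + 1)) *
      ((∏ i, ((rs i).1.factorial * (rs i).2.factorial) : ℕ) : K)⁻¹
  else 0

theorem wcoef_dynkin {K : Type} [Field K] (n : ℕ) (rs : Fin (n + 1) → ℕ × ℕ) :
    PreDGLA.dynkinCoeff K n rs =
      wcoef K n rs * ((∑ i, ((rs i).1 + (rs i).2) : ℕ) : K)⁻¹ := by
  unfold PreDGLA.dynkinCoeff wcoef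
  split_ifs
  · ring
  · simp

theorem wcoef_length {K : Type*} [Field K] {n : ℕ} {rs : Fin (n + 1) → ℕ × ℕ}
    (h : wcoef K n rs ≠ 0) : n + 1 ≤ ∑ i, ((rs i).1 + (rs i).2) := by
  unfold wcoef at h
  split_ifs at h with h1
  · calc n + 1 = ∑ i : Fin (n + 1), 1 := by simp
      _ ≤ _ := Finset.sum_le_sum fun i _ => h1 i
  · exact absurd rfl h

/-- A finite index set containing all the relevant words of length less than `N`. -/
def wset (N : ℕ) : Finset (Σ n : ℕ, Fin (n + 1) → ℕ × ℕ) :=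
  (Finset.range N).sigma fun n =>
    Fintype.piFinset fun _ : Fin (n + 1) => Finset.range N ×ˢ Finset.range N

theorem mem_wset {N : ℕ} {p : Σ n : ℕ, Fin (n + 1) → ℕ × ℕ} {K : Type*} [Field K]
    (h0 : wcoef K p.1 p.2 ≠ 0) (h : ∑ i, ((p.2 i).1 + (p.2 i).2) < N) : p ∈ wset N := by
  have h1 := wcoef_length h0
  simp only [wset, Finset.mem_sigma, Fintype.mem_piFinset, Finset.mem_product, Finset.mem_range]
  have : ∀ i, (p.2 i).1 + (p.2 i).2 ≤ ∑ i, ((p.2 i).1 + (p.2 i).2) := fun i =>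
    Finset.single_le_sum (f := fun i => (p.2 i).1 + (p.2 i).2) (fun _ _ => Nat.zero_le _)
      (Finset.mem_univ i)
  refine ⟨by omega, fun i => ?_⟩
  have := this i
  constructor <;> omega

theorem wsum_eq {K : Type*} [Field K] {M : Type*} [AddCommGroup M] [Module K M] {N : ℕ}
    (v : (Σ n : ℕ, Fin (n + 1) → ℕ × ℕ) → M) (c : (Σ n : ℕ, Fin (n + 1) → ℕ × ℕ) → K)
    (hc : ∀ p, wcoef K p.1 p.2 = 0 → c p = 0)
    (hv : ∀ p, N ≤ ∑ i, ((p.2 i).1 + (p.2 i).2) → v p = 0) :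
    (∑ᶠ p, c p • v p) = ∑ p ∈ wset N, c p • v p := by
  apply finsum_eq_sum_of_support_subset
  intro p hp
  rw [Function.mem_support] at hp
  refine mem_wset (K := K) (fun h => hp ?_) (not_le.1 fun h => hp ?_)
  · rw [hc p h, zero_smul]
  · rw [hv p h, smul_zero]

theorem list_prod_smul {K R : Type*} [Field K] [Ring R] [Algebra K R] (n : ℕ) (c : Fin n → K)
    (x : Fin n → R) :
    (List.ofFn fun i => c i • x i).prod = (∏ i, c i) • (List.ofFn x).prod := by
  induction n with
  | zero => simp
  | succ n ih =>
    rw [List.ofFn_succ, List.ofFn_succ, List.prod_cons, List.prod_cons, ih, Fin.prod_univ_succ,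
      smul_mul_smul_comm]

variable {K : Type*} [Field K] [CharZero K] {V : Type*} [AddCommGroup V] [Module K V]

theorem nlog_expand {F : ℕ → Submodule K V} {N : ℕ} (hF : IsFilt F N) {A B : Module.End K V}
    (hA : A ∈ low F) (hB : B ∈ low F) :
    nlog K (nexp K A * nexp K B) =
      ∑ p ∈ wset N, wcoef K p.1 p.2 • (dw A B p.1 p.2).prod := by
  have hA0 := low_pow_zero hF hA
  have hB0 := low_pow_zero hF hB
  have hu := low_unip hF hA hB
  rcases Nat.eq_zero_or_pos N with rfl | hN
  · have : ∀ T : Module.End K V, T = 0 := by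
      intro T
      ext v
      have : v ∈ F 0 := by rw [hF.top]; trivial
      rw [hF.bot] at this
      have : v = 0 := by simpa using this
      simp [this]
    rw [this (nlog K _), this (Finset.sum _ _)]
  set h : ℕ × ℕ → Module.End K V := fun q =>
    (if 1 ≤ q.1 + q.2 then ((q.1.factorial : K))⁻¹ * ((q.2.factorial : K))⁻¹ else 0) •
      (A ^ q.1 * B ^ q.2) with hh
  have e1 : nexp K A * nexp K B - 1 = ∑ q ∈ Finset.range N ×ˢ Finset.range N, h q := by
    unfold nexp
    rw [nev_eq_sum hA0, nev_eq_sum hB0, Finset.sum_mul_sum, ← Finset.sum_product', sub_eq_iff_eq_add]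
    have h00 : ((0 : ℕ), (0 : ℕ)) ∈ Finset.range N ×ˢ Finset.range N := by simp [hN]
    rw [← Finset.add_sum_erase _ _ h00, ← Finset.add_sum_erase _ h h00]
    have : h (0, 0) = 0 := by simp [hh]
    rw [this, zero_add, add_comm]
    congr 1
    · apply Finset.sum_congr rfl
      rintro ⟨r, s⟩ hrs
      have h1 : 1 ≤ r + s := by
        rcases Nat.eq_zero_or_pos (r + s) with h0 | h0
        · exfalso
          have h1 : r = 0 := by omega
          have h2 : s = 0 := by omega
          simp [h1, h2] at hrs
        · exact h0
      simp only [hh, if_pos h1, coeff_exp']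
      rw [smul_mul_smul_comm]
    · simp
  unfold nlog
  have hu0 := low_pow_zero hF hu
  have hu1 : (nexp K A * nexp K B - 1) ^ (N + 1) = 0 := pow_eq_zero_of_le (Nat.le_succ N) hu0
  rw [nev_eq_sum hu1, Finset.sum_range_succ']
  have : coeff 0 (log K) • (nexp K A * nexp K B - 1) ^ 0 = 0 := by simp
  rw [this, add_zero, wset, Finset.sum_sigma]
  apply Finset.sum_congr rfl
  intro n _
  rw [e1, sum_pow_expand, Finset.smul_sum]
  apply Finset.sum_congr rfl
  intro rs _
  simp only [hh]
  rw [list_prod_smul, ← dw_prod, smul_smul]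
  congr 1
  unfold wcoef
  split_ifs with hc
  · have : ∀ i : Fin (n + 1), (if 1 ≤ (rs i).1 + (rs i).2 then
        (((rs i).1.factorial : K))⁻¹ * (((rs i).2.factorial : K))⁻¹ else 0) =
        (((rs i).1.factorial : K) * ((rs i).2.factorial : K))⁻¹ := by
      intro i
      rw [if_pos (hc i), mul_inv]
    simp only [this, Finset.prod_inv_distrib]
    push_cast
    congr 1
    simp [pow_succ]
  · push Not at hc
    obtain ⟨i, hi⟩ := hc
    rw [Finset.prod_eq_zero (Finset.mem_univ i), mul_zero]
    rw [if_neg (by omega)]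

end words

end BCHAux

set_option linter.unusedSectionVars false
set_option linter.unusedVariables false

namespace BCHAux

open PowerSeries

section aug

variable {K : Type} [Field K] {V : Type*} [AddCommGroup V] [Module K V]

theorem IsFilt.mono {F : ℕ → Submodule K V} {N M : ℕ} (hF : IsFilt F N) (h : N ≤ M) :
    IsFilt F M :=
  ⟨hF.top, le_bot_iff.1 (hF.bot ▸ hF.anti_le h), hF.anti⟩

/-- The affine operator `(v, c) ↦ (A v + c w, 0)`. -/
def augOp (A : Module.End K V) (w : V) : Module.End K (V × K) :=
  (LinearMap.inl K V K).comp (A.coprod (LinearMap.toSpanSingleton K V w))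

@[simp] theorem augOp_apply (A : Module.End K V) (w : V) (v : V) (c : K) :
    augOp A w (v, c) = (A v + c • w, 0) := by
  simp [augOp]

/-- Filtration on `V × K`. -/
def augF (F : ℕ → Submodule K V) : ℕ → Submodule K (V × K)
  | 0 => ⊤
  | k + 1 => (F k).prod ⊥

theorem augF_isFilt {F : ℕ → Submodule K V} {N : ℕ} (hF : IsFilt F N) :
    IsFilt (augF F) (N + 1) := by
  refine ⟨rfl, ?_, ?_⟩
  · rw [Submodule.eq_bot_iff]
    rintro ⟨v, c⟩ hv
    have h1 : v ∈ F N := hv.1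
    have h2 : c = 0 := hv.2
    rw [hF.bot] at h1
    have h3 : v = 0 := h1
    rw [h2, h3]
    rfl
  · intro k
    cases k with
    | zero => exact le_top
    | succ k => exact Submodule.prod_mono (hF.anti k) le_rfl

theorem augOp_low {F : ℕ → Submodule K V} {N : ℕ} (hF : IsFilt F N) {A : Module.End K V}
    (hA : A ∈ low F) (w : V) : augOp A w ∈ low (augF F) := by
  rintro k ⟨v, c⟩ hv
  rw [augOp_apply]
  cases k with
  | zero =>
    refine ⟨?_, rfl⟩
    rw [hF.top]
    trivial
  | succ k =>
    have h2 : c = 0 := hv.2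
    refine ⟨?_, rfl⟩
    rw [h2, zero_smul, add_zero]
    exact hA k v hv.1

theorem nev_aug_inl {A : Module.End K V} {w : V} (hA : IsNilpotent A)
    (hA' : IsNilpotent (augOp A w)) (f : K⟦X⟧) (v : V) :
    nev f (augOp A w) (v, 0) = (nev f A v, 0) := by
  have := nev_intertwine hA hA' (LinearMap.inl K V K) (by intro v; simp) f v
  simpa using this.symm

theorem nexp_aug [CharZero K] {A : Module.End K V} {w : V} (hA : IsNilpotent A)
    (hA' : IsNilpotent (augOp A w)) (v : V) :
    nexp K (augOp A w) (v, 1) = (v + nev (phi K) A (A v + w), 1) := by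
  rw [nexp_eq_phi' hA', LinearMap.add_apply, Module.End.mul_apply, augOp_apply, nev_aug_inl hA hA']
  simp

end aug

section nb

variable {K : Type} [Field K] {V : Type*} [AddCommGroup V] [Module K V]

/-- Right-nested brackets for a bilinear map. -/
def bnb (br : V →ₗ[K] V →ₗ[K] V) : List V → V
  | [] => 0
  | [x] => x
  | x :: y :: xs => br x (bnb br (y :: xs))

/-- BCH product for a bilinear map. -/
def bbch (br : V →ₗ[K] V →ₗ[K] V) (a b : V) : V :=
  ∑ᶠ p : (Σ n : ℕ, Fin (n + 1) → ℕ × ℕ),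
    PreDGLA.dynkinCoeff K p.1 p.2 • bnb br (dw a b p.1 p.2)

theorem nb_eq (L : PreDGLA K) : ∀ l, L.nb l = bnb L.br l
  | [] => rfl
  | [x] => rfl
  | x :: y :: xs => by rw [PreDGLA.nb, bnb, nb_eq L (y :: xs)]

theorem bch_eq (L : PreDGLA K) (a b : L.carrier) : L.bch a b = bbch L.br a b := by
  unfold PreDGLA.bch bbch
  simp only [nb_eq]
  rfl

variable {br : V →ₗ[K] V →ₗ[K] V}

theorem bnb_cons (x : V) {l : List V} (hl : l ≠ []) : bnb br (x :: l) = br x (bnb br l) := by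
  cases l with
  | nil => exact absurd rfl hl
  | cons y l => rfl

theorem bnb_map {W : Type*} [AddCommGroup W] [Module K W] {br' : W →ₗ[K] W →ₗ[K] W}
    (T : V →ₗ[K] W) (hT : ∀ x y, T (br x y) = br' (T x) (T y)) :
    ∀ l, T (bnb br l) = bnb br' (l.map T)
  | [] => by simp [bnb]
  | [x] => rfl
  | x :: y :: xs => by
    rw [bnb, hT, bnb_map T hT (y :: xs)]
    rfl

theorem bnb_low {F : ℕ → Submodule K V} (hF : F 0 = ⊤) {l : List V}
    (h : ∀ x ∈ l, br x ∈ low F) : bnb br l ∈ F (l.length - 1) := by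
  induction l with
  | nil => simp [bnb]
  | cons x l ih =>
    cases l with
    | nil => simp [hF]
    | cons y l =>
      rw [bnb]
      have := h x (by simp) _ _ (ih fun z hz => h z (by simp [hz]))
      simpa using this

theorem bnb_zero {F : ℕ → Submodule K V} {N : ℕ} (hF : IsFilt F N) {l : List V}
    (h : ∀ x ∈ l, br x ∈ low F) (hl : N + 1 ≤ l.length) : bnb br l = 0 := by
  have := hF.anti_le (by omega : N ≤ l.length - 1) (bnb_low hF.top h)
  rw [hF.bot] at this
  simpa using this

theorem bnb_dw_zero {F : ℕ → Submodule K V} {N M : ℕ} (hF : IsFilt F N) (hM : N + 1 ≤ M) {a b : V}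
    (ha : br a ∈ low F) (hb : br b ∈ low F) (p : Σ n : ℕ, Fin (n + 1) → ℕ × ℕ)
    (hp : M ≤ ∑ i, ((p.2 i).1 + (p.2 i).2)) : bnb br (dw a b p.1 p.2) = 0 := by
  apply bnb_zero hF
  · intro x hx
    rcases dw_mem hx with rfl | rfl
    · exact ha
    · exact hb
  · rw [dw_length]
    omega

theorem bbch_eq_sum {F : ℕ → Submodule K V} {N M : ℕ} (hF : IsFilt F N) (hM : N + 1 ≤ M) {a b : V}
    (ha : br a ∈ low F) (hb : br b ∈ low F) :
    bbch br a b = ∑ p ∈ wset M,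
      PreDGLA.dynkinCoeff K p.1 p.2 • bnb br (dw a b p.1 p.2) := by
  unfold bbch
  apply wsum_eq
  · intro p hp
    rw [wcoef_dynkin, hp, zero_mul]
  · exact bnb_dw_zero hF hM ha hb

theorem bbch_map {W : Type*} [AddCommGroup W] [Module K W] {br' : W →ₗ[K] W →ₗ[K] W}
    (T : V →ₗ[K] W) (hT : ∀ x y, T (br x y) = br' (T x) (T y))
    {F : ℕ → Submodule K V} {N : ℕ} (hF : IsFilt F N)
    {F' : ℕ → Submodule K W} {N' : ℕ} (hF' : IsFilt F' N') {a b : V}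
    (ha : br a ∈ low F) (hb : br b ∈ low F) (ha' : br' (T a) ∈ low F') (hb' : br' (T b) ∈ low F') :
    T (bbch br a b) = bbch br' (T a) (T b) := by
  rw [bbch_eq_sum (M := max (N + 1) (N' + 1)) hF (le_max_left _ _) ha hb,
    bbch_eq_sum (M := max (N + 1) (N' + 1)) hF' (le_max_right _ _) ha' hb']
  simp only [map_sum, map_smul, bnb_map T hT, dw_map]

theorem bbch_mem (S : Submodule K V) (hS : ∀ x ∈ S, ∀ y ∈ S, br x y ∈ S) {a b : V}
    (ha : a ∈ S) (hb : b ∈ S) : bbch br a b ∈ S := by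
  unfold bbch
  refine finsum_induction (· ∈ S) S.zero_mem (fun _ _ => S.add_mem) ?_
  intro p
  apply S.smul_mem
  have : ∀ l : List V, (∀ x ∈ l, x ∈ S) → bnb br l ∈ S := by
    intro l
    induction l with
    | nil => intro _; exact S.zero_mem
    | cons x l ih =>
      intro h
      cases l with
      | nil => exact h x (by simp)
      | cons y l => exact hS _ (h x (by simp)) _ (ih fun z hz => h z (by simp [hz]))
  apply this
  intro x hx
  rcases dw_mem hx with rfl | rfl
  · exact ha
  · exact hb

end nb

section core

variable {K : Type} [Field K] [CharZero K] {g : Type*} [LieRing g] [LieAlgebra K g]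
  {W : Type*} [AddCommGroup W] [Module K W]

/-- The bracket as a bilinear map. -/
def lbr (K : Type) [Field K] (g : Type*) [LieRing g] [LieAlgebra K g] : g →ₗ[K] g →ₗ[K] g :=
  (LieAlgebra.ad K g : g →ₗ[K] Module.End K g)

@[simp] theorem lbr_apply (x y : g) : lbr K g x y = ⁅x, y⁆ := rfl

theorem aug_list (l : List g) (hl : l ≠ []) :
    (l.map fun x => augOp (lbr K g x) x).prod (0, 1) = (bnb (lbr K g) l, 0) := by
  induction l with
  | nil => exact absurd rfl hl
  | cons x l ih =>
    rw [List.map_cons, List.prod_cons, Module.End.mul_apply]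
    cases l with
    | nil => simp [bnb]
    | cons y l =>
      rw [ih (by simp), augOp_apply, bnb_cons x (l := y :: l) (by simp)]
      simp

theorem eigen_sum {M ι : Type*} [AddCommGroup M] [Module K M] (D : Module.End K M) (s : Finset ι)
    (t : ι → M) (c : ι → ℕ) (ht : ∀ i ∈ s, t i = 0 ∨ (c i ≠ 0 ∧ D (t i) = (c i : K) • t i))
    (h : D (∑ i ∈ s, t i) = 0) : ∑ i ∈ s, t i = 0 := by
  have hind := D.eigenspaces_iSupIndep 0
  rw [disjoint_iff_inf_le] at hind
  have h0 : ∑ i ∈ s, t i ∈ D.eigenspace 0 := by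
    rw [Module.End.mem_eigenspace_iff, h, zero_smul]
  have h1 : ∑ i ∈ s, t i ∈ ⨆ j, ⨆ (_ : j ≠ (0 : K)), D.eigenspace j := by
    apply Submodule.sum_mem
    intro i hi
    rcases ht i hi with h | ⟨h, h'⟩
    · rw [h]; exact Submodule.zero_mem _
    · have hc : ((c i : ℕ) : K) ≠ 0 := by exact_mod_cast h
      exact Submodule.mem_iSup_of_mem (c i : K) (Submodule.mem_iSup_of_mem hc
        (Module.End.mem_eigenspace_iff.2 h'))
  simpa using hind ⟨h0, h1⟩

theorem cad_prod (D : Module.End K W) (l : List (Module.End K W))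
    (h : ∀ T ∈ l, cad K D T = T) : cad K D l.prod = (l.length : K) • l.prod := by
  induction l with
  | nil => simp [cad_apply]
  | cons T l ih =>
    have h1 := h T (by simp)
    have h2 := ih fun S hS => h S (by simp [hS])
    rw [cad_apply] at h1 h2
    rw [cad_apply, List.prod_cons, List.length_cons]
    have e : D * (T * l.prod) - T * l.prod * D =
      (D * T - T * D) * l.prod + T * (D * l.prod - l.prod * D) := by noncomm_ring
    rw [e, h1, h2]
    push_cast
    rw [add_smul, one_smul, mul_smul_comm, add_comm]

theorem der_bnb (E : g →ₗ[K] g) (hE : ∀ x y : g, E ⁅x, y⁆ = ⁅E x, y⁆ + ⁅x, E y⁆) (l : List g)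
    (h : ∀ x ∈ l, E x = x) : E (bnb (lbr K g) l) = (l.length : K) • bnb (lbr K g) l := by
  induction l with
  | nil => simp [bnb]
  | cons x l ih =>
    have h1 := h x (by simp)
    have h2 := ih fun S hS => h S (by simp [hS])
    cases l with
    | nil => simp [bnb, h1]
    | cons y l =>
      rw [bnb_cons _ (by simp), lbr_apply, hE, h1, h2, List.length_cons (a := x)]
      push_cast
      rw [add_smul _ (1 : K), one_smul, lie_smul, add_comm]

/-- The key graded case of the Baker-Campbell-Hausdorff theorem with Dynkin's formula. -/
theorem bch_graded (ρ : g →ₗ[K] Module.End K W)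
    (hρ : ∀ x y, ρ ⁅x, y⁆ = ρ x * ρ y - ρ y * ρ x)
    {F : ℕ → Submodule K g} {N : ℕ} (hF : IsFilt F N) (hFl : ∀ x, lbr K g x ∈ low F)
    {G : ℕ → Submodule K W} {N' : ℕ} (hG : IsFilt G N') (hGl : ∀ x, ρ x ∈ low G)
    (E : g →ₗ[K] g) (hE : ∀ x y : g, E ⁅x, y⁆ = ⁅E x, y⁆ + ⁅x, E y⁆)
    (D : Module.End K W) (hD : ∀ x, D * ρ x - ρ x * D = ρ (E x))
    (a b : g) (ha : E a = a) (hb : E b = b) :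
    nexp K (ρ a) * nexp K (ρ b) = nexp K (ρ (bbch (lbr K g) a b)) := by
  set M := max (N + 1) N' with hM
  set br := lbr K g with hbr
  set z := bbch br a b with hz
  set gW := nexp K (ρ a) * nexp K (ρ b) with hgW
  set ζW := nlog K gW with hζW
  have nW : ∀ x, IsNilpotent (ρ x) := fun x => low_nilp hG (hGl x)
  have ng : ∀ x, IsNilpotent (br x) := fun x => low_nilp hF (hFl x)
  have uW : IsNilpotent (gW - 1) := low_nilp hG (low_unip hG (hGl a) (hGl b))
  have hexpW : nexp K ζW = gW := nexp_nlog uW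
  have nζW : IsNilpotent ζW := nlog_nilp uW
  set gg := nexp K (br a) * nexp K (br b) with hgg
  have ug : IsNilpotent (gg - 1) := low_nilp hF (low_unip hF (hFl a) (hFl b))
  set ζ := nlog K gg with hζ
  have nζ : IsNilpotent ζ := nlog_nilp ug
  have hexpg : nexp K ζ = gg := nexp_nlog ug
  -- conjugation
  have conj1 : ∀ x q, ρ (nexp K (br x) q) = nexp K (cad K (ρ x)) (ρ q) := fun x q =>
    nev_intertwine (ng x) (cad_nilp (nW x)) ρ (fun v => by rw [hbr, lbr_apply, hρ, cad_apply])
      (exp K) q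
  have invW : nexp K (-ζW) = nexp K (-ρ b) * nexp K (-ρ a) := by
    have h1 : gW * (nexp K (-ρ b) * nexp K (-ρ a)) = 1 := by
      rw [hgW, mul_assoc, ← mul_assoc (nexp K (ρ b)), nexp_mul_neg (nW b), one_mul,
        nexp_mul_neg (nW a)]
    have h2 := nexp_neg_mul (K := K) nζW
    rw [hexpW] at h2
    exact left_inv_eq_right_inv h2 h1
  have conj2 : ∀ q, ρ (gg q) = nexp K (cad K ζW) (ρ q) := by
    intro q
    rw [hgg, Module.End.mul_apply, conj1, conj1, nexp_cad (nW a), nexp_cad (nW b), nexp_cad nζW,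
      hexpW, invW, hgW]
    noncomm_ring
  have conj3 : ∀ q, ρ (ζ q) = cad K ζW (ρ q) := by
    intro q
    have h := nev_intertwine ug (nexp_sub_one_nilp (K := K) (cad_nilp (K := K) nζW)) ρ
      (fun v => by
        rw [LinearMap.sub_apply, LinearMap.sub_apply, map_sub, conj2]; rfl) (log K) q
    have h2 := nlog_nexp (K := K) (cad_nilp (K := K) nζW)
    unfold nlog at h2
    rw [h2] at h
    exact h
  have conj4 : ∀ q, ρ (nev (phi K) ζ q) = nev (phi K) (cad K ζW) (ρ q) := fun q =>
    nev_intertwine nζ (cad_nilp nζW) ρ conj3 (phi K) q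
  -- the element p
  set pp : g := a + nexp K (br a) b with hpp
  have single : ∀ x, E x = x → nexp K (ρ x) * D * nexp K (-ρ x) = D - ρ x := by
    intro x hx
    have c1 : cad K (ρ x) D = - ρ x := by
      have := hD x
      rw [hx] at this
      rw [cad_apply, ← neg_sub, this]
    have c2 : cad K (ρ x) (ρ x) = 0 := by rw [cad_apply, sub_self]
    rw [← nexp_cad (nW x), nexp_eq_phi' (cad_nilp (nW x)), LinearMap.add_apply,
      Module.End.mul_apply, c1, map_neg]
    have c3 : nev (phi K) (cad K (ρ x)) (ρ x) = ρ x := by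
      rw [nev_apply (cad_nilp (nW x)), finsum_eq_single _ 0]
      · simp [phi]
      · intro n hn
        obtain ⟨m, rfl⟩ := Nat.exists_eq_succ_of_ne_zero hn
        rw [pow_succ, Module.End.mul_apply, c2, map_zero, smul_zero]
    rw [c3, Module.End.one_apply, sub_eq_add_neg]
  have hconjD : nexp K (cad K ζW) D = D - ρ pp := by
    rw [nexp_cad nζW, hexpW, invW, hgW]
    have e : nexp K (ρ a) * nexp K (ρ b) * D * (nexp K (-ρ b) * nexp K (-ρ a)) =
        nexp K (ρ a) * (nexp K (ρ b) * D * nexp K (-ρ b)) * nexp K (-ρ a) := by noncomm_ring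
    rw [e, single b hb, mul_sub, sub_mul, single a ha, hpp, map_add, conj1, nexp_cad (nW a)]
    abel
  -- augmented operators
  have hFa := augF_isFilt hF
  have la : ∀ x, augOp (br x) x ∈ low (augF F) := fun x => augOp_low hF (hFl x) x
  have na : ∀ x, IsNilpotent (augOp (br x) x) := fun x => low_nilp hFa (la x)
  set ga := nexp K (augOp (br a) a) * nexp K (augOp (br b) b) with hga
  have ua : IsNilpotent (ga - 1) := low_nilp hFa (low_unip hFa (la a) (la b))
  set ζa := nlog K ga with hζa
  have nζa : IsNilpotent ζa := nlog_nilp ua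
  have hexpa : nexp K ζa = ga := nexp_nlog ua
  have phi_self : ∀ x, nev (phi K) (br x) x = x := by
    intro x
    rw [nev_apply (ng x), finsum_eq_single _ 0]
    · simp [phi]
    · intro n hn
      obtain ⟨m, rfl⟩ := Nat.exists_eq_succ_of_ne_zero hn
      rw [pow_succ, Module.End.mul_apply, hbr, lbr_apply, lie_self, map_zero, smul_zero]
  have hga1 : ga (0, 1) = (pp, 1) := by
    rw [hga, Module.End.mul_apply, nexp_aug (ng b) (na b), nexp_aug (ng a) (na a)]
    simp only [map_zero, zero_add, phi_self]
    rw [map_add, phi_self, hpp, nexp_eq_phi' (ng a)]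
    ext
    · simp only [LinearMap.add_apply, Module.End.mul_apply, Module.End.one_apply]; abel
    · rfl
  have hlow_inl : ∀ v, ζa (v, 0) = (ζ v, 0) := by
    intro v
    have hg : ∀ v, ga (v, 0) = (gg v, 0) := by
      intro v
      rw [hga, Module.End.mul_apply]
      unfold nexp
      rw [nev_aug_inl (ng b) (na b), nev_aug_inl (ng a) (na a)]
      rfl
    have := nev_intertwine ug ua (LinearMap.inl K g K) (by
      intro v
      simp [hg]) (log K) v
    exact this.symm
  set y : g := ∑ p ∈ wset M, wcoef K p.1 p.2 • bnb br (dw a b p.1 p.2) with hy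
  have hζa1 : ζa (0, 1) = (y, 0) := by
    rw [hζa, hga, nlog_expand (hFa.mono (le_max_left _ _ : N + 1 ≤ M)) (la a) (la b), hy,
      LinearMap.sum_apply]
    have : ((∑ p ∈ wset M, wcoef K p.1 p.2 • bnb br (dw a b p.1 p.2), (0 : K)) : g × K) =
      LinearMap.inl K g K (∑ p ∈ wset M, wcoef K p.1 p.2 • bnb br (dw a b p.1 p.2)) := rfl
    rw [this, map_sum]
    apply Finset.sum_congr rfl
    intro p _
    by_cases hp : wcoef K p.1 p.2 = 0
    · rw [hp, zero_smul, zero_smul, map_zero]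
      rfl
    · have hne : dw a b p.1 p.2 ≠ [] := by
        have := wcoef_length hp
        rw [← dw_length a b] at this
        intro h
        rw [h] at this
        simp at this
      have := aug_list (K := K) _ hne
      rw [dw_map (fun x => augOp (lbr K g x) x)] at this
      rw [LinearMap.smul_apply, this, map_smul]
      rfl
  have hp_phi : pp = nev (phi K) ζ y := by
    have h1 := hga1
    rw [← hexpa, nexp_eq_phi' nζa, LinearMap.add_apply, Module.End.mul_apply, hζa1] at h1
    have h2 : nev (phi K) ζa (y, 0) = (nev (phi K) ζ y, 0) := by
      have := nev_intertwine nζ nζa (LinearMap.inl K g K) (by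
        intro v
        simp [hlow_inl]) (phi K) y
      simpa using this.symm
    rw [h2] at h1
    have := congrArg Prod.fst h1
    simpa using this.symm
  have hEz : E z = y := by
    rw [hz, bbch_eq_sum hF (le_max_left _ _ : N + 1 ≤ M) (hFl a) (hFl b), map_sum, hy]
    apply Finset.sum_congr rfl
    intro p _
    rw [map_smul, der_bnb E hE, smul_smul, wcoef_dynkin, dw_length]
    · by_cases hp : wcoef K p.1 p.2 = 0
      · simp [hp]
      · have := wcoef_length hp
        have h0 : ((∑ i, ((p.2 i).1 + (p.2 i).2) : ℕ) : K) ≠ 0 := by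
          exact_mod_cast (by omega : (∑ i, ((p.2 i).1 + (p.2 i).2) : ℕ) ≠ 0)
        rw [mul_assoc, inv_mul_cancel₀ h0, mul_one]
    · intro x hx
      rcases dw_mem hx with rfl | rfl
      · exact ha
      · exact hb
  -- the commutator
  have hcomm : cad K ζW D = - ρ y := by
    have h1 := hconjD
    rw [nexp_eq_phi' (cad_nilp nζW), LinearMap.add_apply, Module.End.mul_apply,
      Module.End.one_apply, hp_phi, conj4] at h1
    have h2 : nev (phi K) (cad K ζW) (cad K ζW D + ρ y) = 0 := by
      rw [map_add]
      have h3 : nev (phi K) (cad K ζW) (cad K ζW D) =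
        (D + nev (phi K) (cad K ζW) (cad K ζW D)) - D := by abel
      rw [h3, h1]
      abel
    obtain ⟨u, hu⟩ := phi_unit (K := K) (cad_nilp (K := K) nζW)
    have h3 : cad K ζW D + ρ y = 0 := by
      have := congrArg u h2
      rw [← Module.End.mul_apply, hu, map_zero] at this
      simpa using this
    exact eq_neg_of_add_eq_zero_left h3
  have hT0 : cad K D (ζW - ρ z) = 0 := by
    have h1 := hD z
    rw [hEz] at h1
    have h2 := hcomm
    rw [cad_apply] at h2
    rw [cad_apply]
    have e : D * (ζW - ρ z) - (ζW - ρ z) * D =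
      -(ζW * D - D * ζW) - (D * ρ z - ρ z * D) := by noncomm_ring
    rw [e, h1, h2]
    abel
  have hTsum : ζW - ρ z = ∑ p ∈ wset M, (wcoef K p.1 p.2 • (dw (ρ a) (ρ b) p.1 p.2).prod -
      PreDGLA.dynkinCoeff K p.1 p.2 • ρ (bnb br (dw a b p.1 p.2))) := by
    rw [Finset.sum_sub_distrib, hζW, hgW, nlog_expand (hG.mono (le_max_right _ _ : N' ≤ M))
      (hGl a) (hGl b), hz, bbch_eq_sum hF (le_max_left _ _ : N + 1 ≤ M) (hFl a) (hFl b), map_sum]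
    simp only [map_smul, hM]
  have hT : ζW - ρ z = 0 := by
    rw [hTsum] at hT0 ⊢
    apply eigen_sum (cad K D) _ _ (fun p => ∑ i, ((p.2 i).1 + (p.2 i).2)) _ hT0
    intro p _
    by_cases hp : wcoef K p.1 p.2 = 0
    · left
      rw [wcoef_dynkin, hp]
      simp
    · right
      have hl := wcoef_length hp
      refine ⟨by omega, ?_⟩
      have e1 : cad K D (dw (ρ a) (ρ b) p.1 p.2).prod =
          ((∑ i, ((p.2 i).1 + (p.2 i).2) : ℕ) : K) • (dw (ρ a) (ρ b) p.1 p.2).prod := by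
        rw [cad_prod, dw_length]
        intro T hT
        rcases dw_mem hT with rfl | rfl
        · rw [cad_apply, hD, ha]
        · rw [cad_apply, hD, hb]
      have e2 : cad K D (ρ (bnb br (dw a b p.1 p.2))) =
          ((∑ i, ((p.2 i).1 + (p.2 i).2) : ℕ) : K) • ρ (bnb br (dw a b p.1 p.2)) := by
        rw [cad_apply, hD, der_bnb E hE, dw_length, map_smul]
        intro x hx
        rcases dw_mem hx with rfl | rfl
        · exact ha
        · exact hb
      rw [map_sub, map_smul, map_smul, e1, e2, smul_sub, smul_comm, smul_comm
        (PreDGLA.dynkinCoeff K p.1 p.2)]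
  rw [← hexpW, sub_eq_zero.1 hT]

end core

end BCHAux

set_option linter.unusedSimpArgs false

set_option linter.unusedSectionVars false
set_option linter.unusedVariables false

namespace BCHAux

open PowerSeries

section poly

variable {K : Type} [Field K] {V : Type*} [AddCommGroup V] [Module K V]

/-- Filtration on a tensor product induced by the right factor. -/
def tF (P : Type*) [AddCommGroup P] [Module K P] (F : ℕ → Submodule K V) (k : ℕ) :
    Submodule K (P ⊗[K] V) :=
  Submodule.span K {z | ∃ p : P, ∃ v ∈ F k, p ⊗ₜ v = z}

variable {P : Type*} [AddCommGroup P] [Module K P]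

theorem tF_isFilt {F : ℕ → Submodule K V} {N : ℕ} (hF : IsFilt F N) :
    IsFilt (tF P F) N := by
  refine ⟨?_, ?_, ?_⟩
  · rw [eq_top_iff, ← TensorProduct.span_tmul_eq_top]
    apply Submodule.span_mono
    rintro z ⟨p, v, rfl⟩
    exact ⟨p, v, by rw [hF.top]; trivial, rfl⟩
  · unfold tF
    rw [Submodule.span_eq_bot]
    rintro z ⟨p, v, hv, rfl⟩
    rw [hF.bot, Submodule.mem_bot] at hv
    rw [hv, TensorProduct.tmul_zero]
  · intro k
    apply Submodule.span_mono
    rintro z ⟨p, v, hv, rfl⟩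
    exact ⟨p, v, hF.anti k hv, rfl⟩

theorem tF_low {F : ℕ → Submodule K V} {A : Module.End K V} (hA : A ∈ low F)
    (S : Module.End K P) : TensorProduct.map S A ∈ low (tF P F) := by
  intro k z hz
  induction hz using Submodule.span_induction with
  | mem z hz =>
    obtain ⟨p, v, hv, rfl⟩ := hz
    exact Submodule.subset_span ⟨S p, A v, hA k v hv, rfl⟩
  | zero => rw [map_zero]; exact Submodule.zero_mem _
  | add x y _ _ hx hy => rw [map_add]; exact Submodule.add_mem _ hx hy
  | smul c x _ hx => rw [map_smul]; exact Submodule.smul_mem _ c hx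

/-- Evaluation of a polynomial vector at `t`. -/
def ev (t : K) (V : Type*) [AddCommGroup V] [Module K V] : (Polynomial K ⊗[K] V) →ₗ[K] V :=
  (TensorProduct.lid K V).toLinearMap ∘ₗ LinearMap.rTensor V (Polynomial.leval t)

@[simp] theorem ev_tmul (t : K) (p : Polynomial K) (v : V) :
    ev t V (p ⊗ₜ v) = p.eval t • v := by
  simp [ev]

/-- The Euler operator on polynomials. -/
def eul (K : Type) [Field K] : Polynomial K →ₗ[K] Polynomial K :=
  LinearMap.mulLeft K Polynomial.X ∘ₗ Polynomial.derivative

theorem eul_apply (p : Polynomial K) : eul K p = Polynomial.X * Polynomial.derivative p := rfl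

/-- The Euler operator on polynomial vectors. -/
def eulT (V : Type*) [AddCommGroup V] [Module K V] : Module.End K (Polynomial K ⊗[K] V) :=
  LinearMap.rTensor V (eul K)

@[simp] theorem eulT_tmul (p : Polynomial K) (v : V) : eulT V (p ⊗ₜ v) = eul K p ⊗ₜ v := rfl

theorem eul_inv [CharZero K] : ∃ S : Polynomial K →ₗ[K] Polynomial K,
    ∀ p, S (eul K p) + Polynomial.C (p.eval 0) = p := by
  refine ⟨(Polynomial.basisMonomials K).constr K fun n => ((n : K)⁻¹) • Polynomial.monomial n 1, ?_⟩
  intro p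
  set S := (Polynomial.basisMonomials K).constr K fun n => ((n : K)⁻¹) • Polynomial.monomial n (1:K)
    with hS
  have hSn : ∀ n, S (Polynomial.monomial n 1) = ((n : K)⁻¹) • Polynomial.monomial n 1 := by
    intro n
    have := (Polynomial.basisMonomials K).constr_basis K
      (fun n => ((n : K)⁻¹) • Polynomial.monomial n (1:K)) n
    rwa [Polynomial.coe_basisMonomials] at this
  induction p using Polynomial.induction_on' with
  | add p q hp hq =>
    rw [map_add, map_add, Polynomial.eval_add, Polynomial.C_add]
    nth_rewrite 3 [← hp]
    nth_rewrite 3 [← hq]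
    abel
  | monomial n c =>
    have e1 : Polynomial.monomial n c = c • Polynomial.monomial n (1 : K) := by
      rw [Polynomial.smul_monomial]; simp
    have e2 : eul K (Polynomial.monomial n (1 : K)) = (n : K) • Polynomial.monomial n (1 : K) := by
      rw [eul_apply, Polynomial.derivative_monomial, Polynomial.X_mul_monomial]
      cases n with
      | zero => simp
      | succ n => simp [Polynomial.smul_monomial]
    rw [e1, map_smul, map_smul, e2, map_smul, hSn, Polynomial.eval_smul]
    cases n with
    | zero => simp [Polynomial.smul_eq_C_mul]
    | succ n =>
      have : ((n : K) + 1) ≠ 0 := by exact_mod_cast Nat.succ_ne_zero n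
      rw [smul_smul ((n + 1 : ℕ) : K), mul_inv_cancel₀ (by exact_mod_cast Nat.succ_ne_zero n)]
      simp

theorem eulT_inj [CharZero K] {z : Polynomial K ⊗[K] V} (h1 : eulT V z = 0) (h2 : ev 0 V z = 0) :
    z = 0 := by
  obtain ⟨S, hS⟩ := eul_inv (K := K)
  have : ∀ z : Polynomial K ⊗[K] V,
      LinearMap.rTensor V S (eulT V z) + (1 : Polynomial K) ⊗ₜ ev 0 V z = z := by
    intro z
    induction z using TensorProduct.induction_on with
    | zero => simp
    | add x y hx hy =>
      rw [map_add, map_add, map_add, TensorProduct.tmul_add]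
      nth_rewrite 3 [← hx]
      nth_rewrite 3 [← hy]
      abel
    | tmul p v =>
      rw [eulT_tmul, LinearMap.rTensor_tmul, ev_tmul, ← TensorProduct.smul_tmul,
        ← TensorProduct.add_tmul]
      nth_rewrite 3 [← hS p]
      rw [Polynomial.smul_eq_C_mul, mul_one]
  rw [← this z, h1, h2, map_zero, TensorProduct.tmul_zero, add_zero]

end poly

section general

variable {K : Type} [Field K] [CharZero K] {n : Type*} [LieRing n] [LieAlgebra K n]
  {W : Type*} [AddCommGroup W] [Module K W]

section brk
variable (x y z : Polynomial K ⊗[K] n) (c : K)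
theorem Padd_lie : ⁅x + y, z⁆ = ⁅x, z⁆ + ⁅y, z⁆ := LieRing.add_lie x y z
theorem Plie_add : ⁅x, y + z⁆ = ⁅x, y⁆ + ⁅x, z⁆ := LieRing.lie_add x y z
theorem Pzero_lie : ⁅(0 : Polynomial K ⊗[K] n), z⁆ = 0 := _root_.zero_lie z
theorem Plie_zero : ⁅x, (0 : Polynomial K ⊗[K] n)⁆ = 0 := _root_.lie_zero x
theorem Plie_sub : ⁅x, y - z⁆ = ⁅x, y⁆ - ⁅x, z⁆ := _root_.lie_sub x y z
theorem Plie_smul : ⁅x, c • y⁆ = c • ⁅x, y⁆ := LieAlgebra.lie_smul c x y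
theorem Plie_lie : ⁅⁅x, y⁆, z⁆ = ⁅x, ⁅y, z⁆⁆ - ⁅y, ⁅x, z⁆⁆ := _root_.lie_lie x y z
theorem Plie_skew : -⁅y, x⁆ = ⁅x, y⁆ := _root_.lie_skew x y
end brk

theorem ev_lie (t : K) (x y : Polynomial K ⊗[K] n) : ev t n ⁅x, y⁆ = ⁅ev t n x, ev t n y⁆ := by
  induction x using TensorProduct.induction_on with
  | zero => simp [Pzero_lie, Plie_zero]
  | add x x' hx hx' => simp only [Padd_lie, _root_.add_lie, map_add, hx, hx']
  | tmul p v =>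
    induction y using TensorProduct.induction_on with
    | zero => simp [Pzero_lie, Plie_zero]
    | add x x' hx hx' => simp only [Plie_add, _root_.lie_add, map_add, hx, hx']
    | tmul q w =>
      rw [LieAlgebra.ExtendScalars.bracket_tmul, ev_tmul, ev_tmul, ev_tmul, Polynomial.eval_mul,
        smul_lie, lie_smul, smul_smul]

theorem eulT_lie (x y : Polynomial K ⊗[K] n) :
    eulT n ⁅x, y⁆ = ⁅eulT n x, y⁆ + ⁅x, eulT n y⁆ := by
  induction x using TensorProduct.induction_on with
  | zero => simp [Pzero_lie, Plie_zero]
  | add x x' hx hx' => simp only [Padd_lie, map_add, hx, hx']; abel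
  | tmul p v =>
    induction y using TensorProduct.induction_on with
    | zero => simp [Pzero_lie, Plie_zero]
    | add x x' hx hx' => simp only [Plie_add, map_add, hx, hx']; abel
    | tmul q w =>
      simp only [LieAlgebra.ExtendScalars.bracket_tmul, eulT_tmul]
      rw [← TensorProduct.add_tmul, eul_apply, eul_apply, eul_apply, Polynomial.derivative_mul]
      congr 1
      ring

/-- Extension of a representation to polynomials. -/
def rhoP (ρ : n →ₗ[K] Module.End K W) :
    (Polynomial K ⊗[K] n) →ₗ[K] Module.End K (Polynomial K ⊗[K] W) :=
  (TensorProduct.homTensorHomMap (RingHom.id K) (Polynomial K) W (Polynomial K) W) ∘ₗ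
    TensorProduct.map (LinearMap.mul K (Polynomial K)) ρ

theorem rhoP_tmul (ρ : n →ₗ[K] Module.End K W) (p : Polynomial K) (x : n) :
    rhoP ρ (p ⊗ₜ x) = TensorProduct.map (LinearMap.mul K (Polynomial K) p) (ρ x) := rfl

@[simp] theorem rhoP_tmul_tmul (ρ : n →ₗ[K] Module.End K W) (p q : Polynomial K) (x : n) (w : W) :
    rhoP ρ (p ⊗ₜ x) (q ⊗ₜ w) = (p * q) ⊗ₜ ρ x w := rfl

theorem rhoP_lie (ρ : n →ₗ[K] Module.End K W)
    (hρ : ∀ x y, ρ ⁅x, y⁆ = ρ x * ρ y - ρ y * ρ x) (x y : Polynomial K ⊗[K] n) :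
    rhoP ρ ⁅x, y⁆ = rhoP ρ x * rhoP ρ y - rhoP ρ y * rhoP ρ x := by
  induction x using TensorProduct.induction_on with
  | zero => simp [Pzero_lie, Plie_zero]; exact (sub_zero (0 : Module.End K (Polynomial K ⊗[K] W))).symm
  | add x x' hx hx' => simp only [Padd_lie, map_add, hx, hx', add_mul, mul_add]; abel
  | tmul p v =>
    induction y using TensorProduct.induction_on with
    | zero => simp [Pzero_lie, Plie_zero]; exact (sub_zero (0 : Module.End K (Polynomial K ⊗[K] W))).symm
    | add x x' hx hx' => simp only [Plie_add, map_add, hx, hx', add_mul, mul_add]; abel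
    | tmul q w =>
      rw [LieAlgebra.ExtendScalars.bracket_tmul]
      apply TensorProduct.ext'
      intro r u
      simp only [LinearMap.sub_apply, Module.End.mul_apply, rhoP_tmul_tmul, hρ]
      rw [TensorProduct.tmul_sub]
      congr 2 <;> ring

theorem rhoP_low (ρ : n →ₗ[K] Module.End K W) {G : ℕ → Submodule K W} (hGl : ∀ x, ρ x ∈ low G)
    (x : Polynomial K ⊗[K] n) : rhoP ρ x ∈ low (tF (Polynomial K) G) := by
  induction x using TensorProduct.induction_on with
  | zero => rw [map_zero]; exact Submodule.zero_mem _
  | add x x' hx hx' => rw [map_add]; exact Submodule.add_mem _ hx hx'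
  | tmul p v => exact tF_low (hGl v) _

theorem rhoP_ev (ρ : n →ₗ[K] Module.End K W) (t : K) (x : Polynomial K ⊗[K] n)
    (w : Polynomial K ⊗[K] W) : ev t W (rhoP ρ x w) = ρ (ev t n x) (ev t W w) := by
  induction x using TensorProduct.induction_on with
  | zero => simp [Pzero_lie, Plie_zero]
  | add x x' hx hx' => simp only [LinearMap.add_apply, map_add, hx, hx']
  | tmul p v =>
    induction w using TensorProduct.induction_on with
    | zero => simp [Pzero_lie, Plie_zero]
    | add x x' hx hx' => simp only [LinearMap.add_apply, map_add, hx, hx']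
    | tmul q w =>
      rw [rhoP_tmul_tmul, ev_tmul, ev_tmul, ev_tmul, Polynomial.eval_mul, map_smul, map_smul,
        LinearMap.smul_apply, smul_smul, mul_comm]

theorem lbrP_low {F : ℕ → Submodule K n} (hFl : ∀ x, lbr K n x ∈ low F)
    (x : Polynomial K ⊗[K] n) :
    lbr K (Polynomial K ⊗[K] n) x ∈ low (tF (Polynomial K) F) := by
  have := rhoP_low (lbr K n) hFl x
  convert this using 1
  apply LinearMap.ext
  intro y
  rw [lbr_apply]
  induction x using TensorProduct.induction_on with
  | zero => simp [Pzero_lie, Plie_zero]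
  | add x x' hx hx' =>
    rw [Padd_lie, hx (rhoP_low (lbr K n) hFl x), hx' (rhoP_low (lbr K n) hFl x'), map_add]; rfl
  | tmul p v =>
    induction y using TensorProduct.induction_on with
    | zero => simp [Pzero_lie, Plie_zero]
    | add x x' hx hx' => simp only [Plie_add, map_add, hx, hx']
    | tmul q w => rfl

theorem rhoP_eul (ρ : n →ₗ[K] Module.End K W) (x : Polynomial K ⊗[K] n) :
    eulT W * rhoP ρ x - rhoP ρ x * eulT W = rhoP ρ (eulT n x) := by
  induction x using TensorProduct.induction_on with
  | zero => simp [Pzero_lie, Plie_zero]; exact (sub_zero (0 : Module.End K (Polynomial K ⊗[K] W)))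
  | add x x' hx hx' => rw [map_add, map_add, map_add, ← hx, ← hx', mul_add, add_mul]; abel
  | tmul p v =>
    apply TensorProduct.ext'
    intro r u
    simp only [LinearMap.sub_apply, Module.End.mul_apply, rhoP_tmul_tmul, eulT_tmul]
    rw [← TensorProduct.sub_tmul, eul_apply, eul_apply, eul_apply, Polynomial.derivative_mul]
    congr 1
    ring

theorem ev_nexp (ρ : n →ₗ[K] Module.End K W) {G : ℕ → Submodule K W} {N' : ℕ} (hG : IsFilt G N')
    (hGl : ∀ x, ρ x ∈ low G) (t : K) (x : Polynomial K ⊗[K] n) (w : Polynomial K ⊗[K] W) :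
    ev t W (nexp K (rhoP ρ x) w) = nexp K (ρ (ev t n x)) (ev t W w) :=
  nev_intertwine (low_nilp (tF_isFilt hG) (rhoP_low ρ hGl x)) (low_nilp hG (hGl _)) _
    (fun v => rhoP_ev ρ t x v) _ _

theorem ev_bbch {F : ℕ → Submodule K n} {N : ℕ} (hF : IsFilt F N) (hFl : ∀ x, lbr K n x ∈ low F)
    (t : K) (x y : Polynomial K ⊗[K] n) :
    ev t n (bbch (lbr K _) x y) = bbch (lbr K n) (ev t n x) (ev t n y) :=
  bbch_map _ (fun x y => ev_lie t x y) (tF_isFilt hF) hF (lbrP_low hFl _) (lbrP_low hFl _)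
    (hFl _) (hFl _)

theorem eul_X : eul K Polynomial.X = Polynomial.X := by
  rw [eul_apply, Polynomial.derivative_X, mul_one]

/-- The Baker-Campbell-Hausdorff theorem for nilpotent representations. -/
theorem bch_gen (ρ : n →ₗ[K] Module.End K W)
    (hρ : ∀ x y, ρ ⁅x, y⁆ = ρ x * ρ y - ρ y * ρ x)
    {F : ℕ → Submodule K n} {N : ℕ} (hF : IsFilt F N) (hFl : ∀ x, lbr K n x ∈ low F)
    {G : ℕ → Submodule K W} {N' : ℕ} (hG : IsFilt G N') (hGl : ∀ x, ρ x ∈ low G) (a b : n) :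
    nexp K (ρ a) * nexp K (ρ b) = nexp K (ρ (bbch (lbr K n) a b)) := by
  have key := bch_graded (rhoP ρ) (rhoP_lie ρ hρ) (tF_isFilt hF) (lbrP_low hFl) (tF_isFilt hG)
    (rhoP_low ρ hGl) (eulT n) eulT_lie (eulT W) (rhoP_eul ρ)
    (Polynomial.X ⊗ₜ a) (Polynomial.X ⊗ₜ b) (by rw [eulT_tmul, eul_X]) (by rw [eulT_tmul, eul_X])
  apply LinearMap.ext
  intro w
  have := congrArg (ev 1 W) (LinearMap.congr_fun key ((1 : Polynomial K) ⊗ₜ w))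
  rw [Module.End.mul_apply, ev_nexp ρ hG hGl, ev_nexp ρ hG hGl, ev_nexp ρ hG hGl,
    ev_bbch hF hFl] at this
  simpa using this

/-- Endomorphisms of the faithful module. -/
abbrev FE (K : Type) [Field K] (n : Type*) [LieRing n] [LieAlgebra K n] :=
  Module.End K ((Polynomial K ⊗[K] n) × K)

/-- A faithful representation on polynomial elements. -/
def faith (K : Type) [Field K] [CharZero K] (n : Type*) [LieRing n] [LieAlgebra K n] :
    (Polynomial K ⊗[K] n) →ₗ[K] Module.End K ((Polynomial K ⊗[K] n) × K) where
  toFun z := augOp (lbr K _ z) (- eulT n z)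
  map_add' x y := by
    apply LinearMap.ext
    rintro ⟨v, c⟩
    rw [LinearMap.add_apply, augOp_apply, augOp_apply, augOp_apply, Prod.mk_add_mk, map_add,
      LinearMap.add_apply, map_add]
    ext
    · simp only [neg_add, smul_add]; abel
    · simp
  map_smul' r x := by
    apply LinearMap.ext
    rintro ⟨v, c⟩
    rw [LinearMap.smul_apply, augOp_apply, augOp_apply, map_smul, LinearMap.smul_apply, map_smul]
    ext
    · simp only [RingHom.id_apply, Prod.smul_mk, smul_add, smul_neg]
      rw [smul_comm]
    · simp

theorem faith_apply (z v : Polynomial K ⊗[K] n) (c : K) :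
    faith K n z (v, c) = (⁅z, v⁆ - c • eulT n z, 0) := by
  show augOp (lbr K _ z) (- eulT n z) (v, c) = _
  rw [augOp_apply, smul_neg, lbr_apply, sub_eq_add_neg]

theorem faith_lie (x y : Polynomial K ⊗[K] n) :
    faith K n ⁅x, y⁆ = faith K n x * faith K n y - faith K n y * faith K n x := by
  apply LinearMap.ext
  rintro ⟨v, c⟩
  simp only [LinearMap.sub_apply, Module.End.mul_apply, faith_apply, eulT_lie]
  ext
  · simp only [Prod.mk_sub_mk, zero_smul, sub_zero, Plie_sub, Plie_smul, Plie_lie, smul_add]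
    rw [← Plie_skew (eulT n x) y, smul_neg]
    abel
  · simp

theorem faith_low {F : ℕ → Submodule K n} {N : ℕ} (hF : IsFilt F N)
    (hFl : ∀ x, lbr K n x ∈ low F) (x : Polynomial K ⊗[K] n) :
    faith K n x ∈ low (augF (tF (Polynomial K) F)) :=
  augOp_low (tF_isFilt hF) (lbrP_low hFl x) _

section conseq


theorem faith_nilp {F : ℕ → Submodule K n} {N : ℕ} (hF : IsFilt F N)
    (hFl : ∀ x, lbr K n x ∈ low F) (x : Polynomial K ⊗[K] n) : IsNilpotent (faith K n x) :=
  low_nilp (augF_isFilt (tF_isFilt hF)) (faith_low hF hFl x)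

theorem faith_bch {F : ℕ → Submodule K n} {N : ℕ} (hF : IsFilt F N)
    (hFl : ∀ x, lbr K n x ∈ low F) (x y : Polynomial K ⊗[K] n) :
    nexp K (faith K n (bbch (lbr K _) x y)) = nexp K (faith K n x) * nexp K (faith K n y) :=
  (bch_gen (faith K n) faith_lie (tF_isFilt hF) (lbrP_low hFl) (augF_isFilt (tF_isFilt hF))
    (faith_low hF hFl) x y).symm

theorem faith_inj {F : ℕ → Submodule K n} {N : ℕ} (hF : IsFilt F N)
    (hFl : ∀ x, lbr K n x ∈ low F) {x y : Polynomial K ⊗[K] n} (hx : ev 0 n x = 0) (hy : ev 0 n y = 0)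
    (h : nexp K (faith K n x) = nexp K (faith K n y)) : x = y := by
  have h1 : faith K n x = faith K n y := by
    rw [← nlog_nexp (K := K) (R := FE K n) (faith_nilp hF hFl x), h, nlog_nexp (R := FE K n) (faith_nilp hF hFl y)]
  have h2 := congrArg Prod.fst (LinearMap.congr_fun h1 (0, 1))
  rw [faith_apply, faith_apply] at h2
  simp only [Plie_zero, one_smul, zero_sub, neg_inj] at h2
  rw [← sub_eq_zero]
  apply eulT_inj
  · rw [map_sub, h2, sub_self]
  · rw [map_sub, hx, hy, sub_self]

theorem bbch_zero_zero {F : ℕ → Submodule K n} {N : ℕ} (hF : IsFilt F N)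
    (hFl : ∀ x, lbr K n x ∈ low F) : bbch (lbr K n) (0 : n) 0 = 0 := by
  have := bbch_mem (br := lbr K n) ⊥ (by
    intro x hx y hy
    rw [Submodule.mem_bot] at *
    rw [hx, map_zero]; rfl) (Submodule.zero_mem _) (Submodule.zero_mem _)
  simpa using this

/-- Elements of the form `X ⊗ a`. -/
theorem ev_X {F : ℕ → Submodule K n} {N : ℕ} (hF : IsFilt F N)
    (hFl : ∀ x, lbr K n x ∈ low F) (t : K) (a : n) : ev t n (Polynomial.X ⊗ₜ a) = t • a := by simp

theorem bbch_assoc {F : ℕ → Submodule K n} {N : ℕ} (hF : IsFilt F N)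
    (hFl : ∀ x, lbr K n x ∈ low F) (a b c : n) :
    bbch (lbr K n) (bbch (lbr K n) a b) c = bbch (lbr K n) a (bbch (lbr K n) b c) := by
  have := faith_inj hF hFl
    (x := bbch (lbr K _) (bbch (lbr K _) (Polynomial.X ⊗ₜ a) (Polynomial.X ⊗ₜ b)) (Polynomial.X ⊗ₜ c))
    (y := bbch (lbr K _) (Polynomial.X ⊗ₜ a) (bbch (lbr K _) (Polynomial.X ⊗ₜ b) (Polynomial.X ⊗ₜ c)))
    (by simp [ev_bbch hF hFl, bbch_zero_zero hF hFl]) (by simp [ev_bbch hF hFl, bbch_zero_zero hF hFl])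
    (by simp only [faith_bch hF hFl, mul_assoc])
  have := congrArg (ev 1 n) this
  simpa [ev_bbch hF hFl] using this

theorem bbch_zero_right {F : ℕ → Submodule K n} {N : ℕ} (hF : IsFilt F N)
    (hFl : ∀ x, lbr K n x ∈ low F) (a : n) : bbch (lbr K n) a 0 = a := by
  have := faith_inj hF hFl
    (x := bbch (lbr K _) (Polynomial.X ⊗ₜ a) 0)
    (y := (Polynomial.X ⊗ₜ a))
    (by simp [ev_bbch hF hFl, bbch_zero_zero hF hFl]) (by simp)
    (by simp only [faith_bch hF hFl, map_zero, nexp_zero, mul_one])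
  have := congrArg (ev 1 n) this
  simpa [ev_bbch hF hFl] using this

theorem bbch_zero_left {F : ℕ → Submodule K n} {N : ℕ} (hF : IsFilt F N)
    (hFl : ∀ x, lbr K n x ∈ low F) (a : n) : bbch (lbr K n) 0 a = a := by
  have := faith_inj hF hFl
    (x := bbch (lbr K _) 0 (Polynomial.X ⊗ₜ a))
    (y := (Polynomial.X ⊗ₜ a))
    (by simp [ev_bbch hF hFl, bbch_zero_zero hF hFl]) (by simp)
    (by simp only [faith_bch hF hFl, map_zero, nexp_zero, one_mul])
  have := congrArg (ev 1 n) this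
  simpa [ev_bbch hF hFl] using this

theorem bbch_neg_left {F : ℕ → Submodule K n} {N : ℕ} (hF : IsFilt F N)
    (hFl : ∀ x, lbr K n x ∈ low F) (a : n) : bbch (lbr K n) (-a) a = 0 := by
  have := faith_inj hF hFl
    (x := bbch (lbr K _) (-(Polynomial.X ⊗ₜ a)) (Polynomial.X ⊗ₜ a))
    (y := 0)
    (by simp [ev_bbch hF hFl, bbch_zero_zero hF hFl]) (by simp)
    (by simp only [faith_bch hF hFl, map_zero, nexp_zero, map_neg,
      nexp_neg_mul (R := FE K n) (faith_nilp hF hFl _)])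
  have := congrArg (ev 1 n) this
  simpa [ev_bbch hF hFl] using this

theorem bbch_conj {F : ℕ → Submodule K n} {N : ℕ} (hF : IsFilt F N)
    (hFl : ∀ x, lbr K n x ∈ low F) (a c : n) :
    bbch (lbr K n) a (bbch (lbr K n) c (-a)) = nexp K (lbr K n a) c := by
  have nl : ∀ x : Polynomial K ⊗[K] n, IsNilpotent (lbr K _ x) := fun x =>
    low_nilp (tF_isFilt hF) (lbrP_low hFl x)
  have he : ∀ (t : K) (x y : Polynomial K ⊗[K] n), ev t n (nexp K (lbr K _ x) y) = nexp K (lbr K n (ev t n x)) (ev t n y) :=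
    fun t x y => nev_intertwine (nl x) (low_nilp hF (hFl _)) _ (fun v => ev_lie t x v) _ _
  have hconj : ∀ x y : Polynomial K ⊗[K] n,
      nexp K (faith K n (nexp K (lbr K _ x) y)) =
        nexp K (faith K n x) * (nexp K (faith K n y) * nexp K (faith K n (-x))) := by
    intro x y
    have e1 : faith K n (nexp K (lbr K _ x) y) =
        nexp K (faith K n x) * faith K n y * nexp K (-faith K n x) := by
      rw [← nexp_cad (R := FE K n) (faith_nilp hF hFl x)]
      exact nev_intertwine (V := Polynomial K ⊗[K] n) (W := FE K n) (x := lbr K _ x)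
        (y := cad K (R := FE K n) (faith K n x)) (nl x) (cad_nilp (R := FE K n) (faith_nilp hF hFl x)) (faith K n)
        (fun v => faith_lie x v) _ _
    have hn := faith_nilp hF hFl (nexp K (lbr K _ x) y)
    rw [map_neg]
    have e2 : nexp K (faith K n x) * nexp K (faith K n y) =
      nexp K (faith K n (nexp K (lbr K _ x) y)) * nexp K (faith K n x) := by
      apply LinearMap.ext
      intro v
      refine nev_intertwine (faith_nilp hF hFl y) hn (nexp K (faith K n x)) ?_ _ _
      intro v
      have e3 : nexp K (faith K n x) * faith K n y =
          faith K n (nexp K (lbr K _ x) y) * nexp K (faith K n x) := by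
        rw [e1, mul_assoc, nexp_neg_mul (R := FE K n) (faith_nilp hF hFl x), mul_one]
      exact LinearMap.congr_fun e3 v
    rw [← mul_assoc, e2, mul_assoc, nexp_mul_neg (R := FE K n) (faith_nilp hF hFl x), mul_one]
  have := faith_inj hF hFl
    (x := bbch (lbr K _) (Polynomial.X ⊗ₜ a) (bbch (lbr K _) (Polynomial.X ⊗ₜ c)
      (-(Polynomial.X ⊗ₜ a))))
    (y := nexp K (lbr K _ (Polynomial.X ⊗ₜ a)) (Polynomial.X ⊗ₜ c))
    (by simp [ev_bbch hF hFl, bbch_zero_zero hF hFl]) (by simp [he])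
    (by simp only [faith_bch hF hFl, hconj])
  have := congrArg (ev 1 n) this
  simpa [ev_bbch hF hFl, he] using this

end conseq

end general

end BCHAux

set_option linter.unusedSimpArgs false

set_option linter.unusedSectionVars false
set_option linter.unusedVariables false

namespace BCHAux

open PowerSeries

/-- The properties of `L ⊗ m_A` that are used in the sequel. -/
class NilD {K : Type} [Field K] (M : PreDGLA K) : Prop where
  d_sq : ∀ x, M.d (M.d x) = 0
  d_deg : ∀ i, ∀ x ∈ M.comp i, M.d x ∈ M.comp (i + 1)
  br_deg : ∀ i j, ∀ x ∈ M.comp i, ∀ y ∈ M.comp j, M.br x y ∈ M.comp (i + j)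
  antisymm : ∀ i j, ∀ x ∈ M.comp i, ∀ y ∈ M.comp j,
      M.br x y = -(PreDGLA.sgn (i * j) • M.br y x)
  jacobi : ∀ i j, ∀ x ∈ M.comp i, ∀ y ∈ M.comp j, ∀ z,
      M.br x (M.br y z) = M.br (M.br x y) z + PreDGLA.sgn (i * j) • M.br y (M.br x z)
  jac0 : ∀ x ∈ M.comp 0, ∀ y z, M.br x (M.br y z) = M.br (M.br x y) z + M.br y (M.br x z)
  leibniz : ∀ i, ∀ x ∈ M.comp i, ∀ y,
      M.d (M.br x y) = M.br (M.d x) y + PreDGLA.sgn i • M.br x (M.d y)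
  filt : ∃ (F : ℕ → Submodule K M.carrier) (N : ℕ), IsFilt F N ∧ ∀ x, M.br x ∈ low F

section sgn

theorem sgn_zero : PreDGLA.sgn 0 = 1 := by simp [PreDGLA.sgn]
theorem sgn_one : PreDGLA.sgn 1 = -1 := by simp [PreDGLA.sgn]
theorem sgn_neg_one : PreDGLA.sgn (-1) = -1 := by simp [PreDGLA.sgn]

end sgn

section dg

variable {K : Type} [Field K] [CharZero K] {M : PreDGLA K} [NilD M]

theorem half_zero {V : Type*} [AddCommGroup V] [Module K V] {x : V} (h : x = -x) : x = 0 := by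
  have h2 : (2 : K) • x = 0 := by
    rw [two_smul]
    nth_rewrite 2 [h]
    exact add_neg_cancel x
  exact (smul_eq_zero.1 h2).resolve_left two_ne_zero

theorem leib0 {a : M.carrier} (ha : a ∈ M.comp 0) (y : M.carrier) :
    M.d (M.br a y) = M.br (M.d a) y + M.br a (M.d y) := by
  have := NilD.leibniz 0 a ha y
  rwa [sgn_zero, one_smul] at this

theorem leib1 {x : M.carrier} (hx : x ∈ M.comp 1) (y : M.carrier) :
    M.d (M.br x y) = M.br (M.d x) y - M.br x (M.d y) := by
  have := NilD.leibniz 1 x hx y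
  rwa [sgn_one, neg_smul, one_smul, ← sub_eq_add_neg] at this

theorem leibm {x : M.carrier} (hx : x ∈ M.comp (-1)) (y : M.carrier) :
    M.d (M.br x y) = M.br (M.d x) y - M.br x (M.d y) := by
  have := NilD.leibniz (-1) x hx y
  rwa [sgn_neg_one, neg_smul, one_smul, ← sub_eq_add_neg] at this

theorem anti0 {a : M.carrier} (ha : a ∈ M.comp 0) {i : ℤ} {y : M.carrier} (hy : y ∈ M.comp i) :
    M.br a y = - M.br y a := by
  have := NilD.antisymm 0 i a ha y hy
  rwa [zero_mul, sgn_zero, one_smul] at this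

theorem anti1 {x y : M.carrier} (hx : x ∈ M.comp 1) (hy : y ∈ M.comp 1) :
    M.br x y = M.br y x := by
  have := NilD.antisymm 1 1 x hx y hy
  rwa [one_mul, sgn_one, neg_smul, one_smul, neg_neg] at this

/-- The Lie algebra of degree zero elements. -/
def L0 (M : PreDGLA K) : Type := ↥(M.comp 0)

instance : AddCommGroup (L0 M) := inferInstanceAs (AddCommGroup ↥(M.comp 0))
instance : Module K (L0 M) := inferInstanceAs (Module K ↥(M.comp 0))

/-- The inclusion of degree zero elements. -/
def v0 (M : PreDGLA K) : L0 M →ₗ[K] M.carrier := (M.comp 0).subtype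

/-- Constructor for degree zero elements. -/
def mk0 {a : M.carrier} (ha : a ∈ M.comp 0) : L0 M := ⟨a, ha⟩

@[simp] theorem v0_mk0 {a : M.carrier} (ha : a ∈ M.comp 0) : v0 M (mk0 ha) = a := rfl

theorem v0_mem (a : L0 M) : v0 M a ∈ M.comp 0 := Subtype.property a

theorem v0_inj {a b : L0 M} (h : v0 M a = v0 M b) : a = b := Subtype.ext h

instance : Bracket (L0 M) (L0 M) :=
  ⟨fun a b => mk0 (a := M.br (v0 M a) (v0 M b))
    (by simpa using NilD.br_deg 0 0 _ (v0_mem a) _ (v0_mem b))⟩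

theorem v0_lie (a b : L0 M) : v0 M ⁅a, b⁆ = M.br (v0 M a) (v0 M b) := rfl

instance : LieRing (L0 M) where
  add_lie x y z := v0_inj (by simp [v0_lie])
  lie_add x y z := v0_inj (by simp [v0_lie])
  lie_self x := v0_inj (by
    rw [v0_lie, map_zero]
    exact half_zero (K := K) (anti0 (v0_mem x) (v0_mem x)))
  leibniz_lie x y z := v0_inj (by
    rw [map_add]
    simp only [v0_lie]
    exact NilD.jac0 _ (v0_mem x) _ _)

instance : LieAlgebra K (L0 M) where
  lie_smul c x y := v0_inj (by simp [v0_lie])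

theorem L0_filt : ∃ (F : ℕ → Submodule K (L0 M)) (N : ℕ),
    IsFilt F N ∧ ∀ x, lbr K (L0 M) x ∈ low F := by
  obtain ⟨F, N, hF, h⟩ := NilD.filt (M := M)
  refine ⟨fun k => (F k).comap (v0 M), N, ⟨?_, ?_, ?_⟩, ?_⟩
  · simp [hF.top]
  · rw [hF.bot, Submodule.eq_bot_iff]
    intro x hx
    exact v0_inj (by simpa using hx)
  · intro k
    exact Submodule.comap_mono (hF.anti k)
  · intro x k y hy
    exact h (v0 M x) k _ hy

theorem br_nilp (x : M.carrier) : IsNilpotent (M.br x) := by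
  obtain ⟨F, N, hF, h⟩ := NilD.filt (M := M)
  exact low_nilp hF (h x)

/-- The Baker-Campbell-Hausdorff group. -/
instance : Group (L0 M) :=
  { mul := fun a b => bbch (lbr K (L0 M)) a b
    one := 0
    inv := fun a => -a
    mul_assoc := fun a b c => by
      obtain ⟨F, N, hF, h⟩ := L0_filt (M := M)
      exact bbch_assoc hF h a b c
    one_mul := fun a => by
      obtain ⟨F, N, hF, h⟩ := L0_filt (M := M)
      exact bbch_zero_left hF h a
    mul_one := fun a => by
      obtain ⟨F, N, hF, h⟩ := L0_filt (M := M)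
      exact bbch_zero_right hF h a
    inv_mul_cancel := fun a => by
      obtain ⟨F, N, hF, h⟩ := L0_filt (M := M)
      exact bbch_neg_left hF h a }

theorem mul_def (a b : L0 M) : a * b = bbch (lbr K (L0 M)) a b := rfl
theorem v0_one : v0 M 1 = 0 := rfl
theorem v0_inv (a : L0 M) : v0 M a⁻¹ = - v0 M a := rfl

theorem v0_mul (a b : L0 M) : v0 M (a * b) = M.bch (v0 M a) (v0 M b) := by
  obtain ⟨F, N, hF, h⟩ := L0_filt (M := M)
  obtain ⟨F', N', hF', h'⟩ := NilD.filt (M := M)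
  rw [bch_eq, mul_def]
  exact bbch_map (v0 M) v0_lie hF hF' (h _) (h _) (h' _) (h' _)

theorem v0_conj (a c : L0 M) : v0 M (a * c * a⁻¹) = nexp K (M.br (v0 M a)) (v0 M c) := by
  obtain ⟨F, N, hF, h⟩ := L0_filt (M := M)
  have e : a * c * a⁻¹ = nexp K (lbr K (L0 M) a) c := by
    rw [mul_assoc]
    exact bbch_conj hF h a c
  rw [e]
  exact nev_intertwine (low_nilp hF (h a)) (br_nilp _) (v0 M) (fun v => v0_lie a v) _ _

/-- The affine representation whose exponential is the gauge action. -/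
def theta (M : PreDGLA K) [NilD M] : L0 M →ₗ[K] Module.End K (M.carrier × K) where
  toFun a := augOp (M.br (v0 M a)) (- M.d (v0 M a))
  map_add' x y := by
    apply LinearMap.ext
    rintro ⟨v, c⟩
    rw [LinearMap.add_apply, augOp_apply, augOp_apply, augOp_apply, Prod.mk_add_mk, map_add,
      map_add, LinearMap.add_apply, map_add]
    ext
    · simp only [neg_add, smul_add]; abel
    · simp
  map_smul' r x := by
    apply LinearMap.ext
    rintro ⟨v, c⟩
    rw [LinearMap.smul_apply, augOp_apply, augOp_apply, map_smul, map_smul, LinearMap.smul_apply,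
      map_smul]
    ext
    · simp only [RingHom.id_apply, Prod.smul_mk, smul_add, smul_neg]
      rw [smul_comm]
    · simp

theorem theta_apply (a : L0 M) (x : M.carrier) (c : K) :
    theta M a (x, c) = (M.br (v0 M a) x - c • M.d (v0 M a), 0) := by
  show augOp (M.br (v0 M a)) (- M.d (v0 M a)) (x, c) = _
  rw [augOp_apply, smul_neg, sub_eq_add_neg]

theorem theta_low : ∃ (F : ℕ → Submodule K (M.carrier × K)) (N : ℕ),
    IsFilt F N ∧ ∀ a, theta M a ∈ low F := by
  obtain ⟨F, N, hF, h⟩ := NilD.filt (M := M)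
  exact ⟨_, _, augF_isFilt hF, fun a => augOp_low hF (h _) _⟩

theorem theta_nilp (a : L0 M) : IsNilpotent (theta M a) := by
  obtain ⟨F, N, hF, h⟩ := theta_low (M := M)
  exact low_nilp hF (h a)

theorem theta_lie (a b : L0 M) :
    theta M ⁅a, b⁆ = theta M a * theta M b - theta M b * theta M a := by
  apply LinearMap.ext
  rintro ⟨x, c⟩
  simp only [LinearMap.sub_apply, Module.End.mul_apply, theta_apply, v0_lie, Prod.mk_sub_mk,
    zero_smul, sub_zero, map_sub, map_smul]
  rw [leib0 (v0_mem a), NilD.jac0 _ (v0_mem a) (v0 M b) x]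
  have := anti0 (v0_mem b) (NilD.d_deg 0 _ (v0_mem a))
  rw [this, smul_neg, smul_add]
  ext
  · simp only; abel
  · rfl

theorem gauge_eq (a : L0 M) (x : M.carrier) :
    M.gauge (v0 M a) x =
      x + nev (phi K) (M.br (v0 M a)) (M.br (v0 M a) x - M.d (v0 M a)) := by
  rw [nev_apply (br_nilp _)]
  simp only [phi, coeff_mk]
  rfl

theorem gauge_theta (a : L0 M) (x : M.carrier) :
    nexp K (theta M a) (x, 1) = (M.gauge (v0 M a) x, 1) := by
  rw [gauge_eq, sub_eq_add_neg]
  exact nexp_aug (br_nilp _) (theta_nilp a) x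

theorem gauge_mul (a b : L0 M) (x : M.carrier) :
    M.gauge (v0 M (a * b)) x = M.gauge (v0 M a) (M.gauge (v0 M b) x) := by
  obtain ⟨F, N, hF, h⟩ := L0_filt (M := M)
  obtain ⟨F', N', hF', h'⟩ := theta_low (M := M)
  have := bch_gen (theta M) theta_lie hF h hF' h' a b
  have := LinearMap.congr_fun this (x, 1)
  rw [Module.End.mul_apply, gauge_theta, gauge_theta, ← mul_def, gauge_theta] at this
  exact (congrArg Prod.fst this).symm

theorem gauge_fix {a : L0 M} {x : M.carrier} (h : M.br (v0 M a) x - M.d (v0 M a) = 0) :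
    M.gauge (v0 M a) x = x := by
  rw [gauge_eq, h, map_zero, add_zero]

theorem gauge_one (x : M.carrier) : M.gauge (v0 M 1) x = x :=
  gauge_fix (by rw [v0_one, map_zero, map_zero, LinearMap.zero_apply, sub_zero])

/-- Twisted differential. -/
def dx (M : PreDGLA K) (x : M.carrier) : Module.End K M.carrier := M.d + M.br x

theorem dx_apply (x h : M.carrier) : dx M x h = M.d h + M.br x h := rfl

theorem dx_sq {x : M.carrier} (hx : x ∈ M.MCset) (h : M.carrier) : dx M x (dx M x h) = 0 := by
  obtain ⟨h1, h2⟩ := hx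
  simp only [dx_apply, map_add, NilD.d_sq, leib1 h1]
  have j := NilD.jacobi 1 1 x h1 x h1 h
  rw [one_mul, sgn_one, neg_smul, one_smul, ← sub_eq_add_neg, eq_sub_iff_add_eq, ← two_smul K] at j
  have j2 : M.br x (M.br x h) = (2 : K)⁻¹ • M.br (M.br x x) h := by
    rw [← j, smul_smul, inv_mul_cancel₀ two_ne_zero, one_smul]
  have h3 : M.br (M.d x + (2 : K)⁻¹ • M.br x x) h = 0 := by
    rw [h2, map_zero, LinearMap.zero_apply]
  rw [map_add, map_smul, LinearMap.add_apply, LinearMap.smul_apply, ← j2] at h3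
  refine Eq.trans ?_ h3
  abel

theorem dx_deg {x : M.carrier} (hx : x ∈ M.comp 1) {h : M.carrier} (hh : h ∈ M.comp (-1)) :
    dx M x h ∈ M.comp 0 := by
  have h1 := NilD.d_deg (-1) h hh
  have h2 := NilD.br_deg 1 (-1) x hx h hh
  rw [show (-1 + 1 : ℤ) = 0 by norm_num] at h1
  rw [show (1 + -1 : ℤ) = 0 by norm_num] at h2
  exact Submodule.add_mem _ h1 h2

theorem dx_br {x : M.carrier} (hx : x ∈ M.comp 1) {h : M.carrier} (hh : h ∈ M.comp (-1))
    (z : M.carrier) :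
    dx M x (M.br h z) = M.br (dx M x h) z - M.br h (dx M x z) := by
  have j := NilD.jacobi 1 (-1) x hx h hh z
  rw [one_mul, sgn_neg_one, neg_smul, one_smul, ← sub_eq_add_neg] at j
  simp only [dx_apply, leibm hh, j, map_add, LinearMap.add_apply]
  abel

/-- The stabilizer as a submodule of the Lie algebra. -/
def stS (M : PreDGLA K) (x : M.carrier) : Submodule K (L0 M) where
  carrier := {y | ∃ h ∈ M.comp (-1), v0 M y = dx M x h}
  add_mem' := by
    rintro a b ⟨h, hh, e⟩ ⟨k, hk, e'⟩
    exact ⟨h + k, Submodule.add_mem _ hh hk, by rw [map_add, map_add, e, e']⟩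
  zero_mem' := ⟨0, Submodule.zero_mem _, by rw [map_zero, map_zero]⟩
  smul_mem' := by
    rintro c b ⟨h, hh, e⟩
    exact ⟨c • h, Submodule.smul_mem _ _ hh, by rw [map_smul, map_smul, e]⟩

theorem mem_stS {x : M.carrier} {y : L0 M} :
    y ∈ stS M x ↔ ∃ h ∈ M.comp (-1), v0 M y = M.d h + M.br x h := Iff.rfl

theorem stS_lie {x : M.carrier} (hx : x ∈ M.MCset) {a b : L0 M} (ha : a ∈ stS M x)
    (hb : b ∈ stS M x) : ⁅a, b⁆ ∈ stS M x := by
  obtain ⟨h, hh, e⟩ := ha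
  obtain ⟨k, hk, ek⟩ := hb
  refine ⟨M.br h (dx M x k), ?_, ?_⟩
  · simpa using NilD.br_deg (-1) 0 h hh _ (dx_deg hx.1 hk)
  · rw [v0_lie, dx_br hx.1 hh, dx_sq hx, map_zero, sub_zero, e, ek]

/-- The stabilizer as a subgroup. -/
def St (x : M.carrier) (hx : x ∈ M.MCset) : Subgroup (L0 M) where
  carrier := stS M x
  mul_mem' := fun {a b} ha hb => bbch_mem (br := lbr K (L0 M)) (stS M x)
    (fun x' hx' y hy => stS_lie hx hx' hy) ha hb
  one_mem' := (stS M x).zero_mem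
  inv_mem' := fun {a} ha => (stS M x).neg_mem ha

theorem mem_St {x : M.carrier} {hx : x ∈ M.MCset} {y : L0 M} :
    y ∈ St x hx ↔ ∃ h ∈ M.comp (-1), v0 M y = M.d h + M.br x h := Iff.rfl

theorem gauge_St {x : M.carrier} {hx : x ∈ M.MCset} {y : L0 M} (hy : y ∈ St x hx) :
    M.gauge (v0 M y) x = x := by
  apply gauge_fix
  rw [anti0 (v0_mem y) hx.1]
  obtain ⟨h, hh, e⟩ := mem_St.1 hy
  have := dx_sq hx h
  rw [dx_apply x h, ← e, dx_apply] at this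
  rw [← neg_eq_zero, ← this]
  abel

theorem nexp_dx (a : L0 M) (x : M.carrier) (hx : x ∈ M.comp 1) (h : M.carrier) :
    nexp K (M.br (v0 M a)) (dx M x h) =
      dx M (M.gauge (v0 M a) x) (nexp K (M.br (v0 M a)) h) := by
  set A := M.br (v0 M a) with hA
  have nA : IsNilpotent A := br_nilp _
  have e1 : cad K A (dx M x) = M.br (A x - M.d (v0 M a)) := by
    apply LinearMap.ext
    intro z
    rw [cad_apply, LinearMap.sub_apply, Module.End.mul_apply, Module.End.mul_apply, dx_apply,
      dx_apply, map_add, hA, leib0 (v0_mem a), NilD.jac0 _ (v0_mem a) x z, map_sub,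
      LinearMap.sub_apply]
    abel
  have e2 : ∀ w, nev (phi K) (cad K A) (M.br w) = M.br (nev (phi K) A w) := by
    intro w
    refine (nev_intertwine nA (cad_nilp nA) M.br ?_ _ w).symm
    intro w
    apply LinearMap.ext
    intro z
    rw [cad_apply, LinearMap.sub_apply, Module.End.mul_apply, Module.End.mul_apply, hA,
      NilD.jac0 _ (v0_mem a) w z]
    abel
  have e3 : nexp K (cad K A) (dx M x) = dx M (M.gauge (v0 M a) x) := by
    rw [nexp_eq_phi' (cad_nilp nA), LinearMap.add_apply, Module.End.mul_apply, e1, e2, gauge_eq,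
      Module.End.one_apply]
    unfold dx
    rw [map_add, ← hA]
    abel
  have e4 : nexp K A * dx M x * nexp K (-A) * nexp K A = nexp K A * dx M x := by
    rw [mul_assoc, nexp_neg_mul nA, mul_one]
  rw [← e3, nexp_cad nA]
  exact (LinearMap.congr_fun e4 h).symm

end dg

end BCHAux

set_option linter.unusedSimpArgs false
set_option linter.unusedSectionVars false
set_option linter.unusedVariables false

namespace BCHAux

open PowerSeries

section bil

variable {K : Type} [Field K] [CharZero K]
  {V W : Type*} [AddCommGroup V] [Module K V] [AddCommGroup W] [Module K W]

theorem nexp_bilin (b : V →ₗ[K] V →ₗ[K] W) {T : Module.End K V} {S : Module.End K W}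
    (hT : IsNilpotent T) (hS : IsNilpotent S)
    (h : ∀ u v, S (b u v) = b (T u) v + b u (T v)) (u v : V) :
    nexp K S (b u v) = b (nexp K T u) (nexp K T v) := by
  let P : Module.End K (V ⊗[K] V) := Module.End.rTensorAlgHom K V V T
  let Q : Module.End K (V ⊗[K] V) := Module.End.lTensorAlgHom K V V T
  have hP : IsNilpotent P := hT.map (Module.End.rTensorAlgHom K V V)
  have hQ : IsNilpotent Q := hT.map (Module.End.lTensorAlgHom K V V)
  have Pa : ∀ (R : Module.End K V) x y, Module.End.rTensorAlgHom K V V R (x ⊗ₜ y) = R x ⊗ₜ y :=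
    fun R x y => rfl
  have Qa : ∀ (R : Module.End K V) x y, Module.End.lTensorAlgHom K V V R (x ⊗ₜ y) = x ⊗ₜ R y :=
    fun R x y => rfl
  have hc : Commute P Q := by
    apply TensorProduct.ext'
    intro x y
    rfl
  have hPQ : IsNilpotent (P + Q) := hc.isNilpotent_add hP hQ
  have hi : ∀ t, TensorProduct.lift b ((P + Q) t) = S (TensorProduct.lift b t) := by
    intro t
    induction t with
    | zero => simp
    | add x y hx hy => rw [map_add, map_add, hx, hy, map_add, map_add]
    | tmul x y =>
      rw [LinearMap.add_apply, Pa, Qa, map_add, TensorProduct.lift.tmul, TensorProduct.lift.tmul,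
        TensorProduct.lift.tmul, h]
  have e := nev_intertwine hPQ hS (TensorProduct.lift b) hi (exp K) (u ⊗ₜ v)
  have e2 : nev (exp K) (P + Q) = nexp K (P + Q) := rfl
  rw [e2, nexp_add hc hP hQ, Module.End.mul_apply] at e
  have eP : nexp K P = Module.End.rTensorAlgHom K V V (nexp K T) := (nev_map hT _ _).symm
  have eQ : nexp K Q = Module.End.lTensorAlgHom K V V (nexp K T) := (nev_map hT _ _).symm
  rw [eP, eQ, Qa, Pa, TensorProduct.lift.tmul, TensorProduct.lift.tmul] at e
  exact e.symm

theorem nev_mem_sub {T : Module.End K V} (hT : IsNilpotent T) (S : Submodule K V)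
    (h : ∀ v ∈ S, T v ∈ S) (f : K⟦X⟧) {v : V} (hv : v ∈ S) : nev f T v ∈ S := by
  rw [nev_apply hT]
  refine finsum_induction (· ∈ S) S.zero_mem (fun _ _ => S.add_mem) ?_
  intro n
  apply S.smul_mem
  induction n with
  | zero => simpa using hv
  | succ n ih => rw [pow_succ', Module.End.mul_apply]; exact h _ ih

end bil

section dg

variable {K : Type} [Field K] [CharZero K] {M : PreDGLA K} [NilD M]

theorem br_comp (a : L0 M) (i : ℤ) : ∀ x ∈ M.comp i, M.br (v0 M a) x ∈ M.comp i := by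
  intro x hx
  have := NilD.br_deg 0 i _ (v0_mem a) x hx
  rwa [zero_add] at this

theorem d_comp (a : L0 M) : M.d (v0 M a) ∈ M.comp 1 := by
  have := NilD.d_deg 0 _ (v0_mem a)
  rwa [zero_add] at this

theorem gauge_comp (a : L0 M) {x : M.carrier} (hx : x ∈ M.comp 1) :
    M.gauge (v0 M a) x ∈ M.comp 1 := by
  rw [gauge_eq]
  exact Submodule.add_mem _ hx (nev_mem_sub (br_nilp _) _ (br_comp a 1) _
    (Submodule.sub_mem _ (br_comp a 1 x hx) (d_comp a)))

/-- The polarized curvature on `M¹ × K`. -/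
def pol (M : PreDGLA K) : (↥(M.comp 1) × K) →ₗ[K] (↥(M.comp 1) × K) →ₗ[K] M.carrier :=
  LinearMap.mk₂ K (fun u v => M.br u.1.1 v.1.1 + (u.2 • M.d v.1.1 + v.2 • M.d u.1.1))
    (by intro u v w; simp [add_smul]; abel)
    (by intro c u v; simp [smul_smul, mul_comm])
    (by intro u v w; simp [add_smul]; abel)
    (by intro c u v; simp [smul_smul, mul_comm])

theorem pol_apply (x y : ↥(M.comp 1)) (c e : K) :
    pol M (x, c) (y, e) = M.br x.1 y.1 + (c • M.d y.1 + e • M.d x.1) := rfl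

theorem gauge_MC (a : L0 M) {x : M.carrier} (hx : x ∈ M.MCset) :
    M.gauge (v0 M a) x ∈ M.MCset := by
  refine ⟨gauge_comp a hx.1, ?_⟩
  obtain ⟨F, N, hF, h⟩ := NilD.filt (M := M)
  let A : Module.End K (M.comp 1) := (M.br (v0 M a)).restrict (br_comp a 1)
  let F1 : ℕ → Submodule K (M.comp 1) := fun k => (F k).comap (M.comp 1).subtype
  have hF1 : IsFilt F1 N := by
    refine ⟨?_, ?_, ?_⟩
    · simp [F1, hF.top]
    · rw [Submodule.eq_bot_iff]
      intro y hy
      have : (y : M.carrier) ∈ F N := hy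
      rw [hF.bot] at this
      exact Subtype.ext this
    · intro k
      exact Submodule.comap_mono (hF.anti k)
  have hA : A ∈ low F1 := fun k y hy => h (v0 M a) k _ hy
  let w : M.comp 1 := ⟨- M.d (v0 M a), Submodule.neg_mem _ (d_comp a)⟩
  have nT : IsNilpotent (augOp A w) := low_nilp (augF_isFilt hF1) (augOp_low hF1 hA w)
  have nA : IsNilpotent A := low_nilp hF1 hA
  have key : ∀ u v, M.br (v0 M a) (pol M u v) = pol M (augOp A w u) v + pol M u (augOp A w v) := by
    rintro ⟨u, c⟩ ⟨v, e⟩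
    rw [augOp_apply, augOp_apply, pol_apply, pol_apply, pol_apply]
    have e1 : ((A u + c • w : M.comp 1) : M.carrier)
        = M.br (v0 M a) u.1 - c • M.d (v0 M a) := by
      show M.br (v0 M a) u.1 + c • (- M.d (v0 M a)) = _
      rw [smul_neg, sub_eq_add_neg]
    have e2 : ((A v + e • w : M.comp 1) : M.carrier)
        = M.br (v0 M a) v.1 - e • M.d (v0 M a) := by
      show M.br (v0 M a) v.1 + e • (- M.d (v0 M a)) = _
      rw [smul_neg, sub_eq_add_neg]
    rw [e1, e2]
    simp only [map_add, map_sub, map_smul, LinearMap.sub_apply, LinearMap.smul_apply,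
      leib0 (v0_mem a), NilD.d_sq, NilD.jac0 _ (v0_mem a) u.1 v.1, anti1 u.2 (d_comp a),
      zero_smul, smul_zero, smul_add, sub_zero]
    abel
  have main := nexp_bilin (pol M) nT (br_nilp (v0 M a)) key (⟨x, hx.1⟩, 1) (⟨x, hx.1⟩, 1)
  have z : pol M (⟨x, hx.1⟩, 1) (⟨x, hx.1⟩, 1) = 0 := by
    rw [pol_apply]
    have := congrArg ((2 : K) • ·) hx.2
    simp only [smul_add, smul_smul, smul_zero, mul_inv_cancel₀ (two_ne_zero (α := K)), one_smul] at this
    refine Eq.trans ?_ this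
    rw [two_smul, one_smul]
    exact add_comm _ _
  have g : nexp K (augOp A w) (⟨x, hx.1⟩, 1) =
      (⟨M.gauge (v0 M a) x, gauge_comp a hx.1⟩, 1) := by
    rw [nexp_aug nA nT]
    refine Prod.ext (Subtype.ext ?_) rfl
    show x + (M.comp 1).subtype _ = M.gauge (v0 M a) x
    rw [nev_intertwine nA (br_nilp (v0 M a)) (M.comp 1).subtype (fun v => rfl), gauge_eq,
      sub_eq_add_neg]
    rfl
  rw [z, map_zero, g, pol_apply] at main
  have := congrArg ((2 : K)⁻¹ • ·) main
  simp only [smul_add, one_smul, smul_zero] at this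
  rw [this, add_comm, ← two_smul K ((2 : K)⁻¹ • M.d _), smul_smul,
    mul_inv_cancel₀ (two_ne_zero (α := K)), one_smul]

theorem St_conj {a y : L0 M} {x x' : M.carrier} {hx : x ∈ M.MCset} (hy : y ∈ St x hx)
    (hx' : x' ∈ M.MCset) (e : M.gauge (v0 M a) x = x') : a * y * a⁻¹ ∈ St x' hx' := by
  obtain ⟨h, hh, e1⟩ := mem_St.1 hy
  subst e
  refine mem_St.2 ⟨nexp K (M.br (v0 M a)) h, nev_mem_sub (br_nilp _) _ (br_comp a (-1)) _ hh, ?_⟩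
  rw [v0_conj, e1]
  exact nexp_dx a x hx.1 h

end dg

section hom

variable {K : Type} [Field K] [CharZero K] {M M' : PreDGLA K} (T : PreDGLA.Hom M M')

theorem hom_comp {i : ℤ} {x : M.carrier} (hx : x ∈ M.comp i) : T.lin x ∈ M'.comp i := by
  unfold PreDGLA.comp at *
  rw [LinearMap.mem_ker, LinearMap.sub_apply, LinearMap.id_apply, sub_eq_zero] at *
  rw [← T.map_proj, hx]

theorem hom_MC {x : M.carrier} (hx : x ∈ M.MCset) : T.lin x ∈ M'.MCset := by
  refine ⟨hom_comp T hx.1, ?_⟩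
  rw [← T.map_d, ← T.map_br, ← map_smul, ← map_add, hx.2, map_zero]

variable [NilD M'] [NilD M]

def hm : L0 M →* L0 M' where
  toFun a := mk0 (hom_comp T (v0_mem a))
  map_one' := v0_inj (by rw [v0_mk0, v0_one, v0_one, map_zero])
  map_mul' a b := v0_inj (by
    obtain ⟨F, N, hF, h⟩ := NilD.filt (M := M)
    obtain ⟨F', N', hF', h'⟩ := NilD.filt (M := M')
    rw [v0_mk0, v0_mul, v0_mul, bch_eq, bch_eq]
    exact bbch_map T.lin T.map_br hF hF' (h _) (h _) (h' _) (h' _))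

theorem v0_hm (a : L0 M) : v0 M' (hm T a) = T.lin (v0 M a) := rfl

theorem hom_gauge (a : L0 M) (x : M.carrier) :
    T.lin (M.gauge (v0 M a) x) = M'.gauge (v0 M' (hm T a)) (T.lin x) := by
  rw [gauge_eq, gauge_eq, map_add, v0_hm,
    nev_intertwine (br_nilp _) (br_nilp (T.lin (v0 M a))) T.lin (fun v => T.map_br _ v), map_sub,
    T.map_br, T.map_d]

theorem hom_St {a : L0 M} {x : M.carrier} {x' : M'.carrier} {hx : x ∈ M.MCset} (ha : a ∈ St x hx)
    (hx' : x' ∈ M'.MCset) (e : T.lin x = x') : hm T a ∈ St x' hx' := by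
  subst e
  obtain ⟨h, hh, e⟩ := mem_St.1 ha
  refine mem_St.2 ⟨T.lin h, hom_comp T hh, ?_⟩
  rw [v0_hm, e, map_add, T.map_d, T.map_br]

end hom

end BCHAux

set_option linter.unusedSimpArgs false
set_option linter.unusedSectionVars false
set_option linter.unusedVariables false

namespace BCHAux

section tm

variable {K : Type} [Field K] {L : PreDGLA K} {R : ArtinData K}

theorem mem_comp {M : PreDGLA K} {i : ℤ} {x : M.carrier} : x ∈ M.comp i ↔ M.proj i x = x := by
  unfold PreDGLA.comp
  rw [LinearMap.mem_ker, LinearMap.sub_apply, LinearMap.id_apply, sub_eq_zero]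

/-- Pure tensors. -/
def tm (L : PreDGLA K) (R : ArtinData K) : L.carrier →ₗ[K] R.mId →ₗ[K] (L.tmA R).carrier :=
  TensorProduct.mk K L.carrier R.mId

theorem tm_br (u v : L.carrier) (μ ν : R.mId) :
    (L.tmA R).br (tm L R u μ) (tm L R v ν) = tm L R (L.br u v) (R.mmul μ ν) := rfl

theorem tm_d (u : L.carrier) (μ : R.mId) : (L.tmA R).d (tm L R u μ) = tm L R (L.d u) μ := rfl

theorem tm_proj (i : ℤ) (u : L.carrier) (μ : R.mId) :
    (L.tmA R).proj i (tm L R u μ) = tm L R (L.proj i u) μ := rfl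

theorem tm_ind {p : (L.tmA R).carrier → Prop} (h0 : p 0) (ht : ∀ u μ, p (tm L R u μ))
    (ha : ∀ x y, p x → p y → p (x + y)) (x : (L.tmA R).carrier) : p x :=
  TensorProduct.induction_on x h0 ht ha

theorem tm_comp {i : ℤ} {u : L.carrier} (hu : u ∈ L.comp i) (μ : R.mId) :
    tm L R u μ ∈ (L.tmA R).comp i := by
  rw [mem_comp] at *
  rw [tm_proj, hu]

theorem tm_cind0 (hL : L.IsDGLA) {i : ℤ} {p : (L.tmA R).carrier → Prop} (h0 : p 0)
    (ht : ∀ u ∈ L.comp i, ∀ μ, p (tm L R u μ))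
    (ha : ∀ x y, p x → p y → p (x + y)) (x : (L.tmA R).carrier) (hx : x ∈ (L.tmA R).comp i) :
    p x := by
  rw [mem_comp] at hx
  rw [← hx]
  clear hx
  induction x using tm_ind with
  | h0 => rwa [map_zero]
  | ht u μ =>
    rw [tm_proj]
    exact ht _ (mem_comp.2 (hL.proj_idem i u)) μ
  | ha x y hx hy =>
    rw [map_add]
    exact ha _ _ hx hy

theorem tm_cind (hL : L.IsDGLA) {i : ℤ}
    {p : (x : (L.tmA R).carrier) → x ∈ (L.tmA R).comp i → Prop} (h0 : p 0 (Submodule.zero_mem _))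
    (ht : ∀ u (hu : u ∈ L.comp i) μ, p (tm L R u μ) (tm_comp hu μ))
    (ha : ∀ x y hx hy, p x hx → p y hy → p (x + y) (Submodule.add_mem _ hx hy))
    (x : (L.tmA R).carrier) (hx : x ∈ (L.tmA R).comp i) : p x hx := by
  have : ∃ h, p x h := by
    refine tm_cind0 hL (p := fun x => ∃ h, p x h) ⟨_, h0⟩ (fun u hu μ => ⟨_, ht u hu μ⟩) ?_ x hx
    rintro x y ⟨h, h1⟩ ⟨k, k1⟩
    exact ⟨_, ha x y h k h1 k1⟩
  obtain ⟨h, h1⟩ := this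
  exact h1

theorem L_ind (hL : L.IsDGLA) {p : L.carrier → Prop} (h0 : p 0)
    (ht : ∀ i, ∀ u ∈ L.comp i, p u)
    (ha : ∀ x y, p x → p y → p (x + y)) (x : L.carrier) : p x := by
  rw [← hL.proj_total x]
  exact finsum_induction p h0 ha (fun i => ht i _ (mem_comp.2 (hL.proj_idem i x)))

theorem L_jac0 (hL : L.IsDGLA) {x : L.carrier} (hx : x ∈ L.comp 0) (y z : L.carrier) :
    L.br x (L.br y z) = L.br (L.br x y) z + L.br y (L.br x z) := by
  induction y using L_ind hL with
  | h0 => simp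
  | ht i y hy =>
    have := hL.jacobi 0 i x hx y hy z
    rwa [zero_mul, sgn_zero, one_smul] at this
  | ha y y' h h' =>
    simp only [map_add, LinearMap.add_apply, h, h']
    abel

theorem mmul_comm (μ ν : R.mId) : R.mmul μ ν = R.mmul ν μ := Subtype.ext (mul_comm μ.1 ν.1)

theorem mmul_assoc (μ ν ξ : R.mId) : R.mmul μ (R.mmul ν ξ) = R.mmul (R.mmul μ ν) ξ :=
  Subtype.ext (mul_assoc μ.1 ν.1 ξ.1).symm

theorem mmul_left_comm (μ ν ξ : R.mId) : R.mmul μ (R.mmul ν ξ) = R.mmul ν (R.mmul μ ξ) :=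
  Subtype.ext (mul_left_comm μ.1 ν.1 ξ.1)

theorem tm_filt : ∃ (F : ℕ → Submodule K (L.tmA R).carrier) (N : ℕ),
    IsFilt F N ∧ ∀ x, (L.tmA R).br x ∈ low F := by
  have := R.isArtinian
  obtain ⟨N, hN⟩ := IsArtinianRing.isNilpotent_jacobson_bot (R := R.A)
  rw [IsLocalRing.jacobson_eq_maximalIdeal ⊥ bot_ne_top] at hN
  let m := IsLocalRing.maximalIdeal R.A
  let F : ℕ → Submodule K (L.tmA R).carrier := fun k =>
    Submodule.span K {t | ∃ (u : L.carrier) (μ : R.mId), (μ : R.A) ∈ m ^ (k + 1) ∧ t = tm L R u μ}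
  refine ⟨F, N, ⟨?_, ?_, ?_⟩, ?_⟩
  · rw [eq_top_iff]
    intro x _
    induction x using tm_ind with
    | h0 => exact Submodule.zero_mem _
    | ht u μ =>
      refine Submodule.subset_span ⟨u, μ, ?_, rfl⟩
      rw [zero_add, pow_one]
      exact μ.2
    | ha x y hx hy => exact Submodule.add_mem _ (hx trivial) (hy trivial)
  · rw [Submodule.span_eq_bot]
    rintro _ ⟨u, μ, hμ, rfl⟩
    have : μ = 0 := by
      apply Subtype.ext
      have h2 : (μ : R.A) ∈ m ^ N := Ideal.pow_le_pow_right (Nat.le_succ N) hμ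
      rw [hN] at h2
      exact h2
    rw [this, map_zero]
  · intro k
    apply Submodule.span_mono
    rintro _ ⟨u, μ, hμ, rfl⟩
    exact ⟨u, μ, Ideal.pow_le_pow_right (Nat.le_succ _) hμ, rfl⟩
  · intro x k y hy
    induction hy using Submodule.span_induction with
    | zero => rw [map_zero]; exact Submodule.zero_mem _
    | add y z _ _ hy hz => rw [map_add]; exact Submodule.add_mem _ hy hz
    | smul c y _ hy => rw [map_smul]; exact Submodule.smul_mem _ _ hy
    | mem y hy =>
      obtain ⟨v, ν, hν, rfl⟩ := hy
      induction x using tm_ind with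
      | h0 => rw [map_zero, LinearMap.zero_apply]; exact Submodule.zero_mem _
      | ha x y hx hy => rw [map_add, LinearMap.add_apply]; exact Submodule.add_mem _ hx hy
      | ht u μ =>
        rw [tm_br]
        refine Submodule.subset_span ⟨_, _, ?_, rfl⟩
        rw [pow_succ']
        exact Ideal.mul_mem_mul μ.2 hν

theorem tmA_nilD (hL : L.IsDGLA) : NilD (L.tmA R) where
  d_sq := by
    intro x
    induction x using tm_ind with
    | h0 => simp
    | ht u μ => rw [tm_d, tm_d, hL.d_sq, map_zero, LinearMap.zero_apply]
    | ha x y hx hy => rw [map_add, map_add, hx, hy, add_zero]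
  d_deg := by
    intro i x hx
    induction x, hx using tm_cind hL with
    | h0 => simp
    | ht u hu μ => exact tm_comp (hL.d_deg i u hu) μ
    | ha x y _ _ hx hy => rw [map_add]; exact Submodule.add_mem _ hx hy
  br_deg := by
    intro i j x hx y hy
    induction x, hx using tm_cind hL with
    | h0 => simp
    | ha x x' _ _ hx hx' => rw [map_add, LinearMap.add_apply]; exact Submodule.add_mem _ hx hx'
    | ht u hu μ =>
      induction y, hy using tm_cind hL with
      | h0 => simp
      | ha x y _ _ hx hy => rw [map_add]; exact Submodule.add_mem _ hx hy
      | ht v hv ν => exact tm_comp (hL.br_deg i j u hu v hv) _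
  antisymm := by
    intro i j x hx y hy
    induction x, hx using tm_cind hL with
    | h0 => simp
    | ha x x' _ _ hx hx' =>
      rw [map_add, LinearMap.add_apply, hx, hx', map_add, smul_add, neg_add]
    | ht u hu μ =>
      induction y, hy using tm_cind hL with
      | h0 => simp
      | ha x x' _ _ hx hx' =>
        rw [map_add, hx, hx', map_add, LinearMap.add_apply, smul_add, neg_add]
      | ht v hv ν =>
        rw [tm_br, tm_br, hL.antisymm i j u hu v hv, mmul_comm, map_neg, map_zsmul,
          LinearMap.neg_apply, LinearMap.smul_apply]
  jacobi := by
    intro i j x hx y hy z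
    induction x, hx using tm_cind hL with
    | h0 => simp
    | ha x x' _ _ hx hx' =>
      simp only [map_add, LinearMap.add_apply, hx, hx', smul_add]
      abel
    | ht u hu μ =>
      induction y, hy using tm_cind hL with
      | h0 => simp
      | ha x x' _ _ hx hx' =>
        simp only [map_add, LinearMap.add_apply, hx, hx', smul_add]
        abel
      | ht v hv ν =>
        induction z using tm_ind with
        | h0 => simp
        | ha x x' hx hx' =>
          simp only [map_add, LinearMap.add_apply, hx, hx', smul_add]
          abel
        | ht w ξ =>
          simp only [tm_br]
          rw [hL.jacobi i j u hu v hv w, map_add, map_zsmul, LinearMap.add_apply,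
            LinearMap.smul_apply, mmul_left_comm ν μ, mmul_assoc]
  jac0 := by
    intro x hx y z
    induction x, hx using tm_cind hL with
    | h0 => simp
    | ha x x' _ _ hx hx' =>
      simp only [map_add, LinearMap.add_apply, hx, hx', smul_add]
      abel
    | ht u hu μ =>
      induction y using tm_ind with
      | h0 => simp
      | ha x x' hx hx' =>
        simp only [map_add, LinearMap.add_apply, hx, hx', smul_add]
        abel
      | ht v ν =>
        induction z using tm_ind with
        | h0 => simp
        | ha x x' hx hx' =>
          simp only [map_add, LinearMap.add_apply, hx, hx', smul_add]
          abel
        | ht w ξ =>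
          simp only [tm_br]
          rw [L_jac0 hL hu v w, map_add, LinearMap.add_apply, mmul_left_comm ν μ, mmul_assoc]
  leibniz := by
    intro i x hx y
    induction x, hx using tm_cind hL with
    | h0 => simp
    | ha x x' _ _ hx hx' =>
      simp only [map_add, LinearMap.add_apply, hx, hx', smul_add]
      abel
    | ht u hu μ =>
      induction y using tm_ind with
      | h0 => simp
      | ha x x' hx hx' =>
        simp only [map_add, LinearMap.add_apply, hx, hx', smul_add]
        abel
      | ht v ν =>
        simp only [tm_br, tm_d]
        rw [hL.leibniz i u hu v, map_add, map_zsmul, LinearMap.add_apply,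
            LinearMap.smul_apply]
  filt := tm_filt

/-- The linear map `h ⊗ id`. -/
def rLin {L' : PreDGLA K} (h : PreDGLA.Hom L L') (R : ArtinData K) :
    (L.tmA R).carrier →ₗ[K] (L'.tmA R).carrier := LinearMap.rTensor _ h.lin

/-- The morphism `h ⊗ id`. -/
def rHom {L' : PreDGLA K} (h : PreDGLA.Hom L L') (R : ArtinData K) :
    PreDGLA.Hom (L.tmA R) (L'.tmA R) where
  lin := rLin h R
  map_d x := by
    induction x using tm_ind with
    | h0 => simp
    | ht u μ => exact congrArg (fun t => tm L' R t μ) (h.map_d u)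
    | ha x y hx hy => rw [map_add, map_add, map_add, map_add, hx, hy]
  map_br x y := by
    induction x using tm_ind with
    | h0 => simp
    | ha x y hx hy => simp only [map_add, LinearMap.add_apply, hx, hy]
    | ht u μ =>
      induction y using tm_ind with
      | h0 => simp
      | ha x y hx hy => simp only [map_add, LinearMap.add_apply, hx, hy]
      | ht v ν => exact congrArg (fun t => tm L' R t (R.mmul μ ν)) (h.map_br u v)
  map_proj i x := by
    induction x using tm_ind with
    | h0 => simp
    | ht u μ => exact congrArg (fun t => tm L' R t μ) (h.map_proj i u)
    | ha x y hx hy => rw [map_add, map_add, map_add, map_add, hx, hy]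

/-- The morphism `id ⊗ f`. -/
def lHom {S : ArtinData K} (f : ArtinHom R S) (L : PreDGLA K) :
    PreDGLA.Hom (L.tmA R) (L.tmA S) where
  lin := f.tmap L
  map_d x := by
    induction x using tm_ind with
    | h0 => simp
    | ht u μ => rfl
    | ha x y hx hy => rw [map_add, map_add, map_add, map_add, hx, hy]
  map_br x y := by
    induction x using tm_ind with
    | h0 => simp
    | ha x y hx hy => simp only [map_add, LinearMap.add_apply, hx, hy]
    | ht u μ =>
      induction y using tm_ind with
      | h0 => simp
      | ha x y hx hy => simp only [map_add, LinearMap.add_apply, hx, hy]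
      | ht v ν =>
        refine congrArg (fun t => tm L S (L.br u v) t) (?_ : f.mLin (R.mmul μ ν) = S.mmul (f.mLin μ) (f.mLin ν))
        exact Subtype.ext (map_mul f.toAlg μ.1 ν.1)
  map_proj i x := by
    induction x using tm_ind with
    | h0 => simp
    | ht u μ => rfl
    | ha x y hx hy => rw [map_add, map_add, map_add, map_add, hx, hy]

theorem mLin_surj {S : ArtinData K} (f : ArtinHom R S) (hf : Function.Surjective f.toAlg) :
    Function.Surjective f.mLin := by
  rintro ⟨y, hy⟩
  obtain ⟨x, rfl⟩ := hf y
  refine ⟨⟨x, ?_⟩, rfl⟩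
  show x ∈ IsLocalRing.maximalIdeal R.A
  have h2 : f.toAlg x ∈ IsLocalRing.maximalIdeal S.A := hy
  rw [IsLocalRing.mem_maximalIdeal] at *
  exact fun hu => h2 (hu.map f.toAlg)

theorem tmap_lift {S : ArtinData K} (hL : L.IsDGLA) (f : ArtinHom R S)
    (hf : Function.Surjective f.toAlg) (i : ℤ) {y : (L.tmA S).carrier} (hy : y ∈ (L.tmA S).comp i) :
    ∃ x ∈ (L.tmA R).comp i, f.tmap L x = y := by
  obtain ⟨x, rfl⟩ := LinearMap.lTensor_surjective L.carrier (mLin_surj f hf) y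
  refine ⟨(L.tmA R).proj i x, ?_, ?_⟩
  · rw [mem_comp]
    clear hy
    induction x using tm_ind with
    | h0 => simp
    | ht u μ => rw [tm_proj, tm_proj, hL.proj_idem]
    | ha x y hx hy => rw [map_add, map_add, hx, hy]
  · exact ((lHom f L).map_proj i x).trans (mem_comp.1 hy)

end tm

end BCHAux

set_option linter.unusedSimpArgs false
set_option linter.unusedSectionVars false
set_option linter.unusedVariables false

namespace BCHAux

section fin

variable {K : Type} [Field K] [CharZero K] (G : ScDGLA K)

instance instNilD (R : ArtinData K) (n : ℕ) : NilD ((G.g n).tmA R) := tmA_nilD (G.isDGLA n)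

/-- The coface maps as morphisms. -/
abbrev fH (R : ArtinData K) (n : ℕ) (k : Fin (n + 2)) :
    PreDGLA.Hom ((G.g n).tmA R) ((G.g (n + 1)).tmA R) := rHom (G.face n k) R

/-- The coface maps on groups. -/
abbrev fG (R : ArtinData K) (n : ℕ) (k : Fin (n + 2)) :
    L0 ((G.g n).tmA R) →* L0 ((G.g (n + 1)).tmA R) := hm (fH G R n k)

theorem fH_lin (R : ArtinData K) (n : ℕ) (k : Fin (n + 2)) : (fH G R n k).lin = G.faceT R n k := rfl

theorem fH_comm (R : ArtinData K) (n : ℕ) (k l : Fin (n + 2)) (h : (l : ℕ) ≤ (k : ℕ))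
    (x : ((G.g n).tmA R).carrier) :
    (fH G R (n + 1) k.succ).lin ((fH G R n l).lin x) =
      (fH G R (n + 1) l.castSucc).lin ((fH G R n k).lin x) := by
  induction x using tm_ind with
  | h0 => simp only [map_zero]
  | ha x y hx hy => simp only [map_add, hx, hy]
  | ht u μ => exact congrArg (fun t => tm (G.g (n + 2)) R t μ) (G.face_comm n k l h u)

theorem fG_comm (R : ArtinData K) (n : ℕ) (k l : Fin (n + 2)) (h : (l : ℕ) ≤ (k : ℕ))
    (a : L0 ((G.g n).tmA R)) :
    fG G R (n + 1) k.succ (fG G R n l a) = fG G R (n + 1) l.castSucc (fG G R n k a) :=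
  v0_inj (fH_comm G R n k l h _)

theorem fH_nat {R S : ArtinData K} (f : ArtinHom R S) (n : ℕ) (k : Fin (n + 2))
    (x : ((G.g n).tmA R).carrier) :
    (lHom f (G.g (n + 1))).lin ((fH G R n k).lin x) =
      (fH G S n k).lin ((lHom f (G.g n)).lin x) := by
  induction x using tm_ind with
  | h0 => simp only [map_zero]
  | ha x y hx hy => simp only [map_add, hx, hy]
  | ht u μ => rfl

theorem fG_nat {R S : ArtinData K} (f : ArtinHom R S) (n : ℕ) (k : Fin (n + 2))
    (a : L0 ((G.g n).tmA R)) :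
    hm (lHom f (G.g (n + 1))) (fG G R n k a) = fG G S n k (hm (lHom f (G.g n)) a) :=
  v0_inj (fH_nat G f n k _)

theorem Zsc_iff (R : ArtinData K) {x : ((G.g 0).tmA R).carrier} (hx : x ∈ ((G.g 0).tmA R).MCset)
    (m : L0 ((G.g 1).tmA R)) :
    (x, v0 _ m) ∈ G.Zsc R ↔
      (fH G R 0 1).lin x = ((G.g 1).tmA R).gauge (v0 _ m) ((fH G R 0 0).lin x) ∧
      fG G R 1 0 m * ((fG G R 1 1 m)⁻¹ * fG G R 1 2 m) ∈
        St ((fH G R 1 2).lin ((fH G R 0 0).lin x)) (hom_MC _ (hom_MC _ hx)) := by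
  rw [mem_St, v0_mul, v0_mul, v0_inv, v0_hm, v0_hm, v0_hm]
  constructor
  · rintro ⟨_, _, h3, h4⟩
    exact ⟨h3, h4⟩
  · rintro ⟨h3, h4⟩
    exact ⟨hx, v0_mem m, h3, h4⟩

theorem srel_iff (R : ArtinData K) {x : ((G.g 0).tmA R).carrier} (hx : x ∈ ((G.g 0).tmA R).MCset)
    (x' : ((G.g 0).tmA R).carrier) (m m' : L0 ((G.g 1).tmA R)) :
    G.srel R (x, v0 _ m) (x', v0 _ m') ↔ ∃ a : L0 ((G.g 0).tmA R),
      ((G.g 0).tmA R).gauge (v0 _ a) x = x' ∧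
      m⁻¹ * ((fG G R 0 1 a)⁻¹ * (m' * fG G R 0 0 a)) ∈ St ((fH G R 0 0).lin x) (hom_MC _ hx) := by
  constructor
  · rintro ⟨a, ha, b, hb, h1, h2⟩
    refine ⟨mk0 ha, h1, mem_St.2 ⟨b, hb, ?_⟩⟩
    rw [v0_mul, v0_mul, v0_mul, v0_inv, v0_inv, v0_hm, v0_hm]
    exact h2
  · rintro ⟨a, h1, h2⟩
    obtain ⟨b, hb, h2⟩ := mem_St.1 h2
    rw [v0_mul, v0_mul, v0_mul, v0_inv, v0_inv, v0_hm, v0_hm] at h2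
    exact ⟨_, v0_mem a, b, hb, h1, h2⟩

theorem zmap_v0 {R S : ArtinData K} (f : ArtinHom R S) (x : ((G.g 0).tmA R).carrier)
    (m : L0 ((G.g 1).tmA R)) :
    G.zmap f (x, v0 _ m) = ((lHom f (G.g 0)).lin x, v0 _ (hm (lHom f (G.g 1)) m)) := rfl

theorem zmap_mem {R S : ArtinData K} (f : ArtinHom R S) :
    ∀ z ∈ G.Zsc R, G.zmap f z ∈ G.Zsc S := by
  rintro ⟨x, m⟩ hz
  have hx : x ∈ ((G.g 0).tmA R).MCset := hz.1
  obtain ⟨m, rfl⟩ : ∃ m', m = v0 _ m' := ⟨mk0 hz.2.1, rfl⟩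
  rw [zmap_v0, Zsc_iff G S (hom_MC _ hx)]
  obtain ⟨h1, h2⟩ := (Zsc_iff G R hx m).1 hz
  constructor
  · rw [← fH_nat, h1, hom_gauge, fH_nat]
  · have := hom_St (lHom f (G.g 2)) h2
      (hom_MC (fH G S 1 2) (hom_MC (fH G S 0 0) (hom_MC (lHom f (G.g 0)) hx)))
      (by rw [fH_nat, fH_nat])
    rwa [map_mul, map_mul, map_inv, fG_nat, fG_nat, fG_nat] at this

theorem Zsc_twist (R : ArtinData K) {x : ((G.g 0).tmA R).carrier} (hx : x ∈ ((G.g 0).tmA R).MCset)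
    {m : L0 ((G.g 1).tmA R)} (hz : (x, v0 _ m) ∈ G.Zsc R) (a : L0 ((G.g 0).tmA R))
    {s : L0 ((G.g 1).tmA R)} (hs : s ∈ St ((fH G R 0 0).lin x) (hom_MC _ hx)) :
    (((G.g 0).tmA R).gauge (v0 _ a) x, v0 _ (fG G R 0 1 a * m * s * (fG G R 0 0 a)⁻¹)) ∈
      G.Zsc R := by
  obtain ⟨h1, h2⟩ := (Zsc_iff G R hx m).1 hz
  rw [Zsc_iff G R (gauge_MC a hx)]
  have c00 : ∀ b : L0 ((G.g 0).tmA R), fG G R 1 1 (fG G R 0 0 b) = fG G R 1 0 (fG G R 0 0 b) :=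
    fG_comm G R 0 0 0 le_rfl
  have c10 : ∀ b : L0 ((G.g 0).tmA R), fG G R 1 2 (fG G R 0 0 b) = fG G R 1 0 (fG G R 0 1 b) :=
    fG_comm G R 0 1 0 (by simp)
  have c11 : ∀ b : L0 ((G.g 0).tmA R), fG G R 1 2 (fG G R 0 1 b) = fG G R 1 1 (fG G R 0 1 b) :=
    fG_comm G R 0 1 1 le_rfl
  have e00 : ∀ b, (fH G R 1 1).lin ((fH G R 0 0).lin b) = (fH G R 1 0).lin ((fH G R 0 0).lin b) :=
    fH_comm G R 0 0 0 le_rfl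
  have e10 : ∀ b, (fH G R 1 2).lin ((fH G R 0 0).lin b) = (fH G R 1 0).lin ((fH G R 0 1).lin b) :=
    fH_comm G R 0 1 0 (by simp)
  constructor
  · rw [hom_gauge, hom_gauge, ← gauge_mul, inv_mul_cancel_right, gauge_mul, gauge_mul, gauge_St hs,
      h1]
  · have hy : (fH G R 1 2).lin ((fH G R 0 0).lin x) ∈ ((G.g 2).tmA R).MCset :=
      hom_MC _ (hom_MC _ hx)
    have h00 : (fH G R 1 0).lin ((fH G R 0 0).lin x) ∈ ((G.g 2).tmA R).MCset :=
      hom_MC _ (hom_MC _ hx)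
    have s0 : fG G R 1 0 s ∈ St _ h00 := hom_St _ hs h00 rfl
    have s1 : fG G R 1 1 s ∈ St _ h00 := hom_St _ hs h00 (e00 x)
    have s2 : fG G R 1 2 s ∈ St _ hy := hom_St _ hs hy rfl
    have t : fG G R 1 0 m * (fG G R 1 0 s * (fG G R 1 1 s)⁻¹) * (fG G R 1 0 m)⁻¹ ∈ St _ hy := by
      refine St_conj (Subgroup.mul_mem _ s0 (Subgroup.inv_mem _ s1)) hy ?_
      rw [e10, h1, hom_gauge]
    have u := Subgroup.mul_mem _ (Subgroup.mul_mem _ t h2) s2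
    have w := St_conj (a := fG G R 1 2 (fG G R 0 0 a)) u
      (hom_MC (fH G R 1 2) (hom_MC (fH G R 0 0) (gauge_MC a hx)))
      (by rw [hom_gauge, hom_gauge])
    convert w using 1
    simp only [map_mul, map_inv, c00, c10, c11]
    group

theorem final_smooth {B A : ArtinData K} (f : ArtinHom B A) (hf : Function.Surjective f.toAlg)
    (zB) (hB : zB ∈ G.Zsc B) (zA) (hA : zA ∈ G.Zsc A) (h : G.srel A (G.zmap f zB) zA) :
    ∃ wB ∈ G.Zsc B, G.srel B wB zB ∧ G.zmap f wB = zA := by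
  obtain ⟨x, m⟩ := zB
  obtain ⟨y, n⟩ := zA
  have hx : x ∈ ((G.g 0).tmA B).MCset := hB.1
  obtain ⟨m, rfl⟩ : ∃ m', m = v0 _ m' := ⟨mk0 hB.2.1, rfl⟩
  obtain ⟨n, rfl⟩ : ∃ m', n = v0 _ m' := ⟨mk0 hA.2.1, rfl⟩
  rw [zmap_v0, srel_iff G A (hom_MC _ hx)] at h
  obtain ⟨a, h1, h2⟩ := h
  obtain ⟨b, hb, h2⟩ := mem_St.1 h2
  obtain ⟨a', ha', ea⟩ := tmap_lift (G.isDGLA 0) f hf 0 (v0_mem a)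
  obtain ⟨b', hb', eb⟩ := tmap_lift (G.isDGLA 1) f hf (-1) hb
  obtain ⟨a', rfl⟩ : ∃ a'', a' = v0 _ a'' := ⟨mk0 ha', rfl⟩
  have ea' : hm (lHom f (G.g 0)) a' = a := v0_inj ea
  have h0 : (fH G B 0 0).lin x ∈ ((G.g 1).tmA B).MCset := hom_MC _ hx
  let s : L0 ((G.g 1).tmA B) := mk0 (dx_deg h0.1 hb')
  have hs : s ∈ St _ h0 := mem_St.2 ⟨b', hb', rfl⟩
  have es : hm (lHom f (G.g 1)) s = (hm (lHom f (G.g 1)) m)⁻¹ *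
      ((fG G A 0 1 a)⁻¹ * (n * fG G A 0 0 a)) := by
    apply v0_inj
    rw [h2, v0_hm, v0_mk0, dx_apply, map_add, (lHom f (G.g 1)).map_d, (lHom f (G.g 1)).map_br,
      fH_nat, ← eb]
    rfl
  refine ⟨_, Zsc_twist G B hx hB a' hs, ?_, ?_⟩
  · rw [srel_iff G B (gauge_MC a' hx)]
    refine ⟨a'⁻¹, ?_, ?_⟩
    · rw [← gauge_mul, inv_mul_cancel, gauge_one]
    · have := St_conj (a := fG G B 0 0 a') (Subgroup.inv_mem _ hs)
        (hom_MC (fH G B 0 0) (gauge_MC a' hx)) (by rw [hom_gauge])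
      convert this using 1
      simp only [map_inv]
      group
  · rw [zmap_v0, hom_gauge, ea', h1]
    simp only [map_mul, map_inv, fG_nat, ea', es]
    congr 2
    group

end fin

end BCHAux

/-- The projection `π : Z¹_sc(exp g^Δ) → H¹_sc(exp g^Δ)` is a
smooth morphism of functors of Artin rings: for every surjection `B → A` in
`Art_K`, the map
`Z¹_sc(exp g^Δ)(B) → H¹_sc(exp g^Δ)(B) ×_{H¹_sc(exp g^Δ)(A)} Z¹_sc(exp g^Δ)(A)`
is surjective.  (An element of the fibered product is a pair consisting of the
class of some `zB ∈ Z¹_sc(B)` and an element `zA ∈ Z¹_sc(A)` whose class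
agrees with the image of the class of `zB`.) -/
theorem Zsc_to_Hsc_smooth
    {K : Type} [Field K] [CharZero K] (G : ScDGLA K) {B A : ArtinData K}
    (f : ArtinHom B A) (hf : Function.Surjective f.toAlg) :
    (∀ z ∈ G.Zsc B, G.zmap f z ∈ G.Zsc A) ∧
    (∀ zB ∈ G.Zsc B, ∀ zA ∈ G.Zsc A, G.srel A (G.zmap f zB) zA →
      ∃ wB ∈ G.Zsc B, G.srel B wB zB ∧ G.zmap f wB = zA) := by
  exact ⟨BCHAux.zmap_mem G f, BCHAux.final_smooth G f hf⟩
end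
end

section
/- Let (L, d, [,]) be a DGLA over K such that: (1) L = M ⊕ C ⊕ D as graded vector spaces; (2) M is a differential graded subalgebra of L; (3) d : C → D[1] is an isomorphism of graded vector spaces (i.e., d maps C^i isomorphically onto D^{i+1} for every i). Then for every A ∈ Art_K the map α : MC_M(A) × (C⁰⊗m_A) → MC_L(A) defined by (x,c) ↦ e^c * x is a bijection. -/
open scoped TensorProduct Classical

noncomputable section

namespace FM
open Finset

section expo
variable {K : Type} [Field K] {V W : Type} [AddCommGroup V] [Module K V]
  [AddCommGroup W] [Module K W]

/-- truncated exponential -/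
def E (T : Module.End K V) (n : ℕ) : Module.End K V :=
  ∑ i ∈ range n, ((i.factorial : K))⁻¹ • T ^ i

variable [CharZero K]

lemma E_eq_exp [Module ℚ V] (T : Module.End K V) (n : ℕ) (h : T ^ n = 0) :
    E T n = IsNilpotent.exp T := by
  rw [IsNilpotent.exp_eq_sum h, E]
  refine sum_congr rfl fun i _ => ?_
  ext v
  simp only [LinearMap.smul_apply]
  have := inv_natCast_smul_eq (R := K) (S := ℚ) (i.factorial) ((T ^ i) v)
  exact this

lemma E_neg (T : Module.End K V) (n : ℕ) (h : T ^ n = 0) (v : V) :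
    E (-T) n (E T n v) = v := by
  let _ : Module ℚ V := Module.compHom V (algebraMap ℚ K)
  have h' : (-T) ^ n = 0 := by rw [neg_pow, h, mul_zero]
  rw [E_eq_exp T n h, E_eq_exp (-T) n h']
  have := IsNilpotent.exp_neg_mul_exp_self (a := T) ⟨n, h⟩
  exact LinearMap.congr_fun this v

lemma E_bilin (T : Module.End K V) (S : Module.End K W) (B : V →ₗ[K] V →ₗ[K] W) (n : ℕ)
    (hT : T ^ n = 0) (hS : S ^ n = 0)
    (hder : ∀ u v, S (B u v) = B (T u) v + B u (T v)) (u v : V) :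
    E S n (B u v) = B (E T n u) (E T n v) := by
  let _ : Module ℚ V := Module.compHom V (algebraMap ℚ K)
  let _ : Module ℚ W := Module.compHom W (algebraMap ℚ K)
  let _ : Module ℚ (V ⊗[K] V) := Module.compHom (V ⊗[K] V) (algebraMap ℚ K)
  rw [E_eq_exp T n hT, E_eq_exp S n hS]
  have h_nil : IsNilpotent T := ⟨n, hT⟩
  let DL : Module.End K (V ⊗[K] V) := T.lTensor V
  let DR : Module.End K (V ⊗[K] V) := T.rTensor V
  have h_nilL : IsNilpotent DL := h_nil.map <| Module.End.lTensorAlgHom K V V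
  have h_nilR : IsNilpotent DR := h_nil.map <| Module.End.rTensorAlgHom K V V
  have h_comm : Commute DL DR := by ext; simp [DL, DR]
  have h₁ : IsNilpotent.exp S (B u v) =
      TensorProduct.lift B (IsNilpotent.exp (DL + DR) (u ⊗ₜ[K] v)) := by
    suffices IsNilpotent.exp S ∘ₗ TensorProduct.lift B
        = TensorProduct.lift B ∘ₗ IsNilpotent.exp (DL + DR) by
      simpa using LinearMap.congr_fun this (u ⊗ₜ[K] v)
    apply Module.End.commute_exp_left_of_commute (h_comm.isNilpotent_add h_nilL h_nilR) ⟨n, hS⟩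
    ext
    simp [DL, DR, hder, add_comm]
  have h₂ : IsNilpotent.exp DL = (IsNilpotent.exp T).lTensor V :=
    (h_nil.map_exp (Module.End.lTensorAlgHom K V V)).symm
  have h₃ : IsNilpotent.exp DR = (IsNilpotent.exp T).rTensor V :=
    (h_nil.map_exp (Module.End.rTensorAlgHom K V V)).symm
  simp [h₁, IsNilpotent.exp_add_of_commute h_comm h_nilL h_nilR, h₂, h₃]

end expo

/-- The part of the dgla axioms needed, with a nilpotent filtration. -/
structure Good {K : Type} [Field K] (N : PreDGLA K) (F : ℕ → Submodule K N.carrier) (m : ℕ) :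
    Prop where
  d_sq : ∀ x, N.d (N.d x) = 0
  d_deg : ∀ i, ∀ x ∈ N.comp i, N.d x ∈ N.comp (i + 1)
  br_deg : ∀ i j, ∀ x ∈ N.comp i, ∀ y ∈ N.comp j, N.br x y ∈ N.comp (i + j)
  antisymm : ∀ x ∈ N.comp 1, ∀ y ∈ N.comp 1, N.br x y = N.br y x
  jacobi : ∀ x ∈ N.comp 0, ∀ y ∈ N.comp 1, ∀ z,
      N.br x (N.br y z) = N.br (N.br x y) z + N.br y (N.br x z)
  leibniz : ∀ x ∈ N.comp 0, ∀ y, N.d (N.br x y) = N.br (N.d x) y + N.br x (N.d y)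
  F0 : ∀ x, x ∈ F 0
  Fm : ∀ x ∈ F m, x = 0
  Fanti : ∀ k, F (k + 1) ≤ F k
  Fd : ∀ k, ∀ x ∈ F k, N.d x ∈ F k
  Fl : ∀ k, ∀ x ∈ F k, ∀ y, N.br x y ∈ F (k + 1)
  Fr : ∀ k, ∀ x, ∀ y ∈ F k, N.br x y ∈ F (k + 1)

section good
variable {K : Type} [Field K] {N : PreDGLA K} {F : ℕ → Submodule K N.carrier} {m : ℕ}

lemma Good.ad_mem (h : Good N F m) (a x : N.carrier) (n : ℕ) : (N.br a ^ n) x ∈ F n := by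
  induction n with
  | zero => exact h.F0 _
  | succ n ih => rw [pow_succ']; exact h.Fr _ _ _ ih

lemma Good.ad_nil (h : Good N F m) (a : N.carrier) : N.br a ^ m = 0 := by
  ext x; exact h.Fm _ (h.ad_mem a x m)

lemma Good.gauge_eq (h : Good N F m) (a x : N.carrier) :
    N.gauge a x = x + ∑ n ∈ range m, ((((n + 1).factorial : K))⁻¹ •
    ((N.br a ^ n) (N.br a x - N.d a))) := by
  rw [PreDGLA.gauge, finsum_eq_sum_of_support_subset]
  intro n hn
  by_contra hc
  apply hn
  simp only [coe_range, Set.mem_Iio, not_lt] at hc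
  have : N.br a ^ n = 0 := pow_eq_zero_of_le hc (h.ad_nil a)
  simp [this]

/-- adjoint of `a` on degree one elements extended by the differential -/
def T (h : Good N F m) (a : N.carrier) (ha : a ∈ N.comp 0) :
    Module.End K (N.comp 1 × K) where
  toFun u := (⟨N.br a u.1 - u.2 • N.d a, by
    have h1 := h.br_deg 0 1 a ha u.1 u.1.2
    have h2 := h.d_deg 0 a ha
    rw [zero_add] at h1 h2
    exact Submodule.sub_mem _ h1 (Submodule.smul_mem _ _ h2)⟩, 0)
  map_add' u v := by
    ext
    · simp [add_smul]; abel
    · simp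
  map_smul' k u := by
    ext
    · simp [smul_sub, mul_smul]
    · simp

/-- the extended bracket -/
def B (N : PreDGLA K) : (N.comp 1 × K) →ₗ[K] (N.comp 1 × K) →ₗ[K] N.carrier :=
  LinearMap.mk₂ K (fun u v => u.2 • N.d v.1 + v.2 • N.d u.1 + N.br u.1 v.1)
    (by intros; simp [add_smul]; abel)
    (by intros; simp [smul_add, mul_smul]; rw [smul_comm])
    (by intros; simp [add_smul]; abel)
    (by intros; simp [smul_add, mul_smul]; rw [smul_comm])

lemma T_pow (h : Good N F m) (a : N.carrier) (ha : a ∈ N.comp 0) (n : ℕ) (u : N.comp 1 × K) :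
    (((T h a ha ^ (n + 1)) u).1 : N.carrier) = (N.br a ^ n) (N.br a u.1 - u.2 • N.d a)
    ∧ ((T h a ha ^ (n + 1)) u).2 = 0 := by
  induction n with
  | zero => simp [T]
  | succ n ih =>
    rw [pow_succ', pow_succ' (N.br a)]
    simp only [Module.End.mul_apply]
    refine ⟨?_, rfl⟩
    change N.br a (((T h a ha ^ (n + 1)) u).1 : N.carrier)
      - ((T h a ha ^ (n + 1)) u).2 • N.d a = _
    rw [ih.1, ih.2]; simp

lemma T_nil (h : Good N F m) (a : N.carrier) (ha : a ∈ N.comp 0) : T h a ha ^ (m + 1) = 0 := by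
  refine LinearMap.ext fun u => ?_
  obtain ⟨h1, h2⟩ := T_pow h a ha m u
  rw [h.ad_nil] at h1
  exact Prod.ext (Subtype.ext h1) h2

lemma E_T (h : Good N F m) (a : N.carrier) (ha : a ∈ N.comp 0) (x : N.comp 1) :
    ((E (T h a ha) (m + 1) (x, 1)).1 : N.carrier) = N.gauge a x ∧
    (E (T h a ha) (m + 1) (x, 1)).2 = 1 := by
  rw [h.gauge_eq, E, sum_range_succ']
  constructor
  · simp [T_pow, Prod.fst_sum, add_comm]
  · simp [T_pow, Prod.snd_sum]

lemma der (h : Good N F m) (a : N.carrier) (ha : a ∈ N.comp 0) (u v : N.comp 1 × K) :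
    N.br a (B N u v) = B N (T h a ha u) v + B N u (T h a ha v) := by
  obtain ⟨⟨y, hy⟩, s⟩ := u
  obtain ⟨⟨z, hz⟩, t⟩ := v
  have h2 := h.d_deg 0 a ha
  rw [zero_add] at h2
  simp [B, T, h.leibniz a ha, h.d_sq, h.jacobi a ha y hy, h.antisymm y hy _ h2]
  abel

variable [CharZero K]

lemma gauge_mem (h : Good N F m) (a : N.carrier) (ha : a ∈ N.comp 0) (x : N.carrier)
    (hx : x ∈ N.comp 1) : N.gauge a x ∈ N.comp 1 := by
  rw [← (E_T h a ha ⟨x, hx⟩).1]; exact Subtype.prop _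

lemma gauge_MC (h : Good N F m) (a : N.carrier) (ha : a ∈ N.comp 0) (x : N.carrier)
    (hx : x ∈ N.MCset) : N.gauge a x ∈ N.MCset := by
  obtain ⟨hx1, hx2⟩ := hx
  refine ⟨gauge_mem h a ha x hx1, ?_⟩
  have key := E_bilin (T h a ha) (N.br a) (B N) (m + 1) (T_nil h a ha)
    (by rw [pow_succ, h.ad_nil, zero_mul]) (der h a ha) (⟨x, hx1⟩, 1) (⟨x, hx1⟩, 1)
  obtain ⟨h1, h2⟩ := E_T h a ha ⟨x, hx1⟩
  have two (w : N.carrier) (b : N.carrier) : w + (2 : K)⁻¹ • b = (2 : K)⁻¹ • (w + w + b) := by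
    rw [← two_smul K w, smul_add, smul_smul]; simp
  rw [two] at hx2 ⊢
  have h0 : B N (⟨x, hx1⟩, 1) (⟨x, hx1⟩, 1) = 0 := by
    have := (smul_eq_zero_iff_right (show (2 : K)⁻¹ ≠ 0 by simp)).1 hx2
    simpa [B] using this
  rw [h0, map_zero] at key
  simp only [B, LinearMap.mk₂_apply, h1, h2, one_smul] at key
  rw [← key, smul_zero]

lemma gauge_neg (h : Good N F m) (a : N.carrier) (ha : a ∈ N.comp 0) (x : N.carrier)
    (hx : x ∈ N.comp 1) : N.gauge (-a) (N.gauge a x) = x := by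
  have hT : T h (-a) (neg_mem ha) = - T h a ha := by
    refine LinearMap.ext fun u => Prod.ext (Subtype.ext ?_) ?_
    · simp [T]; abel
    · simp [T]
  have e := E_neg (T h a ha) (m + 1) (T_nil h a ha) (⟨x, hx⟩, 1)
  obtain ⟨h1, h2⟩ := E_T h a ha ⟨x, hx⟩
  have h3 : E (T h a ha) (m + 1) (⟨x, hx⟩, 1) = (⟨N.gauge a x, gauge_mem h a ha x hx⟩, 1) :=
    Prod.ext (Subtype.ext h1) h2
  rw [h3, ← hT] at e
  rw [← (E_T h (-a) (neg_mem ha) ⟨N.gauge a x, gauge_mem h a ha x hx⟩).1, e]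

lemma gauge_diff (h : Good N F m) (a b y : N.carrier) (k : ℕ) (hab : a - b ∈ F k) :
    N.gauge a y - N.gauge b y + N.d (a - b) ∈ F (k + 1) := by
  have h0 : (N.br a y - N.d a) - (N.br b y - N.d b) + N.d (a - b) ∈ F (k + 1) := by
    have := h.Fl k _ hab y
    convert this using 1
    simp
    abel
  have h0' : (N.br a y - N.d a) - (N.br b y - N.d b) ∈ F k := by
    have := sub_mem (h.Fanti _ h0) (h.Fd _ _ hab)
    simpa using this
  have hst : ∀ z w, z - w ∈ F k → N.br a z - N.br b w ∈ F (k + 1) := by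
    intro z w hzw
    have := add_mem (h.Fl k _ hab z) (h.Fr k b _ hzw)
    convert this using 1
    simp
  have hn : ∀ n, (N.br a ^ (n + 1)) (N.br a y - N.d a)
      - (N.br b ^ (n + 1)) (N.br b y - N.d b) ∈ F (k + 1) := by
    intro n
    induction n with
    | zero => simpa only [zero_add, pow_one] using hst _ _ h0'
    | succ n ih =>
      rw [pow_succ', pow_succ' (N.br b)]
      exact hst _ _ (h.Fanti _ ih)
  have gs : ∀ c : N.carrier, N.gauge c y = y + (N.br c y - N.d c) + ∑ n ∈ range m,
      ((((n + 2).factorial : K))⁻¹ • ((N.br c ^ (n + 1)) (N.br c y - N.d c))) := by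
    intro c
    rw [h.gauge_eq]
    have hz : N.br c ^ m = 0 := h.ad_nil c
    have := sum_range_succ (fun n => ((((n + 1).factorial : K))⁻¹ •
      ((N.br c ^ n) (N.br c y - N.d c)))) m
    rw [hz] at this
    simp only [LinearMap.zero_apply, smul_zero, add_zero] at this
    rw [← this, sum_range_succ']
    simp
    abel
  rw [gs a, gs b]
  have hs : ∑ n ∈ range m, (((n + 2).factorial : K))⁻¹ •
      ((N.br a ^ (n + 1)) (N.br a y - N.d a) - (N.br b ^ (n + 1)) (N.br b y - N.d b))
      ∈ F (k + 1) := sum_mem fun n _ => Submodule.smul_mem _ _ (hn n)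
  have := add_mem h0 hs
  convert this using 1
  simp only [smul_sub, sum_sub_distrib]
  abel

/-- The splitting data. -/
structure Split (N : PreDGLA K) (F : ℕ → Submodule K N.carrier)
    (pM pC pD r : N.carrier →ₗ[K] N.carrier) : Prop where
  tot : ∀ x, pM x + pC x + pD x = x
  MM : ∀ x, pM (pM x) = pM x
  CC : ∀ x, pC (pC x) = pC x
  DM : ∀ x, pM x = x → pD x = 0
  rC : ∀ c, pC c = c → r (N.d c) = c
  Dd : ∀ c, pC c = c → pD (N.d c) = N.d c
  H1 : ∀ y ∈ N.comp 1, pC (r (pD y)) = r (pD y) ∧ r (pD y) ∈ N.comp 0 ∧ N.d (r (pD y)) = pD y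
  Md : ∀ x, pM x = x → pM (N.d x) = N.d x
  Mb : ∀ x y, pM x = x → pM y = y → pM (N.br x y) = N.br x y
  FH : ∀ k, ∀ x ∈ F k, r (pD x) ∈ F k
  FC : ∀ k, ∀ x ∈ F k, pC x ∈ F k

variable {pM pC pD r : N.carrier →ₗ[K] N.carrier}

lemma MC_in_M (h : Good N F m) (s : Split N F pM pC pD r) (x : N.carrier) (hx : x ∈ N.MCset)
    (hH : r (pD x) = 0) : pM x = x := by
  have hD : pD x = 0 := by rw [← (s.H1 x hx.1).2.2, hH, map_zero]
  have hxe : x = pM x + pC x := by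
    have := s.tot x
    rw [hD, add_zero] at this; exact this.symm
  have hv : pC x = - ((2 : K)⁻¹ • r (pD (N.br x x))) := by
    have e1 : r (pD (N.d x)) = pC x := by
      conv_lhs => rw [hxe]
      rw [map_add, map_add, s.DM _ (s.Md _ (s.MM x)), zero_add, s.Dd _ (s.CC x), s.rC _ (s.CC x)]
    rw [← e1, eq_neg_of_add_eq_zero_left hx.2]; simp
  have hk : ∀ k, pC x ∈ F k := by
    intro k
    induction k with
    | zero => exact h.F0 _
    | succ k ih =>
      rw [hv]
      refine neg_mem (Submodule.smul_mem _ _ ?_)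
      have e2 : N.br x x = N.br (pM x) (pM x) + (N.br (pC x) (pM x) + N.br x (pC x)) := by
        have ex : ∀ w, N.br x w = N.br (pM x) w + N.br (pC x) w := by
          intro w
          rw [← LinearMap.add_apply, ← map_add, ← hxe]
        have ey : N.br x x = N.br x (pM x) + N.br x (pC x) := by
          rw [← map_add, ← hxe]
        rw [ey, ex (pM x), add_assoc]
      rw [e2, map_add, s.DM _ (s.Mb _ _ (s.MM x) (s.MM x)), zero_add]
      exact s.FH _ _ (add_mem (h.Fl _ _ ih _) (h.Fr _ _ _ ih))
  rw [h.Fm _ (hk m), add_zero] at hxe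
  exact hxe.symm

theorem main (h : Good N F m) (s : Split N F pM pC pD r) (y : N.carrier) (hy : y ∈ N.MCset) :
    ∃! p : N.carrier × N.carrier, pM p.1 = p.1 ∧ p.1 ∈ N.MCset ∧ pC p.2 = p.2 ∧
      p.2 ∈ N.comp 0 ∧ N.gauge p.2 p.1 = y := by
  let G : N.carrier → N.carrier := fun c => c - r (pD (N.gauge (-c) y))
  have hG : ∀ c, G c = c - r (pD (N.gauge (-c) y)) := fun _ => rfl
  have contr : ∀ c c' k, pC c = c → pC c' = c' → c - c' ∈ F k → G c - G c' ∈ F (k + 1) := by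
    intro c c' k hc hc' hk
    have e : -c - -c' ∈ F k := by
      have := neg_mem hk
      convert this using 1; abel
    have g := neg_mem (s.FH _ _ (gauge_diff h (-c) (-c') y k e))
    convert g using 1
    have e3 : pC (c - c') = c - c' := by rw [map_sub, hc, hc']
    have e2 : N.d (-c - -c') = - N.d (c - c') := by rw [← map_neg]; congr 1; abel
    rw [e2, hG, hG]
    simp only [map_add, map_sub pD, map_neg, map_sub r]
    rw [s.Dd _ e3, s.rC _ e3]
    abel
  have pres : ∀ c, pC c = c → c ∈ N.comp 0 → pC (G c) = G c ∧ G c ∈ N.comp 0 := by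
    intro c hc hc0
    obtain ⟨h1, h2, -⟩ := s.H1 _ (gauge_mem h (-c) (neg_mem hc0) y hy.1)
    exact ⟨by rw [hG, map_sub, hc, h1], sub_mem hc0 h2⟩
  have seq : ∀ k, pC (G^[k] 0) = G^[k] 0 ∧ G^[k] 0 ∈ N.comp 0 ∧
      G^[k + 1] 0 - G^[k] 0 ∈ F k := by
    intro k
    induction k with
    | zero => exact ⟨by simp, by simp, h.F0 _⟩
    | succ k ih =>
      obtain ⟨i1, i2, i3⟩ := ih
      obtain ⟨j1, j2⟩ := pres _ i1 i2
      rw [← Function.iterate_succ_apply' G] at j1 j2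
      refine ⟨j1, j2, ?_⟩
      have := contr _ _ _ j1 i1 i3
      rwa [← Function.iterate_succ_apply' G, ← Function.iterate_succ_apply' G] at this
  obtain ⟨c1, c2, c3⟩ := seq m
  have fix := sub_eq_zero.1 (h.Fm _ c3)
  rw [Function.iterate_succ_apply'] at fix
  generalize G^[m] 0 = c at c1 c2 fix
  have hz : ∀ c, G c = c ↔ r (pD (N.gauge (-c) y)) = 0 := by
    intro c; rw [hG, sub_eq_self]
  have hxMC := gauge_MC h (-c) (neg_mem c2) y hy
  refine ⟨(N.gauge (-c) y, c), ⟨MC_in_M h s _ hxMC ((hz c).1 fix), hxMC, c1, c2, ?_⟩, ?_⟩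
  · have := gauge_neg h (-c) (neg_mem c2) y hy.1
    rwa [neg_neg] at this
  · rintro ⟨x', c'⟩ ⟨g1, g2, g3, g4, g5⟩
    simp only at g1 g2 g3 g4 g5
    have e1 : N.gauge (-c') y = x' := by rw [← g5]; exact gauge_neg h c' g4 x' g2.1
    have fix' : G c' = c' := by rw [hz, e1, s.DM _ g1, map_zero]
    have hk : ∀ k, c' - c ∈ F k := by
      intro k
      induction k with
      | zero => exact h.F0 _
      | succ k ih =>
        have := contr _ _ _ g3 c1 ih
        rwa [fix, fix'] at this
    have : c' = c := sub_eq_zero.1 (h.Fm _ (hk m))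
    subst this
    rw [e1]

end good

section conc
variable {K : Type} [Field K] (L : PreDGLA K) (R : ArtinData K)

/-- pure tensors -/
def tt (x : L.carrier) (a : R.mId) : (L.tmA R).carrier := x ⊗ₜ[K] a

lemma tt_add (x y : L.carrier) (a : R.mId) : tt L R (x + y) a = tt L R x a + tt L R y a :=
  TensorProduct.add_tmul x y a

lemma tt_zero (a : R.mId) : tt L R 0 a = 0 := TensorProduct.zero_tmul _ a

lemma tt_zero' (x : L.carrier) : tt L R x 0 = 0 := TensorProduct.tmul_zero _ x

variable {L R} in
/-- induction for tensors -/
lemma t_ind (P : (L.tmA R).carrier → Prop) (h0 : P 0)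
    (hadd : ∀ x y, P x → P y → P (x + y))
    (ht : ∀ x, ∀ a : R.mId, P (tt L R x a))
    (x : (L.tmA R).carrier) : P x :=
  TensorProduct.induction_on x h0 ht hadd

lemma br_tmul (x y : L.carrier) (a b : R.mId) :
    (L.tmA R).br (tt L R x a) (tt L R y b) = tt L R (L.br x y) (R.mmul a b) := rfl

lemma d_tmul (x : L.carrier) (a : R.mId) :
    (L.tmA R).d (tt L R x a) = tt L R (L.d x) a := rfl

lemma proj_tmul (i : ℤ) (x : L.carrier) (a : R.mId) :
    (L.tmA R).proj i (tt L R x a) = tt L R (L.proj i x) a := rfl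

lemma mem_comp (N : PreDGLA K) (i : ℤ) (x : N.carrier) : x ∈ N.comp i ↔ N.proj i x = x := by
  rw [PreDGLA.comp, LinearMap.mem_ker, LinearMap.sub_apply, sub_eq_zero]; rfl

variable {L R} in
/-- induction for homogeneous elements -/
lemma comp_ind (hL : L.IsDGLA) (i : ℤ) (P : (L.tmA R).carrier → Prop) (h0 : P 0)
    (hadd : ∀ x y, P x → P y → P (x + y))
    (ht : ∀ x ∈ L.comp i, ∀ a : R.mId, P (tt L R x a))
    (x : (L.tmA R).carrier) (hx : x ∈ (L.tmA R).comp i) : P x := by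
  rw [mem_comp] at hx
  rw [← hx]
  clear hx
  revert x
  apply t_ind
  · rw [map_zero]; exact h0
  · intro x y hx hy; rw [map_add]; exact hadd _ _ hx hy
  · intro x a; exact ht _ ((mem_comp _ _ _).2 (hL.proj_idem i x)) a

/-- The filtration -/
def Fil (k : ℕ) : Submodule K (L.tmA R).carrier :=
  Submodule.span K {z | ∃ (x : L.carrier) (a : R.mId),
    a.1 ∈ (IsLocalRing.maximalIdeal R.A) ^ (k + 1) ∧ z = tt L R x a}

/-- tensored map -/
def tm (f : L.carrier →ₗ[K] L.carrier) : (L.tmA R).carrier →ₗ[K] (L.tmA R).carrier :=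
  LinearMap.rTensor R.mId f

lemma tm_tmul (f : L.carrier →ₗ[K] L.carrier) (x : L.carrier) (a : R.mId) :
    tm L R f (tt L R x a) = tt L R (f x) a := rfl

lemma tm_Fil (f : L.carrier →ₗ[K] L.carrier) (k : ℕ) (x) (hx : x ∈ Fil L R k) :
    tm L R f x ∈ Fil L R k := by
  induction hx using Submodule.span_induction with
  | mem x h =>
    obtain ⟨x, a, ha, rfl⟩ := h
    exact Submodule.subset_span ⟨f x, a, ha, rfl⟩
  | zero => rw [map_zero]; exact zero_mem _
  | add x y _ _ hx hy => rw [map_add]; exact add_mem hx hy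
  | smul a x _ hx => rw [map_smul]; exact Submodule.smul_mem _ _ hx

lemma exists_good (hL : L.IsDGLA) : ∃ m, Good (L.tmA R) (Fil L R) m := by
  have := R.isArtinian
  have hnil : IsNilpotent (IsLocalRing.maximalIdeal R.A) := by
    rw [← IsLocalRing.jacobson_eq_maximalIdeal ⊥ bot_ne_top]
    exact IsArtinianRing.isNilpotent_jacobson_bot
  obtain ⟨m, hm⟩ := hnil
  refine ⟨m, ?_⟩
  constructor
  case d_sq =>
    apply t_ind
    · simp
    · intro x y hx hy; simp [hx, hy]
    · intro x a; rw [d_tmul, d_tmul, hL.d_sq, tt_zero]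
  case d_deg =>
    intro i
    apply comp_ind hL
    · simp
    · intro x y hx hy; rw [map_add]; exact add_mem hx hy
    · intro x hx a
      rw [d_tmul, mem_comp, proj_tmul, (mem_comp _ _ _).1 (hL.d_deg i x hx)]
  case br_deg =>
    intro i j
    apply comp_ind hL
    · intro y _; simp
    · intro x y hx hy z hz; rw [map_add, LinearMap.add_apply]; exact add_mem (hx z hz) (hy z hz)
    · intro x hx a
      apply comp_ind hL
      · simp
      · intro x y hx hy; rw [map_add]; exact add_mem hx hy
      · intro y hy b
        rw [br_tmul, mem_comp, proj_tmul, (mem_comp _ _ _).1 (hL.br_deg i j x hx y hy)]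
  case antisymm =>
    apply comp_ind hL
    · intro y _; simp
    · intro x y hx hy z hz; rw [map_add, LinearMap.add_apply, hx z hz, hy z hz, map_add]
    · intro x hx a
      apply comp_ind hL
      · simp
      · intro x y hx hy; rw [map_add, hx, hy, map_add, LinearMap.add_apply]
      · intro y hy b
        have e : R.mmul a b = R.mmul b a := Subtype.ext (mul_comm a.1 b.1)
        rw [br_tmul, br_tmul, hL.antisymm 1 1 x hx y hy, e]
        simp [PreDGLA.sgn]
  case jacobi =>
    apply comp_ind hL
    · intro y _ z; simp
    · intro x y hx hy z hz w
      simp only [map_add, LinearMap.add_apply, hx z hz, hy z hz]; abel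
    · intro x hx a
      apply comp_ind hL
      · simp
      · intro x y hx hy z; simp only [map_add, LinearMap.add_apply, hx z, hy z]; abel
      · intro y hy b
        apply t_ind
        · simp
        · intro x y hx hy; simp only [map_add, hx, hy]; abel
        · intro z c
          have e : R.mmul (R.mmul a b) c = R.mmul a (R.mmul b c) :=
            Subtype.ext (mul_assoc a.1 b.1 c.1)
          have e' : R.mmul b (R.mmul a c) = R.mmul a (R.mmul b c) :=
            Subtype.ext (mul_left_comm b.1 a.1 c.1)
          simp only [br_tmul]
          rw [hL.jacobi 0 1 x hx y hy z, e, e']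
          simp [PreDGLA.sgn, tt_add]
  case leibniz =>
    apply comp_ind hL
    · intro y; simp
    · intro x y hx hy z
      simp only [map_add, LinearMap.add_apply, hx z, hy z]; abel
    · intro x hx a
      apply t_ind
      · simp
      · intro x y hx hy; simp only [map_add, hx, hy]; abel
      · intro y b
        simp only [br_tmul, d_tmul]
        rw [hL.leibniz 0 x hx y]
        simp [PreDGLA.sgn, tt_add]
  case F0 =>
    apply t_ind
    · exact zero_mem _
    · intro x y hx hy; exact add_mem hx hy
    · intro x a
      exact Submodule.subset_span ⟨x, a, by rw [zero_add, pow_one]; exact a.2, rfl⟩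
  case Fm =>
    intro x hx
    rw [Fil, pow_succ, hm, zero_mul] at hx
    induction hx using Submodule.span_induction with
    | mem x h =>
      obtain ⟨x, a, ha, rfl⟩ := h
      have : a = 0 := Subtype.ext (by simpa using ha)
      rw [this, tt_zero']
    | zero => rfl
    | add x y _ _ hx hy => rw [hx, hy, add_zero]
    | smul a x _ hx => rw [hx, smul_zero]
  case Fanti =>
    intro k
    apply Submodule.span_mono
    rintro z ⟨x, a, ha, rfl⟩
    exact ⟨x, a, Ideal.pow_le_pow_right (Nat.le_succ _) ha, rfl⟩
  case Fd => exact fun k x hx => tm_Fil L R L.d k x hx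
  case Fl =>
    intro k x hx
    induction hx using Submodule.span_induction with
    | mem x h =>
      obtain ⟨x, a, ha, rfl⟩ := h
      apply t_ind
      · rw [map_zero]; exact zero_mem _
      · intro x y hx hy; rw [map_add]; exact add_mem hx hy
      · intro y b
        exact Submodule.subset_span ⟨_, R.mmul a b, Ideal.mul_mem_mul ha b.2, rfl⟩
    | zero => intro y; rw [map_zero]; exact zero_mem _
    | add x y _ _ hx hy => intro z; rw [map_add]; exact add_mem (hx z) (hy z)
    | smul a x _ hx => intro z; rw [map_smul]; exact Submodule.smul_mem _ _ (hx z)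
  case Fr =>
    intro k x y hy
    induction hy using Submodule.span_induction with
    | mem y h =>
      obtain ⟨y, a, ha, rfl⟩ := h
      revert x
      apply t_ind
      · rw [map_zero]; exact zero_mem _
      · intro x y hx hy; rw [map_add]; exact add_mem hx hy
      · intro x b
        refine Submodule.subset_span ⟨_, R.mmul b a, ?_, rfl⟩
        have := Ideal.mul_mem_mul ha b.2
        rw [mul_comm a.1 b.1] at this
        exact this
    | zero => rw [map_zero]; exact zero_mem _
    | add x y _ _ hx hy => rw [map_add]; exact add_mem hx hy
    | smul a x _ hx => rw [map_smul]; exact Submodule.smul_mem _ _ hx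

variable {L R} in
/-- induction for elements fixed by an idempotent -/
lemma fix_ind (p : L.carrier →ₗ[K] L.carrier) (hp : ∀ x, p (p x) = p x)
    (P : (L.tmA R).carrier → Prop) (h0 : P 0)
    (hadd : ∀ x y, P x → P y → P (x + y))
    (ht : ∀ x, p x = x → ∀ a : R.mId, P (tt L R x a))
    (x : (L.tmA R).carrier) (hx : tm L R p x = x) : P x := by
  rw [← hx]
  clear hx
  revert x
  apply t_ind
  · rw [map_zero]; exact h0
  · intro x y hx hy; rw [map_add]; exact hadd _ _ hx hy
  · intro x a; exact ht _ (hp x) a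

lemma mem_range_iff (p : L.carrier →ₗ[K] L.carrier) (M : Submodule K L.carrier)
    (h1 : ∀ x, p x ∈ M) (h2 : ∀ x ∈ M, p x = x) (x : (L.tmA R).carrier) :
    x ∈ LinearMap.range (LinearMap.rTensor R.mId M.subtype) ↔ tm L R p x = x := by
  constructor
  · rintro ⟨z, rfl⟩
    change LinearMap.rTensor R.mId p _ = _
    rw [← LinearMap.comp_apply, ← LinearMap.rTensor_comp]
    congr 2
    ext w
    exact h2 _ w.2
  · refine fix_ind p (fun x => h2 _ (h1 x)) _ (zero_mem _) (fun _ _ => add_mem) ?_ x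
    intro x hx a
    exact ⟨(⟨x, hx ▸ h1 x⟩ : M) ⊗ₜ[K] a, rfl⟩

lemma exists_split [CharZero K] (hL : L.IsDGLA) (M C D : Submodule K L.carrier)
    (hspan : ∀ x : L.carrier, ∃ u ∈ M, ∃ v ∈ C, ∃ w ∈ D, x = u + v + w)
    (hindep : ∀ u ∈ M, ∀ v ∈ C, ∀ w ∈ D, u + v + w = 0 → u = 0 ∧ v = 0 ∧ w = 0)
    (hMgr : ∀ i, ∀ x ∈ M, L.proj i x ∈ M)
    (hCgr : ∀ i, ∀ x ∈ C, L.proj i x ∈ C)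
    (hDgr : ∀ i, ∀ x ∈ D, L.proj i x ∈ D)
    (hMd : ∀ x ∈ M, L.d x ∈ M)
    (hMbr : ∀ x ∈ M, ∀ y ∈ M, L.br x y ∈ M)
    (hCD : ∀ x ∈ C, L.d x ∈ D)
    (hdinj : ∀ x ∈ C, L.d x = 0 → x = 0)
    (hdsurj : ∀ i, ∀ y ∈ D, y ∈ L.comp (i + 1) → ∃ c ∈ C, c ∈ L.comp i ∧ L.d c = y) :
    ∃ pM pC pD r : L.carrier →ₗ[K] L.carrier,
      (∀ x, pM x ∈ M) ∧ (∀ x ∈ M, pM x = x) ∧ (∀ x, pC x ∈ C) ∧ (∀ x ∈ C, pC x = x) ∧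
      Split (L.tmA R) (Fil L R) (tm L R pM) (tm L R pC) (tm L R pD) (tm L R r) := by
  choose u hu v hv w hw hx using hspan
  have uniq : ∀ x a b c, a ∈ M → b ∈ C → c ∈ D → x = a + b + c → u x = a ∧ v x = b ∧ w x = c := by
    intro x a b c ha hb hc he
    have := hindep _ (sub_mem (hu x) ha) _ (sub_mem (hv x) hb) _ (sub_mem (hw x) hc) (by
      have h1 := hx x
      have h2 : u x - a + (v x - b) + (w x - c) = (u x + v x + w x) - (a + b + c) := by abel
      rw [h2, ← h1, ← he, sub_self])
    simpa [sub_eq_zero] using this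
  have uadd : ∀ x y, u (x + y) = u x + u y ∧ v (x + y) = v x + v y ∧ w (x + y) = w x + w y := by
    intro x y
    apply uniq _ _ _ _ (add_mem (hu x) (hu y)) (add_mem (hv x) (hv y)) (add_mem (hw x) (hw y))
    conv_lhs => rw [hx x, hx y]
    abel
  have usmul : ∀ (k : K) x, u (k • x) = k • u x ∧ v (k • x) = k • v x ∧ w (k • x) = k • w x := by
    intro k x
    apply uniq _ _ _ _ (M.smul_mem k (hu x)) (C.smul_mem k (hv x)) (D.smul_mem k (hw x))
    conv_lhs => rw [hx x]
    simp
  let pM : L.carrier →ₗ[K] L.carrier := ⟨⟨u, fun x y => (uadd x y).1⟩, fun k x => (usmul k x).1⟩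
  let pC : L.carrier →ₗ[K] L.carrier :=
    ⟨⟨v, fun x y => (uadd x y).2.1⟩, fun k x => (usmul k x).2.1⟩
  let pD : L.carrier →ₗ[K] L.carrier :=
    ⟨⟨w, fun x y => (uadd x y).2.2⟩, fun k x => (usmul k x).2.2⟩
  obtain ⟨r0, hr0⟩ := LinearMap.exists_leftInverse_of_injective (L.d ∘ₗ C.subtype)
    (LinearMap.ker_eq_bot'.2 fun c hc => Subtype.ext (hdinj c c.2 hc))
  let r : L.carrier →ₗ[K] L.carrier := C.subtype ∘ₗ r0
  have hr : ∀ c ∈ C, r (L.d c) = c := fun c hc =>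
    congrArg Subtype.val (LinearMap.congr_fun hr0 ⟨c, hc⟩)
  have hpM : ∀ x ∈ M, u x = x ∧ v x = 0 ∧ w x = 0 := fun x h =>
    uniq x x 0 0 h (zero_mem _) (zero_mem _) (by simp)
  have hpC : ∀ x ∈ C, u x = 0 ∧ v x = x ∧ w x = 0 := fun x h =>
    uniq x 0 x 0 (zero_mem _) h (zero_mem _) (by simp)
  have hpD : ∀ x ∈ D, u x = 0 ∧ v x = 0 ∧ w x = x := fun x h =>
    uniq x 0 0 x (zero_mem _) (zero_mem _) h (by simp)
  have hMM : ∀ x, pM (pM x) = pM x := fun x => (hpM _ (hu x)).1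
  have hCC : ∀ x, pC (pC x) = pC x := fun x => (hpC _ (hv x)).2.1
  have memM : ∀ x, pM x = x → x ∈ M := fun x h => by rw [← h]; exact hu x
  have memC : ∀ x, pC x = x → x ∈ C := fun x h => by rw [← h]; exact hv x
  refine ⟨pM, pC, pD, r, hu, fun x h => (hpM x h).1, hv, fun x h => (hpC x h).2.1, ?_⟩
  constructor
  case tot =>
    apply t_ind
    · simp
    · intro x y hx hy
      conv_rhs => rw [← hx, ← hy]
      simp only [map_add]
      abel
    · intro x a
      rw [tm_tmul, tm_tmul, tm_tmul]
      conv_rhs => rw [hx x, tt_add, tt_add]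
      rfl
  case MM =>
    apply t_ind
    · simp
    · intro x y hx hy; simp only [map_add, hx, hy]
    · intro x a; rw [tm_tmul, tm_tmul, hMM]
  case CC =>
    apply t_ind
    · simp
    · intro x y hx hy; simp only [map_add, hx, hy]
    · intro x a; rw [tm_tmul, tm_tmul, hCC]
  case DM =>
    apply fix_ind pM hMM
    · simp
    · intro x y hx hy; simp only [map_add, hx, hy, add_zero]
    · intro x hx a
      have : pD x = 0 := (hpM x (memM x hx)).2.2
      rw [tm_tmul, this, tt_zero]
  case rC =>
    apply fix_ind pC hCC
    · simp
    · intro x y hx hy; simp only [map_add, hx, hy]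
    · intro x hx a
      rw [d_tmul, tm_tmul, hr x (memC x hx)]
  case Dd =>
    apply fix_ind pC hCC
    · simp
    · intro x y hx hy; simp only [map_add, hx, hy]
    · intro x hx a
      have : pD (L.d x) = L.d x := (hpD _ (hCD x (memC x hx))).2.2
      rw [d_tmul, tm_tmul, this]
  case H1 =>
    apply comp_ind hL
    · simp
    · rintro x y ⟨h1, h2, h3⟩ ⟨k1, k2, k3⟩
      simp only [map_add, h1, h3, k1, k3]
      exact ⟨trivial, add_mem h2 k2, trivial⟩
    · intro y hy a
      have hwy : pD y ∈ L.comp (0 + 1) := by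
        rw [zero_add, mem_comp]
        rw [mem_comp] at hy
        have := (uniq (L.proj 1 y) _ _ _ (hMgr 1 _ (hu y)) (hCgr 1 _ (hv y)) (hDgr 1 _ (hw y))
          (by conv_lhs => rw [hx y]
              simp)).2.2
        rw [hy] at this
        exact this.symm
      obtain ⟨c, hc, hc0, hcd⟩ := hdsurj 0 (pD y) (hw y) hwy
      have hrc : r (pD y) = c := by rw [← hcd, hr c hc]
      have hpc : pC c = c := (hpC c hc).2.1
      rw [tm_tmul, tm_tmul, hrc]
      refine ⟨by rw [tm_tmul, hpc], ?_, by rw [d_tmul, hcd]⟩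
      rw [mem_comp, proj_tmul, (mem_comp _ _ _).1 hc0]
  case Md =>
    apply fix_ind pM hMM
    · simp
    · intro x y hx hy; simp only [map_add, hx, hy]
    · intro x hx a
      have : pM (L.d x) = L.d x := (hpM _ (hMd x (memM x hx))).1
      rw [d_tmul, tm_tmul, this]
  case Mb =>
    intro x y hx
    revert y
    revert x
    apply fix_ind pM hMM
    · simp
    · intro x y hx hy z hz; simp only [map_add, LinearMap.add_apply, hx z hz, hy z hz]
    · intro x hx a
      apply fix_ind pM hMM
      · simp
      · intro x y hx hy; simp only [map_add, hx, hy]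
      · intro y hy b
        have : pM (L.br x y) = L.br x y := (hpM _ (hMbr x (memM x hx) y (memM y hy))).1
        rw [br_tmul, tm_tmul, this]
  case FH => exact fun k x h => tm_Fil L R _ _ _ (tm_Fil L R _ _ _ h)
  case FC => exact fun k x h => tm_Fil L R _ _ _ h

end conc
end FM

/-- **Statement 7** (Fiorenza–Manetti). Let `L = M ⊕ C ⊕ D` be a DGLA with `M`
a differential graded subalgebra and `d : C → D[1]` an isomorphism of graded
vector spaces.  Then for every `A ∈ Art_K` the map
`α : MC_M(A) × (C⁰ ⊗ m_A) → MC_L(A)`, `(x,c) ↦ e^c * x`, is a bijection.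
Here `M ⊗ m_A` and `C ⊗ m_A` are realized as the images of `M ⊗ m_A`,
`C ⊗ m_A` inside `L ⊗ m_A`. -/
theorem FioMan_decomposition_bijection
    {K : Type} [Field K] [CharZero K]
    (L : PreDGLA K) (hL : L.IsDGLA) (M C D : Submodule K L.carrier)
    -- `L = M ⊕ C ⊕ D` as graded vector spaces:
    (hspan : ∀ x : L.carrier, ∃ u ∈ M, ∃ v ∈ C, ∃ w ∈ D, x = u + v + w)
    (hindep : ∀ u ∈ M, ∀ v ∈ C, ∀ w ∈ D, u + v + w = 0 → u = 0 ∧ v = 0 ∧ w = 0)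
    (hMgr : ∀ i, ∀ x ∈ M, L.proj i x ∈ M)
    (hCgr : ∀ i, ∀ x ∈ C, L.proj i x ∈ C)
    (hDgr : ∀ i, ∀ x ∈ D, L.proj i x ∈ D)
    -- `M` is a differential graded subalgebra:
    (hMd : ∀ x ∈ M, L.d x ∈ M)
    (hMbr : ∀ x ∈ M, ∀ y ∈ M, L.br x y ∈ M)
    -- `d : C → D[1]` is an isomorphism of graded vector spaces:
    (hCD : ∀ x ∈ C, L.d x ∈ D)
    (hdinj : ∀ x ∈ C, L.d x = 0 → x = 0)
    (hdsurj : ∀ i, ∀ y ∈ D, y ∈ L.comp (i + 1) → ∃ c ∈ C, c ∈ L.comp i ∧ L.d c = y)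
    (R : ArtinData K) :
    -- `α` is well defined …
    (∀ x ∈ (L.tmA R).MCset, x ∈ LinearMap.range (LinearMap.rTensor R.mId M.subtype) →
      ∀ c ∈ LinearMap.range (LinearMap.rTensor R.mId C.subtype), c ∈ (L.tmA R).comp 0 →
        (L.tmA R).gauge c x ∈ (L.tmA R).MCset) ∧
    -- … and a bijection onto `MC_L(A)`:
    (∀ y ∈ (L.tmA R).MCset,
      ∃! p : (L.tmA R).carrier × (L.tmA R).carrier,
        p.1 ∈ LinearMap.range (LinearMap.rTensor R.mId M.subtype) ∧
        p.1 ∈ (L.tmA R).MCset ∧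
        p.2 ∈ LinearMap.range (LinearMap.rTensor R.mId C.subtype) ∧
        p.2 ∈ (L.tmA R).comp 0 ∧
        (L.tmA R).gauge p.2 p.1 = y) := by
  obtain ⟨m, hg⟩ := FM.exists_good L R hL
  obtain ⟨pM, pC, pD, r, hM1, hM2, hC1, hC2, hs⟩ := FM.exists_split L R hL M C D hspan hindep
    hMgr hCgr hDgr hMd hMbr hCD hdinj hdsurj
  refine ⟨fun x hx _ c _ hc0 => FM.gauge_MC hg c hc0 x hx, fun y hy => ?_⟩
  have hmain := FM.main hg hs y hy
  have eM := FM.mem_range_iff L R pM M hM1 hM2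
  have eC := FM.mem_range_iff L R pC C hC1 hC2
  obtain ⟨p, ⟨h1, h2, h3, h4, h5⟩, hu⟩ := hmain
  refine ⟨p, ⟨(eM _).2 h1, h2, (eC _).2 h3, h4, h5⟩, ?_⟩
  rintro q ⟨k1, k2, k3, k4, k5⟩
  exact hu q ⟨(eM _).1 k1, k2, (eC _).1 k3, k4, k5⟩
end
end
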